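/- arXiv:1008.0809 — 3 statements merged into one kernel-verified Lean document; each statement's English description precedes it below -/
import Mathlib

section
/- (Julia Robinson) For every finite set S of prime numbers, the set of integers ℤ, viewed as a subset of the small ring O_{ℚ,S}, is Diophantine over O_{ℚ,S}. -/
/-- A subset `A ⊆ R^ι` (for a finite index type `ι`) is *Diophantine* over a commutative
ring `R` if there are `k ∈ ℕ` and a polynomial `p` with coefficients in `R` such that a
tuple `t` lies in `A` iff `p(t, x) = 0` has a solution `x ∈ R^k`. -/
def IsDiophantine (R : Type*) [CommRing R] (ι : Type) [Fintype ι] (A : Set (ι → R)) : Prop :=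
  ∃ (k : ℕ) (p : MvPolynomial (ι ⊕ Fin k) R),
    ∀ t : ι → R, t ∈ A ↔ ∃ x : Fin k → R, MvPolynomial.eval (Sum.elim t x) p = 0

/-- The subring `O_{ℚ,S}` of `ℚ` consisting of all rationals whose reduced denominator
is divisible only by primes belonging to `S`. -/
def ringOfPrimes (S : Set ℕ) : Subring ℚ where
  carrier := {x : ℚ | ∀ p : ℕ, p.Prime → p ∣ x.den → p ∈ S}
  zero_mem' := by intro p hp hdvd; rw [Rat.den_zero] at hdvd; exact absurd (Nat.dvd_one.mp hdvd) hp.ne_one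
  one_mem' := by intro p hp hdvd; rw [Rat.den_one] at hdvd; exact absurd (Nat.dvd_one.mp hdvd) hp.ne_one
  add_mem' := by
    intro x y hx hy p hp hdvd
    have := hdvd.trans (Rat.add_den_dvd x y)
    rcases (Nat.Prime.dvd_mul hp).1 this with h | h
    · exact hx p hp h
    · exact hy p hp h
  mul_mem' := by
    intro x y hx hy p hp hdvd
    have := hdvd.trans (Rat.mul_den_dvd x y)
    rcases (Nat.Prime.dvd_mul hp).1 this with h | h
    · exact hx p hp h
    · exact hy p hp h
  neg_mem' := by
    intro x hx p hp hdvd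
    rw [Rat.neg_den] at hdvd
    exact hx p hp hdvd

/-- A solvability criterion for `a x² + b y² = c z²`, due to Legendre. -/
theorem exists_add_sq_eq_mul_sq_of_dvd {a b c : ℕ} (ha : 0 < a) (hb : 0 < b) (hc : 0 < c)
    (hab : a.Coprime b) (hac : a.Coprime c) (hbc : b.Coprime c)
    (hab_sq : ¬ IsSquare (a * b)) (hac_sq : ¬ IsSquare (a * c)) {s u v : ℤ}
    (hs : (c : ℤ) ∣ a * s ^ 2 + b) (hu : (a : ℤ) ∣ b * u ^ 2 - c)
    (hv : (b : ℤ) ∣ a * v ^ 2 - c) :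
    ∃ x y z : ℤ, z ≠ 0 ∧ a * x ^ 2 + b * y ^ 2 = c * z ^ 2 := by
  have : NeZero a := ⟨ha.ne'⟩
  have : NeZero b := ⟨hb.ne'⟩
  have : NeZero c := ⟨hc.ne'⟩
  set A := Nat.sqrt (b * c) with hA
  set B := Nat.sqrt (a * c) with hB
  set C := Nat.sqrt (a * b) with hC
  let box : Finset (ℕ × ℕ × ℕ) :=
    Finset.range (A + 1) ×ˢ Finset.range (B + 1) ×ˢ Finset.range (C + 1)
  let f : ℕ × ℕ × ℕ → ZMod c × ZMod a × ZMod b :=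
    fun w => ((w.1 : ZMod c) - s * w.2.1, (w.2.1 : ZMod a) - u * w.2.2,
      (w.1 : ZMod b) - v * w.2.2)
  have hcard : (Finset.univ : Finset (ZMod c × ZMod a × ZMod b)).card < box.card := by
    simp only [box, Finset.card_product, Finset.card_range, Finset.card_univ, Fintype.card_prod,
      ZMod.card]
    have h1 : b * c < (A + 1) * (A + 1) := Nat.lt_succ_sqrt _
    have h2 : a * c < (B + 1) * (B + 1) := Nat.lt_succ_sqrt _
    have h3 : a * b < (C + 1) * (C + 1) := Nat.lt_succ_sqrt _
    refine lt_of_pow_lt_pow_left₀ 2 (by positivity) ?_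
    calc (c * (a * b)) ^ 2 = (b * c) * ((a * c) * (a * b)) := by ring
      _ < ((A + 1) * (A + 1)) * (((B + 1) * (B + 1)) * ((C + 1) * (C + 1))) := by gcongr
      _ = _ := by ring
  obtain ⟨w, hw, w', hw', hne, heq⟩ := Finset.exists_ne_map_eq_of_card_lt_of_maps_to
    hcard (f := f) (fun _ _ => Finset.mem_coe.2 (Finset.mem_univ _))
  obtain ⟨x₁, y₁, z₁⟩ := w
  obtain ⟨x₂, y₂, z₂⟩ := w'
  simp only [box, Finset.mem_product, Finset.mem_range, Nat.lt_succ_iff] at hw hw'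
  simp only [f, Prod.mk.injEq] at heq
  obtain ⟨e1, e2, e3⟩ := heq
  obtain ⟨x, hx⟩ : ∃ x : ℤ, x = x₁ - x₂ := ⟨_, rfl⟩
  obtain ⟨y, hy⟩ : ∃ y : ℤ, y = y₁ - y₂ := ⟨_, rfl⟩
  obtain ⟨z, hz⟩ : ∃ z : ℤ, z = z₁ - z₂ := ⟨_, rfl⟩
  have d1 : (c : ℤ) ∣ x - s * y := by
    rw [← ZMod.intCast_zmod_eq_zero_iff_dvd]
    subst hx hy; push_cast; linear_combination e1
  have d2 : (a : ℤ) ∣ y - u * z := by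
    rw [← ZMod.intCast_zmod_eq_zero_iff_dvd]
    subst hz hy; push_cast; linear_combination e2
  have d3 : (b : ℤ) ∣ x - v * z := by
    rw [← ZMod.intCast_zmod_eq_zero_iff_dvd]
    subst hz hx; push_cast; linear_combination e3
  obtain ⟨g, hg⟩ : ∃ g : ℤ, g = a * x ^ 2 + b * y ^ 2 - c * z ^ 2 := ⟨_, rfl⟩
  have g1 : (c : ℤ) ∣ g := by
    have : g = a * (x + s * y) * (x - s * y) + (a * s ^ 2 + b) * y ^ 2 - c * z ^ 2 := by
      rw [hg]; ring
    rw [this]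
    exact ((d1.mul_left _).add (hs.mul_right _)).sub (dvd_mul_right _ _)
  have g2 : (a : ℤ) ∣ g := by
    have : g = b * (y + u * z) * (y - u * z) + (b * u ^ 2 - c) * z ^ 2 + a * x ^ 2 := by
      rw [hg]; ring
    rw [this]
    exact ((d2.mul_left _).add (hu.mul_right _)).add (dvd_mul_right _ _)
  have g3 : (b : ℤ) ∣ g := by
    have : g = a * (x + v * z) * (x - v * z) + (a * v ^ 2 - c) * z ^ 2 + b * y ^ 2 := by
      rw [hg]; ring
    rw [this]
    exact ((d3.mul_left _).add (hv.mul_right _)).add (dvd_mul_right _ _)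
  have hdvd : (a * b * c : ℤ) ∣ g := by
    have cab : IsCoprime (a : ℤ) b := Nat.isCoprime_iff_coprime.2 hab
    have cac : IsCoprime (a : ℤ) c := Nat.isCoprime_iff_coprime.2 hac
    have cbc : IsCoprime (b : ℤ) c := Nat.isCoprime_iff_coprime.2 hbc
    exact (cac.mul_left cbc).mul_dvd (cab.mul_dvd g2 g3) g1
  have sq_bound : ∀ {k m₁ m₂ : ℕ}, m₁ ≤ Nat.sqrt k → m₂ ≤ Nat.sqrt k →
      ((m₁ : ℤ) - m₂) ^ 2 ≤ k := by
    intro k m₁ m₂ h1 h2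
    have h3 : ((Nat.sqrt k : ℕ) : ℤ) ^ 2 ≤ k := by exact_mod_cast Nat.sqrt_le' k
    refine le_trans (sq_le_sq' ?_ ?_) h3 <;> omega
  have bx : x ^ 2 ≤ b * c := by
    rw [hx]; exact_mod_cast sq_bound hw.1 hw'.1
  have not_sq : ∀ {k : ℕ} {m : ℤ}, ¬ IsSquare k → m ^ 2 ≤ k → m ^ 2 < k := by
    intro k m hk h
    refine lt_of_le_of_ne h fun h' => hk ⟨m.natAbs, ?_⟩
    zify
    rw [← h', ← sq, sq_abs]
  have bY : y ^ 2 < a * c := by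
    rw [hy]; exact_mod_cast not_sq hac_sq (sq_bound hw.2.1 hw'.2.1)
  have bz : z ^ 2 < a * b := by
    rw [hz]; exact_mod_cast not_sq hab_sq (sq_bound hw.2.2 hw'.2.2)
  have hnz : ¬ (x = 0 ∧ y = 0 ∧ z = 0) := by
    rintro ⟨h1, h2, h3⟩
    apply hne
    simp only [Prod.mk.injEq]
    omega
  have ha' : (0 : ℤ) < a := by exact_mod_cast ha
  have hb' : (0 : ℤ) < b := by exact_mod_cast hb
  have hc' : (0 : ℤ) < c := by exact_mod_cast hc
  obtain ⟨k, hk⟩ := hdvd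
  have habc : (0 : ℤ) < a * b * c := by positivity
  have k_lt : k < 2 := by
    have h1 : (a : ℤ) * x ^ 2 ≤ a * (b * c) := by gcongr
    have h2 : (b : ℤ) * y ^ 2 < b * (a * c) := by gcongr
    have h3 : (0 : ℤ) ≤ c * z ^ 2 := by positivity
    nlinarith
  have lt_k : -1 < k := by
    have h1 : (0 : ℤ) ≤ a * x ^ 2 := by positivity
    have h2 : (0 : ℤ) ≤ b * y ^ 2 := by positivity
    have h3 : (c : ℤ) * z ^ 2 < c * (a * b) := by gcongr
    nlinarith
  obtain rfl | rfl : k = 0 ∨ k = 1 := by omega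
  · refine ⟨x, y, z, fun h => hnz ?_, by linarith⟩
    have h0 : (a : ℤ) * x ^ 2 + b * y ^ 2 = 0 := by rw [h] at hg; linarith
    have h1 : (0 : ℤ) ≤ a * x ^ 2 := by positivity
    have h2 : (0 : ℤ) ≤ b * y ^ 2 := by positivity
    have h3 : (a : ℤ) * x ^ 2 = 0 := by linarith
    have h4 : (b : ℤ) * y ^ 2 = 0 := by linarith
    exact ⟨by simpa [ha.ne'] using h3, by simpa [hb.ne'] using h4, h⟩
  · refine ⟨x * z + b * y, y * z - a * x, z ^ 2 + a * b, by positivity, ?_⟩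
    linear_combination (z ^ 2 + a * b : ℤ) * (hk - hg)

open scoped NumberTheorySymbols in
/-- Positive integers congruent to `1` modulo `4` are represented over `ℚ` by
`x² + q y² + r z²`, when `q`, `r` and the integer are pairwise coprime. -/
theorem exists_mul_sq_eq_sq_add_mul_sq_add_mul_sq {q r n : ℕ} (hq : Odd q) (hr : Odd r)
    (hq_sq : ¬ IsSquare q) (hn : n % 4 = 1) (hqr : q.Coprime r) (hqn : q.Coprime n)
    (hrn : r.Coprime n) :
    ∃ w x y z : ℤ, w ≠ 0 ∧ (n : ℤ) * w ^ 2 = x ^ 2 + q * y ^ 2 + r * z ^ 2 := by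
  have hn0 : 0 < n := by omega
  have hn_odd : Odd n := Nat.odd_iff.2 (by omega)
  have h4q : Nat.Coprime 4 q := by
    rw [show 4 = 2 ^ 2 by norm_num]; exact (Nat.coprime_two_left.2 hq).pow_left 2
  have h4r : Nat.Coprime 4 r := by
    rw [show 4 = 2 ^ 2 by norm_num]; exact (Nat.coprime_two_left.2 hr).pow_left 2
  have h4n : Nat.Coprime 4 n := by
    rw [show 4 = 2 ^ 2 by norm_num]; exact (Nat.coprime_two_left.2 hn_odd).pow_left 2
  have c1 : (4 * q).Coprime n := h4n.mul_left hqn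
  have c2 : (4 * q * n).Coprime r := (h4r.mul_left hqr).mul_left hrn.symm
  obtain ⟨e, he1, he2⟩ := Nat.chineseRemainder c1 1 (r * (n - 1))
  obtain ⟨d, hd1, hd2⟩ := Nat.chineseRemainder c2 e n
  have hd_q : d ≡ 1 [MOD 4 * q] := (hd1.of_mul_right _).trans he1
  have hd_n : d ≡ r * (n - 1) [MOD n] := (hd1.of_mul_left _).trans he2
  have coprime_of : ∀ {m k l : ℕ}, k ≡ l [MOD m] → l.Coprime m → k.Coprime m := by
    intro m k l h h'
    rw [Nat.Coprime, h.gcd_eq]; exact h'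
  have hn1 : (n - 1).Coprime n := by
    have := (Nat.coprime_self_add_right (m := n - 1) (n := 1)).2 (by simp)
    rwa [Nat.sub_add_cancel hn0] at this
  have hd_cop : d.Coprime (4 * q * n * r) :=
    ((coprime_of hd_q (by simp)).mul_right (coprime_of hd_n (hrn.mul_left hn1))).mul_right
      (coprime_of hd2 hrn.symm)
  have : NeZero (4 * q * n * r) := ⟨by have := hq.pos; have := hr.pos; positivity⟩
  obtain ⟨l, hl_gt, hl, hld⟩ := Nat.forall_exists_prime_gt_and_modEq (4 * q * n * r) this.out hd_cop
  have : Fact l.Prime := ⟨hl⟩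
  have hl_4q : l ≡ 1 [MOD 4 * q] := ((hld.of_mul_right _).of_mul_right _).trans hd_q
  have hl_4 : l % 4 = 1 := hl_4q.of_mul_right _
  have hl_q : l ≡ 1 [MOD q] := hl_4q.of_mul_left _
  have hl_n : l ≡ r * (n - 1) [MOD n] := ((hld.of_mul_right _).of_mul_left _).trans hd_n
  have hl_r : l ≡ n [MOD r] := (hld.of_mul_left _).trans hd2
  have hl_odd : Odd l := Nat.odd_iff.2 (by omega)
  have clq : l.Coprime q := coprime_of hl_q (by simp)
  have cln : l.Coprime n := coprime_of hl_n (hrn.mul_left hn1)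
  have clr : l.Coprime r := coprime_of hl_r hrn.symm
  have hl_q' : (q : ℤ) ∣ 1 - l := by simpa using (Nat.modEq_iff_dvd.1 hl_q)
  have hl_n' : (n : ℤ) ∣ l + r := by
    have := Nat.modEq_iff_dvd.1 hl_n
    push_cast [Nat.cast_sub hn0] at this
    have h2 := (dvd_mul_right (n : ℤ) r).sub this
    ring_nf at h2 ⊢
    exact h2
  have hl_r' : (r : ℤ) ∣ n - l := Nat.modEq_iff_dvd.1 hl_r
  have jac_congr : ∀ {m : ℕ} {x y : ℤ}, (m : ℤ) ∣ y - x → J(x | m) = J(y | m) := by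
    intro m x y h
    exact jacobiSym.mod_left' (Int.modEq_iff_dvd.2 h)
  have exists_sq : ∀ {x : ℤ}, J(x | l) = 1 → ∃ s : ℤ, (l : ℤ) ∣ s ^ 2 - x := by
    intro x h
    obtain ⟨s, hs⟩ := ZMod.isSquare_of_jacobiSym_eq_one h
    obtain ⟨s, rfl⟩ := ZMod.intCast_surjective s
    refine ⟨s, ?_⟩
    rw [← ZMod.intCast_zmod_eq_zero_iff_dvd]
    push_cast
    rw [hs]; ring
  have mul_sq : ∀ {k : ℕ}, l.Coprime k → ¬ IsSquare (l * k) := by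
    rintro k hk ⟨m, hm⟩
    have h1 : l ∣ m := by
      have : l ∣ m * m := hm ▸ dvd_mul_right _ _
      exact (hl.dvd_mul.1 this).elim id id
    have h2 : l * l ∣ l * k := hm ▸ mul_dvd_mul h1 h1
    have h3 : l ∣ k := Nat.dvd_of_mul_dvd_mul_left hl.pos h2
    exact hl.one_lt.ne' (Nat.eq_one_of_dvd_coprimes hk dvd_rfl h3)
  have jq : J(-q | l) = 1 := by
    rw [jacobiSym.neg _ hl_odd, ZMod.χ₄_nat_one_mod_four hl_4, one_mul,
      jacobiSym.quadratic_reciprocity_one_mod_four' hq hl_4, jac_congr hl_q',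
      jacobiSym.one_left]
  have jn : J(n * r | l) = 1 := by
    have h1 : J((r : ℤ) | l) = J((n : ℤ) | r) := by
      rw [jacobiSym.quadratic_reciprocity_one_mod_four' hr hl_4, jac_congr hl_r']
    have h2 : J((n : ℤ) | l) = J((n : ℤ) | r) := by
      rw [jacobiSym.quadratic_reciprocity_one_mod_four hn hl_odd,
        jac_congr (y := -r) (by simpa [sub_eq_add_neg, add_comm] using hl_n'.neg_right),
        jacobiSym.neg _ hn_odd, ZMod.χ₄_nat_one_mod_four hn, one_mul,
        jacobiSym.quadratic_reciprocity_one_mod_four' hr hn]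
    rw [jacobiSym.mul_left, h1, h2, ← sq]
    exact jacobiSym.sq_one (by simpa using hrn.symm)
  obtain ⟨x, y, v, hv, hxy⟩ : ∃ x y z : ℤ, z ≠ 0 ∧ (q : ℕ) * x ^ 2 + (1 : ℕ) * y ^ 2 = l * z ^ 2 := by
    obtain ⟨s, hs⟩ := exists_sq jq
    have hinv : ∃ s : ℤ, (l : ℤ) ∣ q * s ^ 2 + 1 := by
      obtain ⟨i, j, hij⟩ := Nat.isCoprime_iff_coprime.2 clq
      refine ⟨j * s, ?_⟩
      have : (q : ℤ) * (j * s) ^ 2 + 1 = q * j ^ 2 * (s ^ 2 - -q) + l * (i * (1 + j * q)) := by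
        linear_combination (-(1 + j * q)) * hij
      rw [this]
      exact (hs.mul_left _).add (dvd_mul_right _ _)
    obtain ⟨s, hs⟩ := hinv
    exact exists_add_sq_eq_mul_sq_of_dvd hq.pos one_pos hl.pos (by simp) clq.symm (by simp)
      (by simpa using hq_sq) (by rw [mul_comm]; exact mul_sq clq) (s := s) (u := 1) (v := 0)
      (by simpa using hs) (by simpa using hl_q') (by simp)
  obtain ⟨g, z, w, hw, hgz⟩ : ∃ x y z : ℤ, z ≠ 0 ∧ (l : ℤ) * x ^ 2 + r * y ^ 2 = n * z ^ 2 := by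
    obtain ⟨s, hs⟩ := exists_sq jn
    have hinv : ∃ s : ℤ, (l : ℤ) ∣ r * s ^ 2 - n := by
      obtain ⟨i, j, hij⟩ := Nat.isCoprime_iff_coprime.2 clr
      refine ⟨j * s, ?_⟩
      have : (r : ℤ) * (j * s) ^ 2 - n =
          r * j ^ 2 * (s ^ 2 - n * r) + l * (-n * i * (1 + j * r)) := by
        linear_combination (n * (1 + j * r)) * hij
      rw [this]
      exact (hs.mul_left _).add (dvd_mul_right _ _)
    obtain ⟨u, hu⟩ := hinv
    have hinv : ∃ s : ℤ, (r : ℤ) ∣ l * s ^ 2 - n :=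
      ⟨1, by simpa using hl_r'.neg_right⟩
    obtain ⟨v, hv⟩ := hinv
    exact exists_add_sq_eq_mul_sq_of_dvd hl.pos hr.pos hn0 clr cln hrn
      (mul_sq clr) (mul_sq cln) (s := 1) (by simpa using hl_n') hu hv
  refine ⟨w * v, y * g, x * g, z * v, mul_ne_zero hw hv, ?_⟩
  push_cast at hxy
  linear_combination (-v ^ 2) * hgz - g ^ 2 * hxy

/-- Infinite descent: a property of integers that passes to a quotient by `p` holds only at `0`. -/
theorem eq_zero_of_forall_exists_eq_mul {p : ℕ} (hp : 1 < p) {P : ℤ → Prop}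
    (h : ∀ w, P w → ∃ w', w = p * w' ∧ P w') {w : ℤ} (hw : P w) : w = 0 := by
  have key : ∀ (n : ℕ) (w : ℤ), P w → (p : ℤ) ^ n ∣ w := by
    intro n
    induction n with
    | zero => simp
    | succ n ih =>
      intro w hw
      obtain ⟨w', rfl, hw'⟩ := h w hw
      rw [pow_succ']
      exact mul_dvd_mul_left _ (ih w' hw')
  refine Int.eq_zero_of_abs_lt_dvd (key w.natAbs w hw) ?_
  have := Nat.lt_pow_self hp (n := w.natAbs)
  zify at this
  exact this

/-- A quadratic form `b² + p m a²` with `p ∣ b` and `p ∤ a` is not represented by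
`x² + q y² + p z²` when `-q` and `m` are not squares modulo `p`. -/
theorem eq_zero_of_dvd_of_not_isSquare {p : ℕ} (hp : p.Prime) {q m : ℕ}
    (hq : ¬ IsSquare (-q : ZMod p)) (hm : ¬ IsSquare (m : ZMod p)) {a b : ℤ} (hb : (p : ℤ) ∣ b)
    (ha : ¬ (p : ℤ) ∣ a) {w x y z : ℤ}
    (h : (b ^ 2 + p * m * a ^ 2) * w ^ 2 = x ^ 2 + q * y ^ 2 + p * z ^ 2) : w = 0 := by
  have : Fact p.Prime := ⟨hp⟩
  have hp0 : (p : ℤ) ≠ 0 := by exact_mod_cast hp.ne_zero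
  have hpp : Prime (p : ℤ) := Nat.prime_iff_prime_int.1 hp
  have aniso : ∀ {c x y : ℤ}, ¬ IsSquare (c : ZMod p) → (p : ℤ) ∣ x ^ 2 - c * y ^ 2 →
      (p : ℤ) ∣ x ∧ (p : ℤ) ∣ y := by
    intro c x y hc h
    simp only [← ZMod.intCast_zmod_eq_zero_iff_dvd] at h ⊢
    push_cast at h
    by_cases hy : (y : ZMod p) = 0
    · rw [hy] at h ⊢; simpa using h
    · refine absurd ⟨(x : ZMod p) / y, ?_⟩ hc
      field_simp
      linear_combination -h
  refine eq_zero_of_forall_exists_eq_mul hp.one_lt (P := fun w => ∃ x y z : ℤ,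
    (b ^ 2 + p * m * a ^ 2) * w ^ 2 = x ^ 2 + q * y ^ 2 + p * z ^ 2) ?_ ⟨x, y, z, h⟩
  rintro w ⟨x, y, z, h⟩
  obtain ⟨b, rfl⟩ := hb
  obtain ⟨⟨x, rfl⟩, ⟨y, rfl⟩⟩ := aniso (c := -q) (x := x) (y := y) (by simpa using hq)
    ⟨p * b ^ 2 * w ^ 2 + m * a ^ 2 * w ^ 2 - z ^ 2, by linear_combination -h⟩
  have h' : (p * b ^ 2 + m * a ^ 2) * w ^ 2 = p * x ^ 2 + p * q * y ^ 2 + z ^ 2 :=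
    mul_left_cancel₀ hp0 (by linear_combination h)
  obtain ⟨⟨z, rfl⟩, haw⟩ := aniso (c := m) (x := z) (y := a * w) (by simpa using hm)
    ⟨b ^ 2 * w ^ 2 - x ^ 2 - q * y ^ 2, by linear_combination -h'⟩
  obtain ⟨w, rfl⟩ := (hpp.dvd_mul.1 haw).resolve_left ha
  exact ⟨w, rfl, x, y, z, mul_left_cancel₀ (pow_ne_zero 2 hp0) (by linear_combination h)⟩

/-- A form `b⁶ + 140 a⁶` with `b` even and `a` odd is not represented by `x² + 5 y² + z²`. -/
theorem eq_zero_of_two_dvd_of_odd {a b : ℤ} (hb : 2 ∣ b) (ha : ¬ 2 ∣ a) {w x y z : ℤ}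
    (h : (b ^ 6 + 140 * a ^ 6) * w ^ 2 = x ^ 2 + 5 * y ^ 2 + z ^ 2) : w = 0 := by
  have even_of_dvd : ∀ {x y z : ℤ}, (4 : ℤ) ∣ x ^ 2 + 5 * y ^ 2 + z ^ 2 →
      (2 : ℤ) ∣ x ∧ (2 : ℤ) ∣ y ∧ (2 : ℤ) ∣ z := by
    intro x y z h
    rcases Int.even_or_odd' x with ⟨x, rfl | rfl⟩ <;>
      rcases Int.even_or_odd' y with ⟨y, rfl | rfl⟩ <;>
      rcases Int.even_or_odd' z with ⟨z, rfl | rfl⟩ <;> ring_nf at h <;> omega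
  obtain ⟨b, rfl⟩ := hb
  refine eq_zero_of_forall_exists_eq_mul one_lt_two (P := fun w => ∃ x y z : ℤ,
    ((2 * b) ^ 6 + 140 * a ^ 6) * w ^ 2 = x ^ 2 + 5 * y ^ 2 + z ^ 2) ?_ ⟨x, y, z, h⟩
  rintro w ⟨x, y, z, h⟩
  obtain ⟨⟨x, rfl⟩, ⟨y, rfl⟩, ⟨z, rfl⟩⟩ := even_of_dvd (x := x) (y := y) (z := z)
    ⟨(16 * b ^ 6 + 35 * a ^ 6) * w ^ 2, by linear_combination -h⟩
  have h' : (16 * b ^ 6 + 35 * a ^ 6) * w ^ 2 = x ^ 2 + 5 * y ^ 2 + z ^ 2 := by linarith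
  rcases Int.even_or_odd' w with ⟨w, rfl | rfl⟩
  · exact ⟨w, rfl, x, y, z, by linear_combination h'⟩
  · exfalso
    have sq_cases : ∀ x : ℤ, x ^ 2 % 8 = 0 ∨ x ^ 2 % 8 = 1 ∨ x ^ 2 % 8 = 4 := by
      intro x
      have : x % 8 = 0 ∨ x % 8 = 1 ∨ x % 8 = 2 ∨ x % 8 = 3 ∨ x % 8 = 4 ∨ x % 8 = 5 ∨
        x % 8 = 6 ∨ x % 8 = 7 := by omega
      rcases this with h | h | h | h | h | h | h | h <;> simp [pow_two, Int.mul_emod, h]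
    have sq_mod : ∀ {x : ℤ}, ¬ 2 ∣ x → x ^ 2 % 8 = 1 := by
      intro x hx
      have h2 : ¬ (2 : ℤ) ∣ x ^ 2 := fun h => hx (Int.prime_two.dvd_of_dvd_pow h)
      have := sq_cases x
      omega
    have h1 : (a ^ 3 * (2 * w + 1)) ^ 2 % 8 = 1 := sq_mod fun h => by
      rcases Int.prime_two.dvd_mul.1 h with h | h
      · exact ha (Int.prime_two.dvd_of_dvd_pow h)
      · omega
    have h2 : 8 * (2 * b ^ 6 * (2 * w + 1) ^ 2) + 35 * (a ^ 3 * (2 * w + 1)) ^ 2 =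
        x ^ 2 + 5 * y ^ 2 + z ^ 2 := by linear_combination h'
    have := sq_cases x
    have := sq_cases y
    have := sq_cases z
    omega

/-- For every prime `p` there is an equation `(1 + k t ^ (2 f)) w² = x² + q y² + r z²` that is
nontrivially solvable for integral `t`, but not when `p` divides the denominator of `t`. -/
theorem exists_ternary_certificate {p : ℕ} (hp : p.Prime) : ∃ k f q r : ℕ,
    (∀ t : ℤ, ∃ w x y z : ℤ, w ≠ 0 ∧
      (1 + k * t ^ (2 * f)) * w ^ 2 = x ^ 2 + q * y ^ 2 + r * z ^ 2) ∧
    ∀ a b : ℤ, (p : ℤ) ∣ b → ¬ (p : ℤ) ∣ a → ∀ w x y z : ℤ,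
      (b ^ (2 * f) + k * a ^ (2 * f)) * w ^ 2 = x ^ 2 + q * y ^ 2 + r * z ^ 2 → w = 0 := by
  have coprime_one_add : ∀ {d k t : ℕ}, d ∣ k → d.Coprime (1 + k * t) := by
    rintro d k t ⟨e, rfl⟩
    rw [mul_assoc]; simp
  have solvable : ∀ {k q r f : ℕ}, Odd q → Odd r → ¬ IsSquare q → q.Coprime r → 4 ∣ k → q ∣ k →
      r ∣ k → ∀ t : ℤ, ∃ w x y z : ℤ, w ≠ 0 ∧
        (1 + k * t ^ (2 * f)) * w ^ 2 = x ^ 2 + q * y ^ 2 + r * z ^ 2 := by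
    intro k q r f hq hr hsq hqr h4 hqk hrk t
    have hn : (1 + k * t.natAbs ^ (2 * f)) % 4 = 1 := by
      obtain ⟨k, rfl⟩ := h4
      rw [mul_assoc]; omega
    have := exists_mul_sq_eq_sq_add_mul_sq_add_mul_sq hq hr hsq hn hqr
      (coprime_one_add hqk) (coprime_one_add hrk)
    push_cast at this
    rwa [(even_two_mul f).pow_abs] at this
  rcases hp.eq_two_or_odd' with rfl | hodd
  · refine ⟨140, 3, 5, 1, solvable (by decide) (by decide)
      Nat.prime_five.prime.not_isSquare (by decide) (by decide)
      (by decide) (by decide), fun a b hb ha w x y z h => ?_⟩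
    exact eq_zero_of_two_dvd_of_odd hb ha (x := x) (y := y) (z := z) (by simpa using h)
  · have : Fact p.Prime := ⟨hp⟩
    obtain ⟨c, hc⟩ := FiniteField.exists_nonsquare (F := ZMod p) (by
      rw [ZMod.ringChar_zmod_n]; rintro rfl; exact absurd hodd (by decide))
    have h4p : Nat.Coprime 4 p := by
      rw [show 4 = 2 ^ 2 by norm_num]; exact (Nat.coprime_two_left.2 hodd).pow_left 2
    obtain ⟨q, hq4, hqp⟩ := Nat.chineseRemainder h4p 3 (-c).val
    have hqc : (q : ZMod p) = -c := by
      rw [(ZMod.natCast_eq_natCast_iff _ _ _).2 hqp, ZMod.natCast_zmod_val]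
    replace hq4 : q % 4 = 3 := hq4
    have hq_nonsq : ¬ IsSquare (-q : ZMod p) := by rwa [hqc, neg_neg]
    have hq_cop : q.Coprime p := by
      refine ((hp.coprime_iff_not_dvd).2 fun h => hq_nonsq ?_).symm
      rw [(ZMod.natCast_eq_zero_iff _ _).2 h, neg_zero]
      exact IsSquare.zero
    refine ⟨p * (4 * q * (p - 1)), 1, q, p, solvable (Nat.odd_iff.2 (by omega)) hodd ?_ hq_cop
      ⟨p * (q * (p - 1)), by ring⟩ ⟨p * (4 * (p - 1)), by ring⟩ (dvd_mul_right _ _),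
      fun a b hb ha w x y z h => ?_⟩
    · rintro ⟨m, hm⟩
      rcases Nat.even_or_odd' m with ⟨m, rfl | rfl⟩
      · rw [hm, show 2 * m * (2 * m) = 4 * (m * m) by ring] at hq4; omega
      · rw [hm, show (2 * m + 1) * (2 * m + 1) = 4 * (m * m + m) + 1 by ring] at hq4; omega
    · refine eq_zero_of_dvd_of_not_isSquare hp hq_nonsq (m := 4 * q * (p - 1)) ?_ hb ha
        (x := x) (y := y) (z := z) (by push_cast at h ⊢; simpa using h)
      have h2 : (2 : ZMod p) ≠ 0 := by
        intro h0
        have h2 : p ∣ 2 := (ZMod.natCast_eq_zero_iff 2 p).1 (by exact_mod_cast h0)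
        rw [(Nat.prime_dvd_prime_iff_eq hp Nat.prime_two).1 h2] at hodd
        exact absurd hodd (by decide)
      have hm : ((4 * q * (p - 1) : ℕ) : ZMod p) = -q * (2 * 2) := by
        push_cast [Nat.cast_sub hp.one_le]
        rw [CharP.cast_eq_zero (ZMod p) p]; ring
      rw [hm]
      rintro ⟨s, hs⟩
      refine hq_nonsq ⟨s / 2, ?_⟩
      field_simp
      linear_combination hs

theorem IsDiophantine.inter {R : Type*} [CommRing R] [LinearOrder R] [IsStrictOrderedRing R]
    {ι : Type} [Fintype ι] {A B : Set (ι → R)} (hA : IsDiophantine R ι A)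
    (hB : IsDiophantine R ι B) : IsDiophantine R ι (A ∩ B) := by
  obtain ⟨k, p, hp⟩ := hA
  obtain ⟨l, q, hq⟩ := hB
  refine ⟨k + l, (MvPolynomial.rename (Sum.map id (Fin.castAdd l)) p) ^ 2 +
    (MvPolynomial.rename (Sum.map id (Fin.natAdd k)) q) ^ 2, fun t => ?_⟩
  have hleft : ∀ x : Fin (k + l) → R, Sum.elim t x ∘ Sum.map id (Fin.castAdd l) =
      Sum.elim t (x ∘ Fin.castAdd l) := by
    intro x; ext i; cases i <;> rfl
  have hright : ∀ x : Fin (k + l) → R, Sum.elim t x ∘ Sum.map id (Fin.natAdd k) =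
      Sum.elim t (x ∘ Fin.natAdd k) := by
    intro x; ext i; cases i <;> rfl
  simp only [Set.mem_inter_iff, hp, hq, map_add, map_pow, MvPolynomial.eval_rename, hleft, hright]
  constructor
  · rintro ⟨⟨x, hx⟩, y, hy⟩
    refine ⟨Fin.append x y, ?_⟩
    have h1 : Fin.append x y ∘ Fin.castAdd l = x := by ext i; simp
    have h2 : Fin.append x y ∘ Fin.natAdd k = y := by ext i; simp
    rw [h1, h2, hx, hy]; simp
  · rintro ⟨x, hx⟩
    rw [add_eq_zero_iff_of_nonneg (sq_nonneg _) (sq_nonneg _)] at hx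
    exact ⟨⟨_, pow_eq_zero_iff two_ne_zero |>.1 hx.1⟩, ⟨_, pow_eq_zero_iff two_ne_zero |>.1 hx.2⟩⟩

theorem isDiophantine_setOf_exists_ternary (R : Type*) [CommRing R] (k f q r : ℕ) :
    IsDiophantine R (Fin 1) {t | ∃ a b c d x y z : R,
      (1 + k * t 0 ^ (2 * f)) * (1 + a ^ 2 + b ^ 2 + c ^ 2 + d ^ 2) ^ 2 =
        x ^ 2 + q * y ^ 2 + r * z ^ 2} := by
  let X : Fin 7 → MvPolynomial (Fin 1 ⊕ Fin 7) R := fun i => MvPolynomial.X (Sum.inr i)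
  refine ⟨7, (1 + (k : MvPolynomial _ R) * MvPolynomial.X (Sum.inl 0) ^ (2 * f)) *
    (1 + X 0 ^ 2 + X 1 ^ 2 + X 2 ^ 2 + X 3 ^ 2) ^ 2 -
      (X 4 ^ 2 + (q : MvPolynomial _ R) * X 5 ^ 2 + (r : MvPolynomial _ R) * X 6 ^ 2),
    fun t => ?_⟩
  simp only [X, Set.mem_ofPred_eq, map_sub, map_add, map_mul, map_pow, map_one, map_natCast,
    MvPolynomial.eval_X, Sum.elim_inl, Sum.elim_inr, sub_eq_zero]
  constructor
  · rintro ⟨a, b, c, d, x, y, z, h⟩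
    exact ⟨![a, b, c, d, x, y, z], h⟩
  · rintro ⟨v, h⟩
    exact ⟨_, _, _, _, _, _, _, h⟩

/-- Over a subring of `ℚ`, the integers are separated from the elements whose denominator is
divisible by a given prime by a Diophantine set. -/
theorem exists_isDiophantine_of_prime (R : Subring ℚ) {p : ℕ} (hp : p.Prime) :
    ∃ A : Set (Fin 1 → R), IsDiophantine R (Fin 1) A ∧
      (∀ t : Fin 1 → R, (∃ n : ℤ, (t 0 : ℚ) = n) → t ∈ A) ∧
      ∀ t ∈ A, ¬ p ∣ (t 0 : ℚ).den := by
  obtain ⟨k, f, q, r, hsolv, hanis⟩ := exists_ternary_certificate hp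
  refine ⟨_, isDiophantine_setOf_exists_ternary R k f q r, ?_, ?_⟩
  · rintro t ⟨n, hn⟩
    obtain ⟨w, x, y, z, hw, h⟩ := hsolv n
    obtain ⟨a, b, c, d, habcd⟩ := Nat.sum_four_squares (w.natAbs - 1)
    have hw' : (1 + a ^ 2 + b ^ 2 + c ^ 2 + d ^ 2 : ℤ) = |w| := by
      rw [Int.abs_eq_natAbs, show w.natAbs = 1 + (a ^ 2 + b ^ 2 + c ^ 2 + d ^ 2) by omega]
      push_cast; ring
    have ht : t 0 = (n : R) := Subtype.ext (by simpa using hn)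
    refine ⟨a, b, c, d, x, y, z, ?_⟩
    rw [ht]
    have h' : (1 + k * n ^ (2 * f)) * (1 + a ^ 2 + b ^ 2 + c ^ 2 + d ^ 2 : ℤ) ^ 2 =
        x ^ 2 + q * y ^ 2 + r * z ^ 2 := by rw [hw', sq_abs, h]
    exact_mod_cast congrArg (Int.cast : ℤ → R) h'
  · rintro t ⟨a, b, c, d, x, y, z, h⟩ hdvd
    replace h := congrArg (Subtype.val : R → ℚ) h
    push_cast at h
    obtain ⟨s, hs⟩ : ∃ s : ℚ, s = t 0 := ⟨_, rfl⟩
    obtain ⟨w, hw⟩ : ∃ w : ℚ, w = 1 + (a : ℚ) ^ 2 + (b : ℚ) ^ 2 + (c : ℚ) ^ 2 + (d : ℚ) ^ 2 :=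
      ⟨_, rfl⟩
    obtain ⟨x, hx⟩ : ∃ x' : ℚ, x' = x := ⟨_, rfl⟩
    obtain ⟨y, hy⟩ : ∃ y' : ℚ, y' = y := ⟨_, rfl⟩
    obtain ⟨z, hz⟩ : ∃ z' : ℚ, z' = z := ⟨_, rfl⟩
    have hw0 : w ≠ 0 := by rw [hw]; positivity
    rw [← hs, ← hw, ← hx, ← hy, ← hz] at h
    rw [← hs] at hdvd
    have hnum : ¬ (p : ℤ) ∣ s.num := fun h' => hp.one_lt.ne'
      (Nat.eq_one_of_dvd_coprimes s.reduced (Int.natCast_dvd.1 h') hdvd)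
    refine hw0 ?_
    have hmul : (w.num * x.den * y.den * z.den : ℤ) = 0 := by
      refine hanis s.num s.den (by exact_mod_cast hdvd) hnum _
        (s.den ^ f * w.den * x.num * y.den * z.den) (s.den ^ f * w.den * x.den * y.num * z.den)
        (s.den ^ f * w.den * x.den * y.den * z.num) ?_
      have es : (s.num : ℚ) = s * s.den := (Rat.mul_den_eq_num s).symm
      have ew : (w.num : ℚ) = w * w.den := (Rat.mul_den_eq_num w).symm
      have ex : (x.num : ℚ) = x * x.den := (Rat.mul_den_eq_num x).symm
      have ey : (y.num : ℚ) = y * y.den := (Rat.mul_den_eq_num y).symm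
      have ez : (z.num : ℚ) = z * z.den := (Rat.mul_den_eq_num z).symm
      rw [← Int.cast_inj (α := ℚ)]
      push_cast
      rw [es, ew, ex, ey, ez]
      simp only [mul_pow, ← pow_mul, mul_comm 2 f]
      rw [mul_comm 2 f] at h
      linear_combination
        ((s.den : ℚ) ^ (f * 2) * w.den ^ 2 * x.den ^ 2 * y.den ^ 2 * z.den ^ 2) * h
    simpa using hmul

/-- (Julia Robinson) For every finite set `S` of primes, the set of integers `ℤ`,
viewed as a subset of the small ring `O_{ℚ,S}`, is Diophantine over `O_{ℚ,S}`. -/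
theorem int_diophantine_over_small_ring (S : Set ℕ) (hS : ∀ p ∈ S, p.Prime)
    (hfin : S.Finite) :
    IsDiophantine (ringOfPrimes S) (Fin 1)
      {t | ∃ n : ℤ, (t 0 : ℚ) = (n : ℚ)} := by
  have key : ∀ T : Set ℕ, T.Finite → (∀ p ∈ T, p.Prime) →
      ∃ A : Set (Fin 1 → ringOfPrimes S), IsDiophantine (ringOfPrimes S) (Fin 1) A ∧
        (∀ t : Fin 1 → ringOfPrimes S, (∃ n : ℤ, (t 0 : ℚ) = n) → t ∈ A) ∧
        ∀ t ∈ A, ∀ p ∈ T, ¬ p ∣ (t 0 : ℚ).den := by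
    intro T hT
    induction T, hT using Set.Finite.induction_on with
    | empty => exact fun _ => ⟨Set.univ, ⟨0, 0, by simp⟩, by simp, by simp⟩
    | @insert p T _ _ ih =>
      intro hprime
      obtain ⟨A, hA, hA_int, hA_den⟩ := ih fun l hl => hprime l (Set.mem_insert_of_mem _ hl)
      obtain ⟨B, hB, hB_int, hB_den⟩ :=
        exists_isDiophantine_of_prime (ringOfPrimes S) (hprime p (Set.mem_insert _ _))
      refine ⟨A ∩ B, hA.inter hB, fun t ht => ⟨hA_int t ht, hB_int t ht⟩, ?_⟩
      rintro t ⟨htA, htB⟩ l (rfl | hl)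
      · exact hB_den t htB
      · exact hA_den t htA l hl
  obtain ⟨A, hA, hA_int, hA_den⟩ := key S hfin hS
  convert hA using 1
  ext t
  refine ⟨hA_int t, fun ht => ⟨(t 0 : ℚ).num, ?_⟩⟩
  refine ((Rat.den_eq_one_iff _).1 ?_).symm
  by_contra hne
  obtain ⟨p, hp, hdvd⟩ := Nat.exists_prime_and_dvd hne
  exact hA_den t ht p ((t 0).2 p hp hdvd) hdvd
end

section
/- (Eisenträger–Everest) There exist computable (recursive) sets S and T of prime numbers that are exactly complementary — i.e., S ∪ T is the set of all primes and S ∩ T = ∅ — such that each of the rings O_{ℚ,S} and O_{ℚ,T} possesses a Diophantine subset that is not computable; consequently Hilbert's Tenth Problem is undecidable for both rings O_{ℚ,S} and O_{ℚ,T}. -/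
open Encodable

theorem primrecRel_dvd : PrimrecRel ((· ∣ ·) : ℕ → ℕ → Prop) :=
  (Primrec.eq.comp (Primrec.nat_mod.comp .snd .fst) (.const 0)).of_eq
    fun _ => (Nat.dvd_iff_mod_eq_zero ..).symm

theorem primrecRel_coprime : PrimrecRel Nat.Coprime := by
  have h : PrimrecRel fun (d : ℕ) (x : ℕ × ℕ) => d ∣ x.1 → d ∣ x.2 → d = 1 :=
    ((primrecRel_dvd.comp .fst (Primrec.fst.comp .snd)).not.or
      ((primrecRel_dvd.comp .fst (Primrec.snd.comp .snd)).not.or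
        (Primrec.eq.comp .fst (.const 1)))).of_eq fun x => by tauto
  have h' := h.forall_mem_list.comp (Primrec.list_range.comp
    (Primrec.nat_add.comp (Primrec.nat_add.comp .fst .snd) (.const 2))) .id
  refine h'.of_eq fun x => ?_
  simp only [List.mem_range, id]
  refine ⟨fun H => ?_, fun H d _ h1 h2 => Nat.eq_one_of_dvd_coprimes H h1 h2⟩
  rcases Nat.eq_zero_or_pos (x.1 + x.2) with h0 | h0
  · have := H 0 (by omega) ⟨0, by simp; omega⟩ ⟨0, by simp; omega⟩
    omega
  · refine H _ ?_ (Nat.gcd_dvd_left _ _) (Nat.gcd_dvd_right _ _)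
    rcases Nat.eq_zero_or_pos x.1 with h1 | h1
    · have := Nat.gcd_le_right (m := x.1) (n := x.2) (by omega)
      omega
    · have := Nat.gcd_le_left (m := x.1) x.2 h1
      omega

theorem primrecPred_prime : PrimrecPred Nat.Prime := by
  have h : PrimrecRel fun (d p : ℕ) => d ∣ p → d = 1 :=
    (primrecRel_dvd.not.or (Primrec.eq.comp .fst (.const 1))).of_eq fun x => by tauto
  refine ((Primrec.nat_le.comp (.const 2) .id).and (h.forall_lt.comp .id .id)).of_eq fun p => ?_
  rw [Nat.prime_def_lt]
  rfl

theorem Int.natAbs_eq_encode_div (z : ℤ) : z.natAbs = (encode z + 1) / 2 := by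
  cases z with
  | ofNat n =>
    have : encode (Int.ofNat n) = 2 * n := rfl
    simp only [Int.natAbs, this]
    omega
  | negSucc n =>
    have : encode (Int.negSucc n) = 2 * n + 1 := rfl
    simp only [Int.natAbs, this]
    omega

theorem Rat.mem_range_encode_iff (j : ℕ) : j ∈ Set.range Rat.instEncodable.encode ↔
    0 < j.unpair.2 ∧ ((j.unpair.1 + 1) / 2).Coprime j.unpair.2 := by
  have henc (q : ℚ) : Rat.instEncodable.encode q = Nat.pair (encode q.num) q.den := rfl
  constructor
  · rintro ⟨q, rfl⟩
    rw [henc, Nat.unpair_pair, ← Int.natAbs_eq_encode_div]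
    exact ⟨q.den_pos, q.reduced⟩
  · rintro ⟨h1, h2⟩
    let z : ℤ := Denumerable.ofNat ℤ j.unpair.1
    have hz : encode z = j.unpair.1 := Denumerable.encode_ofNat _
    rw [← hz, ← Int.natAbs_eq_encode_div] at h2
    refine ⟨⟨z, j.unpair.2, h1.ne', h2⟩, ?_⟩
    rw [henc]
    simp only [hz, Nat.pair_unpair]

theorem Rat.encode_eq_length_filter (q : ℚ) :
    Rat.instDenumerable.encode q = ((List.range (Rat.instEncodable.encode q)).filter fun j =>
      0 < j.unpair.2 ∧ ((j.unpair.1 + 1) / 2).Coprime j.unpair.2).length := by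
  let := Rat.instEncodable
  let := @decidableRangeEncode ℚ _
  have h : Rat.instDenumerable.encode q = (List.range (Rat.instEncodable.encode q)).countP
      (· ∈ Set.range (@encode ℚ Rat.instEncodable)) := rfl
  rw [h, List.countP_eq_length_filter]
  congr 2
  funext j
  simp only [Rat.mem_range_encode_iff]

theorem Rat.primrec_natCast : Primrec (Nat.cast : ℕ → ℚ) := by
  have hp : PrimrecPred fun j : ℕ =>
      0 < j.unpair.2 ∧ ((j.unpair.1 + 1) / 2).Coprime j.unpair.2 :=
    (Primrec.nat_lt.comp (.const 0) (Primrec.snd.comp .unpair)).and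
      (primrecRel_coprime.comp (Primrec.nat_div.comp
        (Primrec.succ.comp (Primrec.fst.comp .unpair)) (.const 2))
        (Primrec.snd.comp .unpair))
  refine Primrec.encode_iff.1 (Primrec.of_eq (Primrec.list_length.comp
    ((Primrec.listFilter hp).comp (Primrec.list_range.comp
      (Primrec₂.natPair.comp (Primrec.nat_mul.comp (.const 2) .id) (.const 1))))) fun n => ?_)
  exact (Rat.encode_eq_length_filter n).symm

theorem ComputablePred.and {α : Type*} [Primcodable α] {p q : α → Prop} (hp : ComputablePred p)
    (hq : ComputablePred q) : ComputablePred fun x => p x ∧ q x := by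
  obtain ⟨_, hp⟩ := hp
  obtain ⟨_, hq⟩ := hq
  exact ⟨inferInstance, (Primrec.and.to_comp.comp hp hq).of_eq fun x => by simp⟩

theorem ComputablePred.or {α : Type*} [Primcodable α] {p q : α → Prop} (hp : ComputablePred p)
    (hq : ComputablePred q) : ComputablePred fun x => p x ∨ q x :=
  (hp.not.and hq.not).not.of_eq fun x => by tauto

/-- `x` is a prime in the class of `c` modulo `24` and, for all `i`, in the class of `e i` modulo
the `i`-th entry of `L`; here `c` and `e` depend on the length of `L`. -/
def IsNextPrime (c : ℕ → ℕ) (e : ℕ → ℕ → ℕ) (L : List ℕ) (x : ℕ) : Prop :=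
  x.Prime ∧ x ≡ c L.length [MOD 24] ∧ ∀ i < L.length, x ≡ e L.length i [MOD L.getD i 0]

section Sequence

variable {c : ℕ → ℕ} {e : ℕ → ℕ → ℕ}

theorem primrecRel_isNextPrime (hc : Primrec c) (he : Primrec₂ e) :
    PrimrecRel (IsNextPrime c e) := by
  have h : PrimrecRel fun (i : ℕ) (a : List ℕ × ℕ) =>
      a.2 ≡ e a.1.length i [MOD a.1.getD i 0] := by
    have hget : Primrec fun t : ℕ × (List ℕ × ℕ) => t.2.1.getD t.1 0 :=
      (Primrec.list_getD 0).comp (Primrec.fst.comp .snd) .fst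
    exact Primrec.eq.comp (Primrec.nat_mod.comp (Primrec.snd.comp .snd) hget)
      (Primrec.nat_mod.comp (he.comp (Primrec.list_length.comp (Primrec.fst.comp .snd)) .fst) hget)
  have h' := h.forall_mem_list.comp
    (Primrec.list_range.comp (Primrec.list_length.comp (.fst (β := ℕ)))) .id
  refine ((primrecPred_prime.comp .snd).and ((Primrec.eq.comp
    (Primrec.nat_mod.comp .snd (.const 24)) (Primrec.nat_mod.comp
      (hc.comp (Primrec.list_length.comp .fst)) (.const 24))).and h')).of_eq fun x => ?_
  simp only [List.mem_range, id]
  rfl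

open Classical in
/-- The least `x` with `IsNextPrime c e L x`, or `0` if there is none. -/
noncomputable def nextPrime (c : ℕ → ℕ) (e : ℕ → ℕ → ℕ) (L : List ℕ) : ℕ :=
  if h : ∃ x, IsNextPrime c e L x then Nat.find h else 0

/-- The list of the first `k` terms of the greedy sequence of primes. -/
noncomputable def greedyList (c : ℕ → ℕ) (e : ℕ → ℕ → ℕ) : ℕ → List ℕ
  | 0 => []
  | k + 1 => greedyList c e k ++ [nextPrime c e (greedyList c e k)]

/-- The greedy sequence of primes with `a k ≡ c k [MOD 24]` and `a k ≡ e k i [MOD a i]`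
for `i < k`. -/
noncomputable def greedyPrime (c : ℕ → ℕ) (e : ℕ → ℕ → ℕ) (k : ℕ) : ℕ :=
  nextPrime c e (greedyList c e k)

theorem greedyList_eq_map (k : ℕ) :
    greedyList c e k = (List.range k).map (greedyPrime c e) := by
  induction k with
  | zero => rfl
  | succ k ih => rw [List.range_succ, List.map_append, ← ih]; rfl

theorem isNextPrime_greedyList_iff {k x : ℕ} : IsNextPrime c e (greedyList c e k) x ↔
    x.Prime ∧ x ≡ c k [MOD 24] ∧ ∀ i < k, x ≡ e k i [MOD greedyPrime c e i] := by
  rw [IsNextPrime, greedyList_eq_map, List.length_map, List.length_range]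
  refine and_congr_right fun _ => and_congr_right fun _ => forall₂_congr fun i hi => ?_
  simp [hi]

theorem five_le_of_prime_of_modEq {p c : ℕ} (hp : p.Prime) (h : p ≡ c [MOD 24])
    (hc : c.Coprime 24) : 5 ≤ p := by
  have hco : p.Coprime 24 := by rw [Nat.Coprime, h.gcd_eq, hc]
  by_contra! hlt
  interval_cases p <;> revert hp hco <;> decide

theorem lt_of_prime_of_modEq {p q c e : ℕ} (hp : p.Prime) (h : p ≡ c [MOD 24])
    (hc : c.Coprime 24) (hq : 5 ≤ q) (hpq : p ≡ e [MOD q]) (he : 0 < e) (he' : e ≤ 3) : q < p := by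
  have h5 := five_le_of_prime_of_modEq hp h hc
  rw [Nat.ModEq, Nat.mod_eq_of_lt (by omega : e < q)] at hpq
  rcases lt_trichotomy p q with hlt | rfl | hlt
  · rw [Nat.mod_eq_of_lt hlt] at hpq
    omega
  · rw [Nat.mod_self] at hpq
    omega
  · exact hlt

theorem isNextPrime_greedyPrime (hc : ∀ k, (c k).Coprime 24)
    (he : ∀ k i, 0 < e k i ∧ e k i ≤ 3) (k : ℕ) :
    IsNextPrime c e (greedyList c e k) (greedyPrime c e k) := by
  induction k using Nat.strong_induction_on with
  | _ k ih =>
  suffices h : ∃ x, IsNextPrime c e (greedyList c e k) x by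
    classical
    rw [greedyPrime, nextPrime, dif_pos h]
    exact Nat.find_spec h
  set a := greedyPrime c e
  simp only [isNextPrime_greedyList_iff] at ih ⊢
  have h5 : ∀ i < k, 5 ≤ a i := fun i hi =>
    five_le_of_prime_of_modEq (ih i hi).1 (ih i hi).2.1 (hc i)
  have hlt : ∀ i j, i < j → j < k → a i < a j := fun i j hij hj =>
    lt_of_prime_of_modEq (ih j hj).1 (ih j hj).2.1 (hc j) (h5 i (hij.trans hj))
      ((ih j hj).2.2 i hij) (he j i).1 (he j i).2
  have hne : ∀ i < k, ∀ j < k, i ≠ j → a i ≠ a j := fun i hi j hj hij => by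
    rcases lt_or_gt_of_ne hij with h | h
    · exact (hlt i j h hj).ne
    · exact (hlt j i h hi).ne'
  obtain ⟨y, hy⟩ := Nat.chineseRemainderOfFinset (e k) a (Finset.range k)
    (fun i hi => by have := h5 i (Finset.mem_range.1 hi); omega)
    (fun i hi j hj hij => (Nat.coprime_primes (ih i (by simpa using hi)).1
      (ih j (by simpa using hj)).1).2 (hne i (by simpa using hi) j (by simpa using hj) hij))
  have hcop : Nat.Coprime 24 (∏ i ∈ Finset.range k, a i) := by
    refine Nat.Coprime.prod_right fun i hi => Nat.Coprime.symm ?_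
    rw [Nat.Coprime, (ih i (Finset.mem_range.1 hi)).2.1.gcd_eq]
    exact hc i
  obtain ⟨z, hz1, hz2⟩ := Nat.chineseRemainder hcop (c k) y
  have hzi : ∀ i < k, z ≡ e k i [MOD a i] := fun i hi =>
    (hz2.of_dvd (Finset.dvd_prod_of_mem a (Finset.mem_range.2 hi))).trans
      (hy i (Finset.mem_range.2 hi))
  have hzcop : z.Coprime (24 * ∏ i ∈ Finset.range k, a i) := by
    refine Nat.Coprime.mul_right (by rw [Nat.Coprime, hz1.gcd_eq]; exact hc k) ?_
    refine Nat.Coprime.prod_right fun i hi => ?_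
    have hi := Finset.mem_range.1 hi
    rw [Nat.Coprime, (hzi i hi).gcd_eq]
    exact (Nat.coprime_of_lt_prime (he k i).1.ne' (by have := h5 i hi; have := he k i; omega)
      (ih i hi).1).symm
  have hM : 24 * ∏ i ∈ Finset.range k, a i ≠ 0 :=
    mul_ne_zero (by norm_num) (Finset.prod_ne_zero_iff.2 fun i hi =>
      (ih i (Finset.mem_range.1 hi)).1.ne_zero)
  obtain ⟨p, -, hp, hpz⟩ := Nat.forall_exists_prime_gt_and_modEq 0 hM hzcop
  refine ⟨p, hp, (hpz.of_dvd (dvd_mul_right _ _)).trans hz1, fun i hi => ?_⟩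
  exact (hpz.of_dvd ((Finset.dvd_prod_of_mem a (Finset.mem_range.2 hi)).trans
    (dvd_mul_left _ _))).trans (hzi i hi)

theorem strictMono_greedyPrime (hc : ∀ k, (c k).Coprime 24)
    (he : ∀ k i, 0 < e k i ∧ e k i ≤ 3) : StrictMono (greedyPrime c e) := by
  have h := fun k => isNextPrime_greedyList_iff.1 (isNextPrime_greedyPrime hc he k)
  intro i j hij
  exact lt_of_prime_of_modEq (h j).1 (h j).2.1 (hc j)
    (five_le_of_prime_of_modEq (h i).1 (h i).2.1 (hc i)) ((h j).2.2 i hij) (he j i).1 (he j i).2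

theorem computable_greedyList (hc : ∀ k, (c k).Coprime 24)
    (he : ∀ k i, 0 < e k i ∧ e k i ≤ 3) (hcp : Primrec c) (hep : Primrec₂ e) :
    Computable (greedyList c e) := by
  classical
  let h : ℕ → ℕ × List ℕ →. List ℕ := fun _ t =>
    (Nat.rfind fun x => Part.some (decide (IsNextPrime c e t.2 x))).map fun x => t.2 ++ [x]
  have hP : Partrec₂ h := by
    refine Partrec.map (Partrec.rfind ?_)
      (Primrec.list_concat.comp (Primrec.snd.comp (Primrec.snd.comp .fst)) .snd).to₂.to_comp
    exact ((primrecRel_isNextPrime hcp hep).decide.comp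
      (Primrec.snd.comp (Primrec.snd.comp .fst)) .snd).to_comp
  refine (Partrec.nat_rec Computable.id (Computable.const []).partrec hP).of_eq fun k => ?_
  induction k with
  | zero => rfl
  | succ k ih =>
    simp only [id, PFun.coe_val] at ih ⊢
    rw [ih, Part.bind_some]
    have hex : ∃ x, IsNextPrime c e (greedyList c e k) x := ⟨_, isNextPrime_greedyPrime hc he k⟩
    refine Part.eq_some_iff.2 (Part.mem_map_iff _ |>.2 ⟨nextPrime c e (greedyList c e k), ?_, rfl⟩)
    rw [nextPrime, dif_pos hex]
    refine Nat.mem_rfind.2 ⟨?_, fun hm => ?_⟩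
    · simpa using Nat.find_spec hex
    · simpa using Nat.find_min hex hm

end Sequence

theorem Nat.isSquare_cast_of_odd_padicValNat {R : Type*} [CommSemiring R] {n : ℕ} (hn : n ≠ 0)
    (h : ∀ p : ℕ, p.Prime → p ∣ n → Odd (padicValNat p n) → IsSquare (p : R)) :
    IsSquare (n : R) := by
  rw [← Nat.prod_factorization_pow_eq_self hn, Finsupp.prod, Nat.cast_prod]
  refine Finset.prod_induction _ _ (fun _ _ ha hb => ha.mul hb) IsSquare.one fun p hp => ?_
  have hp' := Nat.prime_of_mem_primeFactors hp
  rw [Nat.factorization_def n hp', Nat.cast_pow]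
  rcases Nat.even_or_odd (padicValNat p n) with he | ho
  · exact he.isSquare_pow _
  · exact (h p hp' (Nat.dvd_of_mem_primeFactors hp) ho).pow _

theorem Int.isSquare_neg_of_odd_padicValInt {p : ℕ} [Fact p.Prime] {q n z x y : ℤ} (hn : n ≠ 0)
    (hz : z ≠ 0) (h : n * z ^ 2 = x ^ 2 + q * y ^ 2) (hodd : Odd (padicValInt p n)) :
    IsSquare ((-q : ℤ) : ZMod p) := by
  by_contra hsq
  have hxy : Int.gcd x y ≠ 0 := fun h0 => by
    obtain ⟨rfl, rfl⟩ := Int.gcd_eq_zero_iff.1 h0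
    simp [hn, hz] at h
  obtain ⟨g, x', y', hg, hco, rfl, rfl⟩ := Int.exists_gcd_one' (Nat.pos_of_ne_zero hxy)
  set m := x' ^ 2 + q * y' ^ 2 with hm
  have hgm : n * z ^ 2 = g ^ 2 * m := by rw [h, hm]; ring
  have hpm : ¬ (p : ℤ) ∣ m := by
    intro hd
    have h0 : (x' : ZMod p) ^ 2 + q * (y' : ZMod p) ^ 2 = 0 := by
      have := (ZMod.intCast_zmod_eq_zero_iff_dvd m p).2 hd
      rw [hm] at this
      exact_mod_cast this
    have hy : (y' : ZMod p) = 0 := by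
      by_contra hy
      refine hsq ⟨x' / y', ?_⟩
      push_cast
      field_simp
      linear_combination -h0
    have hx : (x' : ZMod p) = 0 := by simpa [hy] using h0
    rw [ZMod.intCast_zmod_eq_zero_iff_dvd] at hx hy
    have := Int.dvd_coe_gcd hx hy
    rw [hco] at this
    exact (Fact.out : p.Prime).not_dvd_one (by exact_mod_cast this)
  have hm0 : m ≠ 0 := fun h0 => hpm (h0 ▸ dvd_zero _)
  have hg0 : (g : ℤ) ≠ 0 := by exact_mod_cast hg.ne'
  have hv := congrArg (padicValInt p) hgm
  rw [padicValInt.mul hn (pow_ne_zero 2 hz), padicValInt.mul (pow_ne_zero 2 hg0) hm0,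
    pow_two, pow_two, padicValInt.mul hz hz, padicValInt.mul hg0 hg0,
    padicValInt.eq_zero_of_not_dvd hpm] at hv
  obtain ⟨t, ht⟩ := hodd
  omega

/-- The case of **Legendre's theorem** on ternary quadratic forms needed below. -/
theorem exists_prime_mul_sq_eq_sq_add_prime_mul_sq {p q : ℕ} [hp : Fact p.Prime]
    [hq : Fact q.Prime] (hpq : p ≠ q) (hqp : IsSquare (-q : ZMod p))
    (hpq' : IsSquare (p : ZMod q)) :
    ∃ x y z : ℤ, z ≠ 0 ∧ p * z ^ 2 = x ^ 2 + q * y ^ 2 := by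
  obtain ⟨α, hα⟩ := hqp
  obtain ⟨β, hβ⟩ := hpq'
  have hp0 : (0 : ℤ) < p := by exact_mod_cast hp.out.pos
  have hq0 : (0 : ℤ) < q := by exact_mod_cast hq.out.pos
  let f : Fin (Nat.sqrt (p * q) + 1) × Fin (Nat.sqrt p + 1) × Fin (Nat.sqrt q + 1) →
      ZMod p × ZMod q :=
    fun t => ((t.1 : ℕ) - α * (t.2.1 : ℕ), (t.1 : ℕ) - β * (t.2.2 : ℕ))
  have hcard : Fintype.card (ZMod p × ZMod q) < Fintype.card
      (Fin (Nat.sqrt (p * q) + 1) × Fin (Nat.sqrt p + 1) × Fin (Nat.sqrt q + 1)) := by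
    simp only [Fintype.card_prod, ZMod.card, Fintype.card_fin]
    have h1 := Nat.lt_succ_sqrt' (p * q)
    have h2 := Nat.lt_succ_sqrt' p
    have h3 := Nat.lt_succ_sqrt' q
    refine lt_of_pow_lt_pow_left₀ 2 (Nat.zero_le _) ?_
    calc (p * q) ^ 2 = (p * q) * (p * q) := by ring
      _ < (p * q).sqrt.succ ^ 2 * (p.sqrt.succ ^ 2 * q.sqrt.succ ^ 2) :=
        Nat.mul_lt_mul'' h1 (Nat.mul_lt_mul'' h2 h3)
      _ = _ := by simp only [Nat.succ_eq_add_one]; ring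
  obtain ⟨⟨a, b, c⟩, ⟨a', b', c'⟩, hne, heq⟩ := Fintype.exists_ne_map_eq_of_card_lt f hcard
  simp only [f, Prod.mk.injEq] at heq
  have hbound : ∀ {n : ℕ} (i j : Fin (Nat.sqrt n + 1)), ((i : ℤ) - j) ^ 2 ≤ n := by
    intro n i j
    have hi : (i : ℤ) ≤ Nat.sqrt n := by exact_mod_cast Nat.lt_succ_iff.1 i.2
    have hj : (j : ℤ) ≤ Nat.sqrt n := by exact_mod_cast Nat.lt_succ_iff.1 j.2
    have hn : (Nat.sqrt n : ℤ) ^ 2 ≤ n := by exact_mod_cast Nat.sqrt_le' n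
    refine (sq_le_sq.2 ?_).trans hn
    rw [abs_of_nonneg (by positivity : (0 : ℤ) ≤ Nat.sqrt n), abs_le]
    constructor <;> omega
  have hsq : ∀ {r : ℕ}, r.Prime → ∀ t : ℤ, t ^ 2 ≠ r := fun {r} hr t ht => by
    have h' : r = t.natAbs ^ 2 := by
      have : ((t.natAbs ^ 2 : ℕ) : ℤ) = r := by simpa using ht
      exact_mod_cast this.symm
    exact hr.prime.not_isSquare ⟨t.natAbs, by rw [h', sq]⟩
  set x : ℤ := (a : ℤ) - a' with hx
  set y : ℤ := (b : ℤ) - b' with hy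
  set z : ℤ := (c : ℤ) - c' with hz
  have hx2 : x ^ 2 ≤ p * q := (hbound a a').trans_eq (Nat.cast_mul p q)
  have hy2 : y ^ 2 < p := lt_of_le_of_ne (hbound b b') (hsq hp.out y)
  have hz2 : z ^ 2 < q := lt_of_le_of_ne (hbound c c') (hsq hq.out z)
  have hnz : ¬ (x = 0 ∧ y = 0 ∧ z = 0) := by
    rintro ⟨h1, h2, h3⟩
    apply hne
    have h1' : (a : ℕ) = a' := by omega
    have h2' : (b : ℕ) = b' := by omega
    have h3' : (c : ℕ) = c' := by omega
    rw [Fin.ext h1', Fin.ext h2', Fin.ext h3']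
  have hdp : (p : ℤ) ∣ x ^ 2 + q * y ^ 2 - p * z ^ 2 := by
    rw [← ZMod.intCast_zmod_eq_zero_iff_dvd]
    have h1 : (x : ZMod p) = α * y := by
      rw [hx, hy]; push_cast; linear_combination heq.1
    push_cast
    rw [h1, CharP.cast_eq_zero (ZMod p) p]
    linear_combination - (y : ZMod p) ^ 2 * hα
  have hdq : (q : ℤ) ∣ x ^ 2 + q * y ^ 2 - p * z ^ 2 := by
    rw [← ZMod.intCast_zmod_eq_zero_iff_dvd]
    have h1 : (x : ZMod q) = β * z := by
      rw [hx, hz]; push_cast; linear_combination heq.2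
    push_cast
    rw [h1, CharP.cast_eq_zero]
    linear_combination - (z : ZMod q) ^ 2 * hβ
  obtain ⟨k, hk⟩ : (p * q : ℤ) ∣ x ^ 2 + q * y ^ 2 - p * z ^ 2 := by
    refine IsCoprime.mul_dvd ?_ hdp hdq
    exact Nat.isCoprime_iff_coprime.2 ((Nat.coprime_primes hp.out hq.out).2 hpq)
  have hpq0 : (0 : ℤ) < p * q := mul_pos hp0 hq0
  have hk1 : k < 2 := by
    have h1 : (q : ℤ) * y ^ 2 < p * q := by rw [mul_comm (p : ℤ)]; gcongr
    have h2 : 0 ≤ p * z ^ 2 := by positivity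
    by_contra! hk2
    have : (p * q : ℤ) * 2 ≤ p * q * k := by gcongr
    linarith
  have hk2 : -1 < k := by
    have h1 : (p : ℤ) * z ^ 2 < p * q := by gcongr
    have h2 : 0 ≤ q * y ^ 2 := by positivity
    by_contra! hk2
    have : (p * q : ℤ) * k ≤ p * q * (-1) := by gcongr
    nlinarith [sq_nonneg x]
  obtain rfl | rfl : k = 0 ∨ k = 1 := by omega
  · refine ⟨x, y, z, fun h0 => hnz ?_, by linear_combination -hk⟩
    have h1 : x ^ 2 + q * y ^ 2 = 0 := by rw [h0] at hk; linear_combination hk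
    have h2 : 0 ≤ q * y ^ 2 := by positivity
    have h3 : x ^ 2 = 0 := by nlinarith [sq_nonneg x]
    have h4 : (q : ℤ) * y ^ 2 = 0 := by linarith
    exact ⟨by simpa using h3, (by simpa [hq.out.ne_zero] using h4), h0⟩
  · refine ⟨x * z - q * y, x + y * z, z ^ 2 + q, by positivity, ?_⟩
    linear_combination (- (z ^ 2 + q)) * hk

theorem Int.exists_mul_eq_odd_mul_three_mul_add_one {z : ℤ} (hz : z ≠ 0) :
    ∃ z' a b : ℤ, z * z' = (2 * a + 1) * (3 * b + 1) := by
  obtain ⟨n, m, hm, hzm⟩ := Nat.exists_eq_two_pow_mul_odd (Int.natAbs_ne_zero.2 hz)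
  obtain ⟨a, ha⟩ := hm
  have h4 : ∃ b : ℤ, (2 : ℤ) ^ n * 2 ^ n = 3 * b + 1 := by
    obtain ⟨b, hb⟩ := sub_dvd_pow_sub_pow (4 : ℤ) 1 n
    exact ⟨b, by rw [← mul_pow]; norm_num at hb ⊢; linarith⟩
  obtain ⟨b, hb⟩ := h4
  have habs : (z.natAbs : ℤ) = 2 ^ n * (2 * a + 1) := by rw [hzm, ha]; push_cast; ring
  rcases Int.natAbs_eq z with h | h
  · exact ⟨2 ^ n, a, b, by rw [h, habs, ← hb]; ring⟩
  · exact ⟨-2 ^ n, a, b, by rw [h, habs, ← hb]; ring⟩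

theorem Rat.exists_natAbs_num_mul_den_eq {u : ℚ} (hu : 0 < u) :
    ∃ n : ℕ, n ≠ 0 ∧ (n : ℤ) = u.num * u.den ∧ (n : ℚ) = u * u.den ^ 2 := by
  have hnum : 0 < u.num := Rat.num_pos.2 hu
  have h : ((u.num.natAbs * u.den : ℕ) : ℤ) = u.num * u.den := by
    push_cast
    rw [abs_of_pos hnum]
  refine ⟨u.num.natAbs * u.den, by positivity, h, ?_⟩
  rw [← Int.cast_natCast, h, Int.cast_mul, Int.cast_natCast, sq, ← mul_assoc, Rat.mul_den_eq_num]

theorem mem_of_dvd_num_mul_den {S : Set ℕ} {u v : ℚ} (hu : u ∈ ringOfPrimes S)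
    (hv : v ∈ ringOfPrimes S) (huv : u * v = 1) {p n : ℕ} (hp : p.Prime)
    (hn : (n : ℤ) = u.num * u.den) (hpn : p ∣ n) : p ∈ S := by
  have h : (p : ℤ) ∣ u.num * u.den := hn ▸ Int.natCast_dvd_natCast.2 hpn
  rcases (Nat.prime_iff_prime_int.1 hp).dvd_or_dvd h with h | h
  · refine hv p hp ?_
    rw [← inv_eq_of_mul_eq_one_right huv, Rat.den_inv_of_ne_zero (left_ne_zero_of_mul_eq_one huv)]
    exact Int.natCast_dvd.1 h
  · exact hu p hp (Int.natCast_dvd_natCast.1 h)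

theorem natCast_inv_mem_ringOfPrimes {S : Set ℕ} {p : ℕ} (hp : p.Prime) (hpS : p ∈ S) :
    (p : ℚ)⁻¹ ∈ ringOfPrimes S := by
  intro r hr hd
  rw [Rat.inv_natCast_den_of_pos hp.pos] at hd
  rwa [(Nat.prime_dvd_prime_iff_eq hr hp).1 hd]

theorem not_dvd_den_of_notMem {S : Set ℕ} {x : ℚ} (hx : x ∈ ringOfPrimes S) {p : ℕ}
    (hp : p.Prime) (hpS : p ∉ S) : ¬ p ∣ x.den := fun h => hpS (hx p hp h)

/-- Solvability of `x² + y² = 3 + t z` in `R` with `x² + y²` a unit. -/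
def HasUnitSumTwoSquares (R : Type*) [CommRing R] (t : R) : Prop :=
  ∃ x y z v : R, x ^ 2 + y ^ 2 = 3 + t * z ∧ (x ^ 2 + y ^ 2) * v = 1

/-- Solvability of `u z² = x² + t y²` in `R` with `u ≡ 3 mod 4` a unit and `z` a divisor of an
element `(2 a + 1) (3 b + 1)`. -/
def HasUnitRepresentation (R : Type*) [CommRing R] (t : R) : Prop :=
  ∃ w v x y z z' a b : R, (3 + 4 * w) * v = 1 ∧ (3 + 4 * w) * z ^ 2 = x ^ 2 + t * y ^ 2 ∧
    z * z' = (2 * a + 1) * (3 * b + 1)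

section Diophantine

variable (R : Type*) [CommRing R] [LinearOrder R] [IsStrictOrderedRing R]

open MvPolynomial in
theorem isDiophantine_hasUnitSumTwoSquares :
    IsDiophantine R (Fin 1) {t | HasUnitSumTwoSquares R (t 0)} := by
  let V (i : Fin 4) : MvPolynomial (Fin 1 ⊕ Fin 4) R := X (.inr i)
  refine ⟨4, (V 0 ^ 2 + V 1 ^ 2 - (3 + X (.inl 0) * V 2)) ^ 2 +
    ((V 0 ^ 2 + V 1 ^ 2) * V 3 - 1) ^ 2, fun t => ?_⟩
  have h (r s : R) : r ^ 2 + s ^ 2 = 0 ↔ r = 0 ∧ s = 0 := by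
    rw [add_eq_zero_iff_of_nonneg (sq_nonneg r) (sq_nonneg s)]
    simp
  have h3 (f : Fin 1 ⊕ Fin 4 → R) : eval f 3 = 3 := map_ofNat _ 3
  simp only [Set.mem_ofPred_eq, HasUnitSumTwoSquares, V, map_add, map_sub, map_mul, map_pow,
    map_one, eval_X, h3, Sum.elim_inl, Sum.elim_inr, h, sub_eq_zero]
  constructor
  · rintro ⟨x, y, z, v, hxy⟩
    exact ⟨![x, y, z, v], hxy⟩
  · rintro ⟨f, hf⟩
    exact ⟨f 0, f 1, f 2, f 3, hf⟩

open MvPolynomial in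
theorem isDiophantine_hasUnitRepresentation :
    IsDiophantine R (Fin 1) {t | HasUnitRepresentation R (t 0)} := by
  let V (i : Fin 8) : MvPolynomial (Fin 1 ⊕ Fin 8) R := X (.inr i)
  refine ⟨8, ((3 + 4 * V 0) * V 1 - 1) ^ 2 +
    ((3 + 4 * V 0) * V 4 ^ 2 - (V 2 ^ 2 + X (.inl 0) * V 3 ^ 2)) ^ 2 +
    (V 4 * V 5 - (2 * V 6 + 1) * (3 * V 7 + 1)) ^ 2, fun t => ?_⟩
  have h (r s u : R) : r ^ 2 + s ^ 2 + u ^ 2 = 0 ↔ r = 0 ∧ s = 0 ∧ u = 0 := by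
    rw [add_eq_zero_iff_of_nonneg (by positivity) (sq_nonneg u),
      add_eq_zero_iff_of_nonneg (sq_nonneg r) (sq_nonneg s)]
    simp [and_assoc]
  have h2 (f : Fin 1 ⊕ Fin 8 → R) : eval f 2 = 2 := map_ofNat _ 2
  have h3 (f : Fin 1 ⊕ Fin 8 → R) : eval f 3 = 3 := map_ofNat _ 3
  have h4 (f : Fin 1 ⊕ Fin 8 → R) : eval f 4 = 4 := map_ofNat _ 4
  simp only [Set.mem_ofPred_eq, HasUnitRepresentation, V, map_add, map_sub, map_mul, map_pow,
    map_one, eval_X, h2, h3, h4, Sum.elim_inl, Sum.elim_inr, h, sub_eq_zero]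
  constructor
  · rintro ⟨w, v, x, y, z, z', a, b, h⟩
    exact ⟨![w, v, x, y, z, z', a, b], h⟩
  · rintro ⟨f, hf⟩
    exact ⟨f 0, f 1, f 2, f 3, f 4, f 5, f 6, f 7, hf⟩

end Diophantine

section Solvability

variable {S : Set ℕ} {p q : ℕ}

theorem hasUnitSumTwoSquares_of_mem (hp : p.Prime) (hpS : p ∈ S) (hp4 : p % 4 = 1)
    (hpq : p ≡ 3 [MOD q]) : HasUnitSumTwoSquares (ringOfPrimes S) q := by
  have := Fact.mk hp
  obtain ⟨x, y, hxy⟩ := Nat.Prime.sq_add_sq (p := p) (by omega)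
  obtain ⟨z, hz⟩ := (Nat.modEq_iff_dvd.1 hpq.symm)
  have hxy' : ((x : ringOfPrimes S)) ^ 2 + (y : ringOfPrimes S) ^ 2 = p := by exact_mod_cast hxy
  have hz' : (p : ringOfPrimes S) = 3 + q * (z : ringOfPrimes S) := by
    have : (p : ℤ) = 3 + q * z := by push_cast at hz; linarith
    exact_mod_cast congrArg (Int.cast : ℤ → ringOfPrimes S) this
  refine ⟨x, y, z, ⟨_, natCast_inv_mem_ringOfPrimes hp hpS⟩, by rw [hxy', hz'], ?_⟩
  rw [hxy']
  apply Subtype.ext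
  simp [hp.ne_zero]

theorem not_isSquare_three (hq : q.Prime) (hq24 : q % 24 = 17) : ¬ IsSquare (3 : ZMod q) := by
  have h2 : ¬ IsSquare ((2 : ℕ) : ZMod 3) := by decide
  have := Fact.mk hq
  have := Fact.mk Nat.prime_three
  have h := ZMod.exists_sq_eq_prime_iff_of_mod_four_eq_one (p := q) (q := 3) (by omega) (by omega)
  rw [Nat.cast_ofNat] at h
  rw [h, ← ZMod.natCast_mod, show q % 3 = 2 by omega]
  exact h2

theorem not_hasUnitSumTwoSquares (hq : q.Prime) (hqS : q ∉ S) (hq24 : q % 24 = 17)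
    (hS : ∀ p ∈ S, p.Prime → p % 4 = 1 → IsSquare (p : ZMod q)) :
    ¬ HasUnitSumTwoSquares (ringOfPrimes S) q := by
  have := Fact.mk hq
  rintro ⟨⟨x, hx⟩, ⟨y, hy⟩, ⟨z, hz⟩, ⟨v, hv⟩, hxyz, hxyv⟩
  have hxyz : x ^ 2 + y ^ 2 = 3 + q * z := congrArg Subtype.val hxyz
  have hxyv : (x ^ 2 + y ^ 2) * v = 1 := congrArg Subtype.val hxyv
  have hu : x ^ 2 + y ^ 2 ∈ ringOfPrimes S := add_mem (pow_mem hx 2) (pow_mem hy 2)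
  have hqu := not_dvd_den_of_notMem hu hq hqS
  have hqz := not_dvd_den_of_notMem hz hq hqS
  have hpos : 0 < x ^ 2 + y ^ 2 :=
    lt_of_le_of_ne (by positivity) (left_ne_zero_of_mul_eq_one hxyv).symm
  set u := x ^ 2 + y ^ 2 with hu_def
  obtain ⟨n, hn0, hn, hn'⟩ := Rat.exists_natAbs_num_mul_den_eq hpos
  have hsum : ∃ a b : ℕ, (x.den * y.den) ^ 2 * n = a ^ 2 + b ^ 2 := by
    refine ⟨(x.num * y.den * u.den).natAbs, (y.num * x.den * u.den).natAbs, ?_⟩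
    zify
    simp only [sq_abs]
    have hx' := Rat.mul_den_eq_num x
    have hy' := Rat.mul_den_eq_num y
    have : (((x.den * y.den) ^ 2 * n : ℤ) : ℚ) =
        (((x.num * y.den * u.den) ^ 2 + (y.num * x.den * u.den) ^ 2 : ℤ) : ℚ) := by
      push_cast
      rw [← hx', ← hy', hn', hu_def]
      ring
    exact_mod_cast this
  have heven := Nat.eq_sq_add_sq_iff.1 hsum
  have hsq : IsSquare (n : ZMod q) := by
    refine Nat.isSquare_cast_of_odd_padicValNat hn0 fun p hp hpn hodd => ?_
    have := Fact.mk hp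
    rcases hp.eq_two_or_odd with rfl | hp2
    · exact (ZMod.exists_sq_eq_two_iff (p := q) (by omega)).2 (by omega)
    have hpS := mem_of_dvd_num_mul_den hu hv hxyv hp hn hpn
    rcases (by omega : p % 4 = 1 ∨ p % 4 = 3) with hp4 | hp4
    · exact hS p hpS hp hp4
    · have hc : x.den * y.den ≠ 0 := by simp
      have h := heven p (Nat.mem_primeFactors.2 ⟨hp, hpn.mul_left _,
        mul_ne_zero (pow_ne_zero 2 hc) hn0⟩) hp4
      rw [padicValNat.mul (pow_ne_zero 2 hc) hn0, padicValNat.pow] at h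
      obtain ⟨a, ha⟩ := h
      obtain ⟨b, hb⟩ := hodd
      omega
  have hden : (u.den : ZMod q) ≠ 0 := by rwa [Ne, ZMod.natCast_eq_zero_iff]
  have hzden : (z.den : ZMod q) ≠ 0 := by rwa [Ne, ZMod.natCast_eq_zero_iff]
  have hnz : (n : ZMod q) = 3 * (u.den : ZMod q) ^ 2 := by
    have h1 : (n * z.den : ℤ) = 3 * u.den ^ 2 * z.den + q * z.num * u.den ^ 2 := by
      have : ((n * z.den : ℤ) : ℚ) =
          ((3 * u.den ^ 2 * z.den + q * z.num * u.den ^ 2 : ℤ) : ℚ) := by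
        push_cast
        rw [hn', ← Rat.mul_den_eq_num z]
        linear_combination (u.den : ℚ) ^ 2 * z.den * hxyz
      exact_mod_cast this
    have h2 := congrArg (Int.cast : ℤ → ZMod q) h1
    push_cast at h2
    rw [CharP.cast_eq_zero (ZMod q) q] at h2
    refine mul_right_cancel₀ hzden ?_
    linear_combination h2
  refine not_isSquare_three hq hq24 ?_
  have : (3 : ZMod q) = n / (u.den : ZMod q) ^ 2 := by rw [hnz]; field_simp
  rw [this]
  exact hsq.div (IsSquare.sq _)

theorem hasUnitRepresentation_of_mem (hp : p.Prime) (hq : q.Prime) (hpq : p ≠ q) (hpS : p ∈ S)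
    (hp4 : p % 4 = 3) (hqp : IsSquare (-q : ZMod p)) (hpq' : IsSquare (p : ZMod q)) :
    HasUnitRepresentation (ringOfPrimes S) q := by
  have := Fact.mk hp
  have := Fact.mk hq
  obtain ⟨x, y, z, hz, hxyz⟩ := exists_prime_mul_sq_eq_sq_add_prime_mul_sq hpq hqp hpq'
  obtain ⟨z', a, b, hab⟩ := Int.exists_mul_eq_odd_mul_three_mul_add_one hz
  have hw : ((3 + 4 * ((p / 4 : ℕ) : ringOfPrimes S))) = p := by
    exact_mod_cast congrArg (Nat.cast : ℕ → ringOfPrimes S) (by omega : 3 + 4 * (p / 4) = p)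
  refine ⟨(p / 4 : ℕ), ⟨_, natCast_inv_mem_ringOfPrimes hp hpS⟩, x, y, z, z', a, b, ?_, ?_, ?_⟩
  · rw [hw]
    apply Subtype.ext
    simp [hp.ne_zero]
  · rw [hw]
    exact_mod_cast congrArg (Int.cast : ℤ → ringOfPrimes S) hxyz
  · exact_mod_cast congrArg (Int.cast : ℤ → ringOfPrimes S) hab

theorem mul_add_one_ne_zero {x : ℚ} (hx : x ∈ ringOfPrimes S) (hp : p.Prime) (hpS : p ∉ S) :
    p * x + 1 ≠ 0 := by
  intro h
  have h1 : ((p * x.num + x.den : ℤ) : ℚ) = 0 := by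
    push_cast
    rw [← Rat.mul_den_eq_num x]
    linear_combination (x.den : ℚ) * h
  have h2 : (p * x.num + x.den : ℤ) = 0 := by exact_mod_cast h1
  refine not_dvd_den_of_notMem hx hp hpS (Int.natCast_dvd_natCast.1 ⟨-x.num, ?_⟩)
  linarith

theorem not_hasUnitRepresentation (h2 : 2 ∉ S) (h3 : 3 ∉ S)
    (hS : ∀ p ∈ S, p.Prime → p % 4 = 3 → ¬ IsSquare (-q : ZMod p)) :
    ¬ HasUnitRepresentation (ringOfPrimes S) q := by
  rintro ⟨⟨w, hw⟩, ⟨v, hv⟩, ⟨x, hx⟩, ⟨y, hy⟩, ⟨z, hz⟩, ⟨z', hz'⟩, ⟨a, ha⟩, ⟨b, hb⟩,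
    huv, hxyz, hab⟩
  have huv : (3 + 4 * w) * v = 1 := congrArg Subtype.val huv
  have hxyz : (3 + 4 * w) * z ^ 2 = x ^ 2 + q * y ^ 2 := congrArg Subtype.val hxyz
  have hab : z * z' = (2 * a + 1) * (3 * b + 1) := congrArg Subtype.val hab
  have hz0 : z ≠ 0 := by
    refine left_ne_zero_of_mul (b := z') (hab ▸ mul_ne_zero ?_ ?_)
    · exact_mod_cast mul_add_one_ne_zero ha Nat.prime_two h2
    · exact_mod_cast mul_add_one_ne_zero hb Nat.prime_three h3
  have hu : 3 + 4 * w ∈ ringOfPrimes S :=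
    add_mem (ofNat_mem _ 3) (mul_mem (ofNat_mem _ 4) hw)
  have hwden := not_dvd_den_of_notMem hw Nat.prime_two h2
  have huden := not_dvd_den_of_notMem hu Nat.prime_two h2
  have hpos : 0 < 3 + 4 * w := by
    refine lt_of_le_of_ne ?_ (left_ne_zero_of_mul_eq_one huv).symm
    refine nonneg_of_mul_nonneg_left (b := z ^ 2) ?_ (by positivity)
    rw [hxyz]
    positivity
  obtain ⟨n, hn0, hn, hn'⟩ := Rat.exists_natAbs_num_mul_den_eq hpos
  set u := 3 + 4 * w with hu_def
  have hn4 : n % 4 = 3 := by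
    have h1 : (n * w.den : ℤ) = 3 * u.den ^ 2 * w.den + 4 * (w.num * u.den ^ 2) := by
      have : ((n * w.den : ℤ) : ℚ) =
          ((3 * u.den ^ 2 * w.den + 4 * (w.num * u.den ^ 2) : ℤ) : ℚ) := by
        push_cast
        rw [hn', ← Rat.mul_den_eq_num w]
        linear_combination (u.den : ℚ) ^ 2 * w.den * hu_def
      exact_mod_cast this
    have hsq : u.den ^ 2 % 4 = 1 := by
      rcases (by omega : u.den % 4 = 1 ∨ u.den % 4 = 3) with h | h <;> simp [Nat.pow_mod, h]
    have hd : (4 : ℤ) ∣ n - 3 * u.den ^ 2 := by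
      have hco : IsCoprime (4 : ℤ) w.den := by
        have : Nat.Coprime 4 w.den :=
          Nat.Coprime.pow_left 2 ((Nat.Prime.coprime_iff_not_dvd Nat.prime_two).2 hwden)
        exact_mod_cast Nat.isCoprime_iff_coprime.2 this
      refine hco.dvd_of_dvd_mul_right ⟨w.num * u.den ^ 2, ?_⟩
      linear_combination h1
    zify at hsq ⊢
    omega
  obtain ⟨p, hp, hp4, hpn, hodd⟩ :
      ∃ p : ℕ, p.Prime ∧ p % 4 = 3 ∧ p ∣ n ∧ Odd (padicValNat p n) := by
    by_contra! hcon
    obtain ⟨a, b, h⟩ := Nat.eq_sq_add_sq_iff.2 fun p hp hp4 =>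
      Nat.not_odd_iff_even.1 (hcon p (Nat.prime_of_mem_primeFactors hp) hp4
        (Nat.dvd_of_mem_primeFactors hp))
    rw [h, Nat.add_mod, Nat.pow_mod a, Nat.pow_mod b] at hn4
    have ha4 := Nat.mod_lt a (by norm_num : 4 > 0)
    have hb4 := Nat.mod_lt b (by norm_num : 4 > 0)
    generalize a % 4 = a at *
    generalize b % 4 = b at *
    interval_cases a <;> interval_cases b <;> simp at hn4
  have := Fact.mk hp
  refine hS p (mem_of_dvd_num_mul_den hu hv huv hp hn hpn) hp hp4 ?_
  have hsq := Int.isSquare_neg_of_odd_padicValInt (p := p) (q := q) (n := n)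
    (z := x.den * y.den * z.num) (x := x.num * y.den * z.den * u.den)
    (y := x.den * y.num * z.den * u.den) (by exact_mod_cast hn0) (by simp [hz0]) ?_
    (by simpa using hodd)
  · simpa using hsq
  · have : ((n * (x.den * y.den * z.num) ^ 2 : ℤ) : ℚ) = (((x.num * y.den * z.den * u.den) ^ 2 +
        q * (x.den * y.num * z.den * u.den) ^ 2 : ℤ) : ℚ) := by
      push_cast
      rw [hn', ← Rat.mul_den_eq_num x, ← Rat.mul_den_eq_num y, ← Rat.mul_den_eq_num z]
      linear_combination (u.den * x.den * y.den * z.den : ℚ) ^ 2 * hxyz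
    exact_mod_cast this

end Solvability

section Halting

open Nat.Partrec

/-- The program with code `m` halts on input `0` within `s` steps. -/
def HaltsBy (m s : ℕ) : Prop :=
  (Code.evaln s (Denumerable.ofNat Code m) 0).isSome

instance (m s : ℕ) : Decidable (HaltsBy m s) :=
  inferInstanceAs (Decidable (_ = true))

theorem primrecRel_haltsBy : PrimrecRel HaltsBy := by
  refine (Primrec.option_isSome.comp (Code.primrec_evaln.comp
    ((Primrec.pair .snd ((Primrec.ofNat Code).comp .fst)).pair (.const 0)))).of_eq
    (g := fun x : ℕ × ℕ => decide (HaltsBy x.1 x.2)) (fun x => ?_) |>.primrecPred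
  rw [Bool.eq_iff_iff, decide_eq_true_iff]
  rfl

theorem not_computablePred_exists_haltsBy :
    ¬ ComputablePred fun m => ∃ s, m ≤ s ∧ HaltsBy m s := by
  intro h
  refine ComputablePred.halting_problem 0 (ComputablePred.of_eq
    (ComputablePred.computable_iff.2 ?_) (p := fun c => ∃ s, encode c ≤ s ∧ HaltsBy (encode c) s)
    fun c => ?_)
  · obtain ⟨f, hf, hf'⟩ := ComputablePred.computable_iff.1 h
    refine ⟨fun c => f (encode c), hf.comp .encode, funext fun c => ?_⟩
    exact congrFun hf' (encode c)
  · simp only [HaltsBy, Denumerable.ofNat_encode]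
    constructor
    · rintro ⟨s, -, hs⟩
      obtain ⟨x, hx⟩ := Option.isSome_iff_exists.1 hs
      exact Part.dom_iff_mem.2 ⟨x, Code.evaln_sound hx⟩
    · intro hd
      obtain ⟨x, hx⟩ := Part.dom_iff_mem.1 hd
      obtain ⟨s, hs⟩ := Code.evaln_complete.1 hx
      exact ⟨max s (encode c), le_max_right _ _,
        Option.isSome_iff_exists.2 ⟨x, Code.evaln_mono (le_max_left _ _) hs⟩⟩

end Halting

/-- The classes modulo `24` of the primes `haltingPrime k`. -/
def haltingClass (k : ℕ) : ℕ :=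
  if k % 4 = 0 then 17 else if k % 4 = 1 then 1 else 19

/-- The classes of the primes `haltingPrime k` modulo `haltingPrime i`. -/
def haltingResidue (k i : ℕ) : ℕ :=
  if k % 4 = 1 ∧ i % 4 = 0 ∧ HaltsBy (i / 4) (k / 4) then 3
  else if k % 4 = 3 ∧ i % 4 = 2 ∧ ¬ HaltsBy (i / 4) (k / 4) then 2
  else 1

/-- A computable sequence of primes whose residues modulo each other encode the halting problem:
the terms of index `4 m` and `4 m + 2` stand for programs, those of index `4 s + 1` and `4 s + 3`
for running times. -/
noncomputable def haltingPrime : ℕ → ℕ := greedyPrime haltingClass haltingResidue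

theorem haltingClass_coprime (k : ℕ) : (haltingClass k).Coprime 24 := by
  unfold haltingClass
  split_ifs <;> decide

theorem haltingResidue_bounds (k i : ℕ) : 0 < haltingResidue k i ∧ haltingResidue k i ≤ 3 := by
  unfold haltingResidue
  split_ifs <;> decide

theorem primrec_haltingClass : Primrec haltingClass := by
  have h4 (r : ℕ) : PrimrecPred fun k : ℕ => k % 4 = r :=
    Primrec.eq.comp (Primrec.nat_mod.comp .id (.const 4)) (.const r)
  exact .ite (h4 0) (.const 17) (.ite (h4 1) (.const 1) (.const 19))

theorem primrec₂_haltingResidue : Primrec₂ haltingResidue := by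
  have h4 (r : ℕ) : PrimrecPred fun k : ℕ => k % 4 = r :=
    Primrec.eq.comp (Primrec.nat_mod.comp .id (.const 4)) (.const r)
  have hh : PrimrecPred fun x : ℕ × ℕ => HaltsBy (x.2 / 4) (x.1 / 4) :=
    primrecRel_haltsBy.comp (Primrec.nat_div.comp .snd (.const 4))
      (Primrec.nat_div.comp .fst (.const 4))
  exact .ite (((h4 1).comp .fst).and (((h4 0).comp .snd).and hh)) (.const 3)
    (.ite (((h4 3).comp .fst).and (((h4 2).comp .snd).and hh.not)) (.const 2) (.const 1))

theorem computable_greedyList_haltingPrime :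
    Computable (greedyList haltingClass haltingResidue) :=
  computable_greedyList haltingClass_coprime haltingResidue_bounds primrec_haltingClass
    primrec₂_haltingResidue

theorem strictMono_haltingPrime : StrictMono haltingPrime :=
  strictMono_greedyPrime haltingClass_coprime haltingResidue_bounds

theorem haltingPrime_spec (k : ℕ) : (haltingPrime k).Prime ∧
    haltingPrime k ≡ haltingClass k [MOD 24] ∧
    ∀ i < k, haltingPrime k ≡ haltingResidue k i [MOD haltingPrime i] :=
  isNextPrime_greedyList_iff.1 <|
    isNextPrime_greedyPrime haltingClass_coprime haltingResidue_bounds k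

theorem prime_haltingPrime (k : ℕ) : (haltingPrime k).Prime := (haltingPrime_spec k).1

theorem haltingPrime_mod (k : ℕ) :
    haltingPrime k % 24 = if k % 4 = 0 then 17 else if k % 4 = 1 then 1 else 19 := by
  have h := (haltingPrime_spec k).2.1
  rw [Nat.ModEq, haltingClass] at h
  rw [h]
  split_ifs <;> rfl

theorem haltingPrime_modEq {k i : ℕ} (h : i < k) :
    haltingPrime k ≡ haltingResidue k i [MOD haltingPrime i] :=
  (haltingPrime_spec k).2.2 i h

theorem computable_haltingPrime : Computable haltingPrime := by
  refine ((Primrec.list_getD 0).to_comp.comp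
    (computable_greedyList_haltingPrime.comp .succ) .id).of_eq fun k => ?_
  simp [greedyList_eq_map, haltingPrime]

theorem computablePred_exists_haltingPrime (r : ℕ) :
    ComputablePred fun p => ∃ k, k % 4 = r ∧ haltingPrime k = p := by
  have h : PrimrecRel fun (k : ℕ) (a : List ℕ × ℕ) => k % 4 = r ∧ a.1.getD k 0 = a.2 :=
    (Primrec.eq.comp (Primrec.nat_mod.comp .fst (.const 4)) (.const r)).and
      (Primrec.eq.comp ((Primrec.list_getD 0).comp (Primrec.fst.comp .snd) .fst)
        (Primrec.snd.comp .snd))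
  have h' := h.exists_mem_list.comp (Primrec.list_range.comp (Primrec.list_length.comp .fst)) .id
  refine ComputablePred.of_eq (p := fun p => ∃ k ∈ List.range
    (greedyList haltingClass haltingResidue (p + 1)).length, k % 4 = r ∧
      (greedyList haltingClass haltingResidue (p + 1)).getD k 0 = p) ?_ fun p => ?_
  · obtain ⟨f, hf, hf'⟩ := ComputablePred.computable_iff.1 h'.computablePred
    exact ComputablePred.computable_iff.2 ⟨_,
      hf.comp ((computable_greedyList_haltingPrime.comp .succ).pair .id), funext fun p =>
        congrFun hf' (greedyList haltingClass haltingResidue (p + 1), p)⟩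
  · have hlen : (greedyList haltingClass haltingResidue (p + 1)).length = p + 1 := by
      simp [greedyList_eq_map]
    have hget : ∀ k < p + 1, (greedyList haltingClass haltingResidue (p + 1)).getD k 0 =
        haltingPrime k := fun k hk => by simp [greedyList_eq_map, haltingPrime, hk]
    simp only [hlen, List.mem_range]
    constructor
    · rintro ⟨k, hk, hkr, hkp⟩
      exact ⟨k, hkr, by rw [← hget k hk, hkp]⟩
    · rintro ⟨k, hkr, rfl⟩
      have hk := Nat.lt_succ_of_le (strictMono_haltingPrime.le_apply (x := k))
      exact ⟨k, hk, hkr, hget k hk⟩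

/-- The primes `p ≡ 1 mod 4` other than the `haltingPrime (4 s + 1)`, together with the
`haltingPrime (4 s + 3)`. -/
def firstPrimes : Set ℕ :=
  {p | p.Prime ∧ ((p % 4 = 1 ∧ ¬ ∃ k, k % 4 = 1 ∧ haltingPrime k = p) ∨
    ∃ k, k % 4 = 3 ∧ haltingPrime k = p)}

/-- The primes outside `firstPrimes`. -/
def secondPrimes : Set ℕ := {p | p.Prime ∧ p ∉ firstPrimes}

theorem computablePred_firstPrimes : ComputablePred fun p => p ∈ firstPrimes := by
  have h4 : PrimrecPred fun k : ℕ => k % 4 = 1 :=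
    Primrec.eq.comp (Primrec.nat_mod.comp .id (.const 4)) (.const 1)
  exact .and primrecPred_prime.computablePred (.or (.and h4.computablePred
    (computablePred_exists_haltingPrime 1).not) (computablePred_exists_haltingPrime 3))

theorem computablePred_secondPrimes : ComputablePred fun p => p ∈ secondPrimes :=
  .and primrecPred_prime.computablePred computablePred_firstPrimes.not

theorem exists_haltingPrime_of_mem_secondPrimes {p : ℕ} (hp : p ∈ secondPrimes) (hp4 : p % 4 = 1) :
    ∃ s, haltingPrime (4 * s + 1) = p := by
  by_contra! h
  refine hp.2 ⟨hp.1, .inl ⟨hp4, ?_⟩⟩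
  rintro ⟨k, hk, rfl⟩
  exact h (k / 4) (congrArg _ (by omega))

theorem exists_haltingPrime_of_mem_firstPrimes {p : ℕ} (hp : p ∈ firstPrimes) (hp4 : p % 4 ≠ 1) :
    ∃ s, haltingPrime (4 * s + 3) = p := by
  rcases hp.2 with h | ⟨k, hk, rfl⟩
  · exact absurd h.1 hp4
  · exact ⟨k / 4, congrArg _ (by omega)⟩

theorem haltingPrime_mem_secondPrimes (s : ℕ) : haltingPrime (4 * s + 1) ∈ secondPrimes := by
  refine ⟨prime_haltingPrime _, ?_⟩
  rintro ⟨-, ⟨-, h⟩ | ⟨k, hk, h⟩⟩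
  · exact h ⟨_, by omega, rfl⟩
  · have := strictMono_haltingPrime.injective h
    omega

theorem haltingPrime_mem_firstPrimes (s : ℕ) : haltingPrime (4 * s + 3) ∈ firstPrimes :=
  ⟨prime_haltingPrime _, .inr ⟨_, by omega, rfl⟩⟩

theorem haltingPrime_notMem_secondPrimes (m : ℕ) : haltingPrime (4 * m) ∉ secondPrimes := by
  refine fun h => h.2 ⟨prime_haltingPrime _, .inl ⟨?_, ?_⟩⟩
  · have h1 := haltingPrime_mod (4 * m)
    rw [if_pos (by omega)] at h1
    omega
  · rintro ⟨k, hk, h⟩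
    have := strictMono_haltingPrime.injective h
    omega

theorem mod_of_mem_firstPrimes {p : ℕ} (hp : p ∈ firstPrimes) : p % 4 = 1 ∨ p % 24 = 19 := by
  by_cases hp4 : p % 4 = 1
  · exact .inl hp4
  obtain ⟨s, rfl⟩ := exists_haltingPrime_of_mem_firstPrimes hp hp4
  have h := haltingPrime_mod (4 * s + 3)
  rw [if_neg (by omega), if_neg (by omega)] at h
  exact .inr h

theorem hasUnitSumTwoSquares_secondPrimes_iff (m : ℕ) :
    HasUnitSumTwoSquares (ringOfPrimes secondPrimes) (haltingPrime (4 * m)) ↔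
      ∃ s, m ≤ s ∧ HaltsBy m s := by
  have hq24 := haltingPrime_mod (4 * m)
  rw [if_pos (by omega)] at hq24
  have hp24 (s : ℕ) : haltingPrime (4 * s + 1) % 24 = 1 := by
    rw [haltingPrime_mod, if_neg (by omega), if_pos (by omega)]
  constructor
  · contrapose!
    intro hm
    refine not_hasUnitSumTwoSquares (prime_haltingPrime _) (haltingPrime_notMem_secondPrimes m) hq24
      fun p hpT hp hp4 => ?_
    obtain ⟨s, rfl⟩ := exists_haltingPrime_of_mem_secondPrimes hpT hp4
    have := Fact.mk hp
    have := Fact.mk (prime_haltingPrime (4 * m))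
    rcases lt_or_gt_of_ne (by omega : 4 * m ≠ 4 * s + 1) with h | h
    · have hpq := haltingPrime_modEq h
      rw [haltingResidue, if_neg, if_neg (by omega)] at hpq
      · rw [(ZMod.natCast_eq_natCast_iff ..).2 hpq, Nat.cast_one]
        exact IsSquare.one
      · rintro ⟨-, -, h'⟩
        rw [show 4 * m / 4 = m by omega, show (4 * s + 1) / 4 = s by omega] at h'
        exact hm s (by omega) h'
    · have hqp := haltingPrime_modEq h
      rw [haltingResidue, if_neg (by omega), if_neg (by omega)] at hqp
      rw [ZMod.exists_sq_eq_prime_iff_of_mod_four_eq_one (by have := hq24; omega)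
        (by have := hp24 s; omega), (ZMod.natCast_eq_natCast_iff ..).2 hqp, Nat.cast_one]
      exact IsSquare.one
  · rintro ⟨s, hms, hs⟩
    refine hasUnitSumTwoSquares_of_mem (prime_haltingPrime _) (haltingPrime_mem_secondPrimes s)
      (by have := hp24 s; omega) ?_
    have hpq := haltingPrime_modEq (by omega : 4 * m < 4 * s + 1)
    rwa [haltingResidue, if_pos] at hpq
    rw [show 4 * m / 4 = m by omega, show (4 * s + 1) / 4 = s by omega]
    exact ⟨by omega, by omega, hs⟩

theorem isSquare_neg_iff_of_mod_four_eq_three {p : ℕ} [Fact p.Prime] (hp4 : p % 4 = 3)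
    {x : ZMod p} (hx : x ≠ 0) : IsSquare (-x) ↔ ¬ IsSquare x := by
  have hodd : Odd (p / 2) := Nat.odd_iff.2 (by omega)
  rw [ZMod.euler_criterion p hx, ZMod.euler_criterion p (neg_ne_zero.2 hx), hodd.neg_pow]
  have : Fact (2 < p) := ⟨by omega⟩
  have h1 : (-1 : ZMod p) ≠ 1 := ZMod.neg_one_ne_one
  rcases ZMod.pow_div_two_eq_neg_one_or_one p hx with h | h <;> simp [h, h1]

theorem hasUnitRepresentation_firstPrimes_iff (m : ℕ) :
    HasUnitRepresentation (ringOfPrimes firstPrimes) (haltingPrime (4 * m + 2)) ↔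
      ∃ s, m ≤ s ∧ HaltsBy m s := by
  have hq24 := haltingPrime_mod (4 * m + 2)
  rw [if_neg (by omega), if_neg (by omega)] at hq24
  have hp24 (s : ℕ) : haltingPrime (4 * s + 3) % 24 = 19 := by
    rw [haltingPrime_mod, if_neg (by omega), if_neg (by omega)]
  have hq := Fact.mk (prime_haltingPrime (4 * m + 2))
  have hp (s : ℕ) := Fact.mk (prime_haltingPrime (4 * s + 3))
  have hne (s : ℕ) : haltingPrime (4 * s + 3) ≠ haltingPrime (4 * m + 2) :=
    strictMono_haltingPrime.injective.ne (by omega)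
  have hneg (s : ℕ) : IsSquare (-(haltingPrime (4 * m + 2)) : ZMod (haltingPrime (4 * s + 3))) ↔
      ¬ IsSquare (haltingPrime (4 * m + 2) : ZMod (haltingPrime (4 * s + 3))) := by
    refine isSquare_neg_iff_of_mod_four_eq_three (by have := hp24 s; omega) ?_
    rw [Ne, ZMod.natCast_eq_zero_iff, Nat.prime_dvd_prime_iff_eq (hp s).out hq.out]
    exact hne s
  have hrec (s : ℕ) := ZMod.exists_sq_eq_prime_iff_of_mod_four_eq_three
    (p := haltingPrime (4 * m + 2)) (q := haltingPrime (4 * s + 3)) (by omega)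
    (by have := hp24 s; omega) (hne s).symm
  constructor
  · contrapose!
    intro hm
    refine not_hasUnitRepresentation (fun h => ?_) (fun h => ?_) fun p hpS _ hp4 => ?_
    · have := mod_of_mem_firstPrimes h
      omega
    · have := mod_of_mem_firstPrimes h
      omega
    obtain ⟨s, rfl⟩ := exists_haltingPrime_of_mem_firstPrimes hpS (by omega)
    rw [hneg, not_not]
    rcases lt_or_gt_of_ne (by omega : 4 * m + 2 ≠ 4 * s + 3) with h | h
    · have hpq := haltingPrime_modEq h
      rw [haltingResidue, if_neg (by omega), if_pos] at hpq
      · rw [← not_not (a := IsSquare _), ← hrec, (ZMod.natCast_eq_natCast_iff ..).2 hpq,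
          Nat.cast_ofNat, ZMod.exists_sq_eq_two_iff (by omega)]
        omega
      · refine ⟨by omega, by omega, fun h' => ?_⟩
        rw [show (4 * m + 2) / 4 = m by omega, show (4 * s + 3) / 4 = s by omega] at h'
        exact hm s (by omega) h'
    · have hqp := haltingPrime_modEq h
      rw [haltingResidue, if_neg (by omega), if_neg (by omega)] at hqp
      rw [(ZMod.natCast_eq_natCast_iff ..).2 hqp, Nat.cast_one]
      exact IsSquare.one
  · rintro ⟨s, hms, hs⟩
    have hpq := haltingPrime_modEq (by omega : 4 * m + 2 < 4 * s + 3)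
    rw [haltingResidue, if_neg (by omega), if_neg] at hpq
    · have hsq : IsSquare (haltingPrime (4 * s + 3) : ZMod (haltingPrime (4 * m + 2))) := by
        rw [(ZMod.natCast_eq_natCast_iff ..).2 hpq, Nat.cast_one]
        exact IsSquare.one
      exact hasUnitRepresentation_of_mem (hp s).out hq.out (hne s) (haltingPrime_mem_firstPrimes s)
        (by have := hp24 s; omega) ((hneg s).2 ((hrec s).1 hsq)) hsq
    · rintro ⟨-, -, h'⟩
      rw [show (4 * m + 2) / 4 = m by omega, show (4 * s + 3) / 4 = s by omega] at h'
      exact h' hs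

theorem exists_isDiophantine_not_computablePred {S : Set ℕ} {P : ringOfPrimes S → Prop}
    (hP : IsDiophantine (ringOfPrimes S) (Fin 1) {t | P (t 0)}) {f : ℕ → ℕ} (hf : Computable f)
    (hPf : ∀ m, P (f m) ↔ ∃ s, m ≤ s ∧ HaltsBy m s) :
    ∃ A : Set ℚ, A ⊆ (ringOfPrimes S : Set ℚ) ∧
      IsDiophantine (ringOfPrimes S) (Fin 1) {t | (t 0 : ℚ) ∈ A} ∧
      ¬ ComputablePred (fun x : ℚ => x ∈ A) := by
  refine ⟨Set.image Subtype.val {x | P x}, by rintro _ ⟨x, -, rfl⟩; exact x.2, ?_, fun h => ?_⟩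
  · simpa only [Subtype.val_injective.mem_set_image, Set.mem_ofPred_eq] using hP
  · refine not_computablePred_exists_haltsBy ?_
    obtain ⟨g, hg, hg'⟩ := ComputablePred.computable_iff.1 h
    refine ComputablePred.of_eq (ComputablePred.computable_iff.2
      ⟨_, hg.comp (Rat.primrec_natCast.to_comp.comp hf), rfl⟩) fun m => ?_
    rw [← hPf]
    refine (iff_of_eq (congrFun hg' (f m))).symm.trans ?_
    exact Subtype.val_injective.mem_set_image (a := (f m : ringOfPrimes S))

/-- (Eisenträger–Everest) There are computable, exactly complementary sets `S`, `T` of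
primes (`S ∪ T` is the set of all primes, `S ∩ T = ∅`) such that each of the rings
`O_{ℚ,S}` and `O_{ℚ,T}` has a Diophantine subset that is not computable; hence HTP is
undecidable for both rings. -/
theorem eisentraeger_everest_complementary :
    ∃ S T : Set ℕ,
      ComputablePred (fun p : ℕ => p ∈ S) ∧ ComputablePred (fun p : ℕ => p ∈ T) ∧
      S ∪ T = {p : ℕ | p.Prime} ∧ S ∩ T = ∅ ∧
      (∃ A : Set ℚ, A ⊆ (ringOfPrimes S : Set ℚ) ∧
        IsDiophantine (ringOfPrimes S) (Fin 1) {t | (t 0 : ℚ) ∈ A} ∧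
        ¬ ComputablePred (fun x : ℚ => x ∈ A)) ∧
      (∃ A : Set ℚ, A ⊆ (ringOfPrimes T : Set ℚ) ∧
        IsDiophantine (ringOfPrimes T) (Fin 1) {t | (t 0 : ℚ) ∈ A} ∧
        ¬ ComputablePred (fun x : ℚ => x ∈ A)) := by
  refine ⟨firstPrimes, secondPrimes, computablePred_firstPrimes, computablePred_secondPrimes,
    ?_, ?_, ?_, ?_⟩
  · ext p
    constructor
    · rintro (h | h) <;> exact h.1
    · intro h
      by_cases hp : p ∈ firstPrimes
      · exact .inl hp
      · exact .inr ⟨h, hp⟩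
  · ext p
    exact ⟨fun h => h.2.2 h.1, False.elim⟩
  · exact exists_isDiophantine_not_computablePred
      (isDiophantine_hasUnitRepresentation (ringOfPrimes firstPrimes))
      (computable_haltingPrime.comp (Primrec.nat_add.comp (Primrec.nat_mul.comp (.const 4) .id)
        (.const 2)).to_comp) hasUnitRepresentation_firstPrimes_iff
  · exact exists_isDiophantine_not_computablePred
      (isDiophantine_hasUnitSumTwoSquares (ringOfPrimes secondPrimes))
      (computable_haltingPrime.comp (Primrec.nat_mul.comp (.const 4) .id).to_comp)
      hasUnitSumTwoSquares_secondPrimes_iff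
end

section
/- (Poonen) For every t ∈ ℚ, t belongs to ℤ if and only if for all a, b ∈ ℚ there exist a₁, a₂, a₃, a₄, b₁, b₂, b₃, b₄, x₁, x₂, x₃, x₄, y₁, y₂, y₃, y₄, n ∈ ℚ such that (a + a₁² + a₂² + a₃² + a₄²)·(b + b₁² + b₂² + b₃² + b₄²)·[ (x₁² − a·x₂² − b·x₃² + a·b·x₄² − 1)² + (y₁² − a·y₂² − b·y₃² + a·b·y₄² − 1)² + (∏_{j=0}^{2309} (n − j))² + (2x₁ + 2y₁ + n − t)² ] = 0. In particular, ℤ is definable over ℚ by a ∀∃-formula with just two universal quantifiers. -/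
open scoped NumberTheorySymbols

theorem exists_sq_modEq_of_squarefree (n : ℤ) (m : ℕ) (hm : Squarefree m)
    (h : ∀ p : ℕ, p.Prime → p ≠ 2 → p ∣ m → ∃ r : ℤ, (p : ℤ) ∣ r ^ 2 - n) :
    ∃ r : ℤ, (m : ℤ) ∣ r ^ 2 - n := by
  induction m using induction_on_primes with
  | zero => exact absurd hm not_squarefree_zero
  | one => exact ⟨0, by simp⟩
  | prime_mul p k hp ih =>
    have hcop : Nat.Coprime p k := Nat.coprime_of_squarefree_mul hm
    obtain ⟨r₂, hr₂⟩ := ih (hm.squarefree_of_dvd (dvd_mul_left _ _))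
      fun q hq hq2 hqk => h q hq hq2 (hqk.mul_left p)
    have hp' : ∃ r : ℤ, (p : ℤ) ∣ r ^ 2 - n := by
      by_cases h2 : p = 2
      · subst h2
        refine ⟨n, ?_⟩
        have : n ^ 2 - n = (n - 1) * (n - 1 + 1) := by ring
        rw [this]
        exact (Int.even_mul_succ_self _).two_dvd
      · exact h p hp h2 (dvd_mul_right _ _)
    obtain ⟨r₁, hr₁⟩ := hp'
    obtain ⟨u, v, huv⟩ := Nat.isCoprime_iff_coprime.mpr hcop
    refine ⟨r₁ * (v * k) + r₂ * (u * p), ?_⟩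
    push_cast
    refine (Nat.isCoprime_iff_coprime.mpr hcop).mul_dvd ?_ ?_
    · have : (r₁ * (v * k) + r₂ * (u * p)) ^ 2 - n
          = (r₁ ^ 2 - n) + p * ((r₂ - r₁) * u * (2 * r₁ + p * u * (r₂ - r₁))) := by
        have hv : v * k = 1 - u * p := by linarith
        rw [hv]; ring
      rw [this]
      exact dvd_add hr₁ (dvd_mul_right _ _)
    · have : (r₁ * (v * k) + r₂ * (u * p)) ^ 2 - n
          = (r₂ ^ 2 - n) + k * ((r₁ - r₂) * v * (2 * r₂ + k * v * (r₁ - r₂))) := by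
        have hv : u * p = 1 - v * k := by linarith
        rw [hv]; ring
      rw [this]
      exact dvd_add hr₂ (dvd_mul_right _ _)

theorem Nat.lt_sqrt_pred_succ_iff {n x : ℕ} (hn : 0 < n) :
    x < Nat.sqrt (n - 1) + 1 ↔ x ^ 2 < n := by
  rw [Nat.lt_succ_iff, Nat.le_sqrt']
  omega

theorem Nat.le_sqrt_pred_succ_sq {n : ℕ} : n ≤ (Nat.sqrt (n - 1) + 1) ^ 2 := by
  have := Nat.lt_succ_sqrt' (n - 1)
  rw [Nat.succ_eq_add_one] at this
  omega

theorem Nat.lt_sqrt_pred_succ_sq {n : ℕ} (hn : Squarefree n) (h1 : n ≠ 1) :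
    n < (Nat.sqrt (n - 1) + 1) ^ 2 := by
  refine lt_of_le_of_ne Nat.le_sqrt_pred_succ_sq fun h => h1 ?_
  have := hn (Nat.sqrt (n - 1) + 1) (by rw [← sq, ← h])
  rw [Nat.isUnit_iff] at this
  rw [h, this, one_pow]

theorem Nat.sub_sq_lt_of_lt_sqrt_pred_succ {n s t : ℕ} (hn : 0 < n)
    (hs : s < Nat.sqrt (n - 1) + 1) (ht : t < Nat.sqrt (n - 1) + 1) :
    ((t : ℤ) - s) ^ 2 < (n : ℤ) := by
  rw [Nat.lt_sqrt_pred_succ_iff hn] at hs ht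
  have hs₂ : (s : ℤ) ^ 2 < n := by exact_mod_cast hs
  have ht₂ : (t : ℤ) ^ 2 < n := by exact_mod_cast ht
  rcases le_total (s : ℤ) t with h | h
  · exact (pow_le_pow_left₀ (by omega) (by omega) 2).trans_lt ht₂
  · rw [← neg_sq]
    exact lt_of_le_of_lt (pow_le_pow_left₀ (by omega) (by omega) 2) hs₂

/-- A small nonzero vector in the sublattice of `ℤ³` cut out by three linear congruences. -/
theorem exists_small_of_congruences {a b c : ℕ} (ha : Squarefree a) (hb : Squarefree b)
    (hc : Squarefree c) (hbc : b.Coprime c)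
    (h1 : ¬ (a = 1 ∧ b = 1 ∧ c = 1)) (r₁ r₂ r₃ : ℤ) :
    ∃ x y z : ℤ, ¬ (x = 0 ∧ y = 0 ∧ z = 0) ∧ x ^ 2 < b * c ∧ y ^ 2 < a * c ∧ z ^ 2 < a * b ∧
      (a : ℤ) ∣ b * y - r₁ * z ∧ (b : ℤ) ∣ a * x - r₂ * z ∧ (c : ℤ) ∣ a * x - r₃ * y := by
  have ha0 : 0 < a := ha.ne_zero.bot_lt
  have hb0 : 0 < b := hb.ne_zero.bot_lt
  have hc0 : 0 < c := hc.ne_zero.bot_lt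
  have : NeZero a := ⟨ha0.ne'⟩
  have : NeZero b := ⟨hb0.ne'⟩
  have : NeZero c := ⟨hc0.ne'⟩
  set X := Nat.sqrt (b * c - 1) + 1 with hX
  set Y := Nat.sqrt (a * c - 1) + 1 with hY
  set Z := Nat.sqrt (a * b - 1) + 1 with hZ
  have hXl : b * c ≤ X ^ 2 := Nat.le_sqrt_pred_succ_sq
  have hYl : a * c ≤ Y ^ 2 := Nat.le_sqrt_pred_succ_sq
  have hZl : a * b ≤ Z ^ 2 := Nat.le_sqrt_pred_succ_sq
  have hbc0 : 0 < b * c := by positivity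
  have hac0 : 0 < a * c := by positivity
  have hab0 : 0 < a * b := by positivity
  have hlt : a * b * c < X * Y * Z := by
    have key : (a * b * c) ^ 2 < (X * Y * Z) ^ 2 := by
      have e1 : (a * b * c) ^ 2 = (b * c) * (a * c) * (a * b) := by ring
      have e2 : (X * Y * Z) ^ 2 = X ^ 2 * Y ^ 2 * Z ^ 2 := by ring
      rw [e1, e2]
      by_cases hbc1 : b * c = 1
      · have hb1 : b = 1 := Nat.eq_one_of_mul_eq_one_right hbc1
        have hc1 : c = 1 := Nat.eq_one_of_mul_eq_one_left hbc1
        have ha1 : a ≠ 1 := fun h => h1 ⟨h, hb1, hc1⟩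
        have hZs : a * b < Z ^ 2 :=
          Nat.lt_sqrt_pred_succ_sq (by rwa [hb1, mul_one]) (by rwa [hb1, mul_one])
        calc b * c * (a * c) * (a * b) < b * c * (a * c) * Z ^ 2 := by gcongr
          _ ≤ _ := by gcongr
      · have hXs : b * c < X ^ 2 :=
          Nat.lt_sqrt_pred_succ_sq ((Nat.squarefree_mul hbc).2 ⟨hb, hc⟩) hbc1
        calc b * c * (a * c) * (a * b) < X ^ 2 * (a * c) * (a * b) := by gcongr
          _ ≤ _ := by gcongr
    exact lt_of_pow_lt_pow_left₀ 2 (Nat.zero_le _) key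
  let S := Finset.range X ×ˢ Finset.range Y ×ˢ Finset.range Z
  let F : ℕ × ℕ × ℕ → ZMod a × ZMod b × ZMod c := fun v =>
    (((b * v.2.1 - r₁ * v.2.2 : ℤ) : ZMod a), ((a * v.1 - r₂ * v.2.2 : ℤ) : ZMod b),
      ((a * v.1 - r₃ * v.2.1 : ℤ) : ZMod c))
  have hcard : (Finset.univ : Finset (ZMod a × ZMod b × ZMod c)).card < S.card := by
    simp only [S, Finset.card_univ, Fintype.card_prod, ZMod.card, Finset.card_product,
      Finset.card_range]
    rw [← mul_assoc, ← mul_assoc]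
    exact hlt
  obtain ⟨v, hv, w, hw, hvw, hF⟩ :=
    Finset.exists_ne_map_eq_of_card_lt_of_maps_to hcard (f := F) (fun _ _ => Finset.mem_univ _)
  obtain ⟨x, y, z⟩ := v
  obtain ⟨x', y', z'⟩ := w
  simp only [S, Finset.mem_product, Finset.mem_range] at hv hw
  simp only [F, Prod.mk.injEq, ZMod.intCast_eq_intCast_iff_dvd_sub] at hF
  refine ⟨(x' : ℤ) - x, (y' : ℤ) - y, (z' : ℤ) - z, ?_, ?_, ?_, ?_, ?_, ?_, ?_⟩
  · rintro ⟨h1, h2, h3⟩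
    apply hvw
    simp only [Prod.mk.injEq]
    omega
  · exact_mod_cast Nat.sub_sq_lt_of_lt_sqrt_pred_succ hbc0 hv.1 hw.1
  · exact_mod_cast Nat.sub_sq_lt_of_lt_sqrt_pred_succ hac0 hv.2.1 hw.2.1
  · exact_mod_cast Nat.sub_sq_lt_of_lt_sqrt_pred_succ hab0 hv.2.2 hw.2.2
  · convert hF.1 using 1; ring
  · convert hF.2.1 using 1; ring
  · convert hF.2.2 using 1; ring

/-- **Legendre's theorem** on ternary quadratic forms, in normalized form. -/
theorem exists_legendre_solution {a b c : ℕ} (ha : Squarefree a) (hb : Squarefree b)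
    (hc : Squarefree c) (hab : a.Coprime b) (hac : a.Coprime c) (hbc : b.Coprime c)
    {r₁ r₂ r₃ : ℤ} (h₁ : (a : ℤ) ∣ r₁ ^ 2 - b * c) (h₂ : (b : ℤ) ∣ r₂ ^ 2 - a * c)
    (h₃ : (c : ℤ) ∣ r₃ ^ 2 - -(a * b)) :
    ∃ x y z : ℤ, ¬ (x = 0 ∧ y = 0 ∧ z = 0) ∧ a * x ^ 2 + b * y ^ 2 = c * z ^ 2 := by
  by_cases h1 : a = 1 ∧ b = 1 ∧ c = 1
  · obtain ⟨rfl, rfl, rfl⟩ := h1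
    exact ⟨1, 0, 1, by simp, by simp⟩
  obtain ⟨x, y, z, hne, hx, hy, hz, d₁, d₂, d₃⟩ :=
    exists_small_of_congruences ha hb hc hbc h1 r₁ r₂ r₃
  have ha0 : (0 : ℤ) < a := by exact_mod_cast ha.ne_zero.bot_lt
  have hb0 : (0 : ℤ) < b := by exact_mod_cast hb.ne_zero.bot_lt
  have hc0 : (0 : ℤ) < c := by exact_mod_cast hc.ne_zero.bot_lt
  have hab' := Nat.isCoprime_iff_coprime.mpr hab
  have hac' := Nat.isCoprime_iff_coprime.mpr hac
  have hbc' := Nat.isCoprime_iff_coprime.mpr hbc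
  have ea : (a : ℤ) ∣ a * x ^ 2 + b * y ^ 2 - c * z ^ 2 := by
    refine hab'.dvd_of_dvd_mul_left ?_
    have : (b : ℤ) * (a * x ^ 2 + b * y ^ 2 - c * z ^ 2)
        = a * (b * x ^ 2) + (b * y - r₁ * z) * (b * y + r₁ * z) + (r₁ ^ 2 - b * c) * z ^ 2 := by
      ring
    rw [this]
    exact dvd_add (dvd_add (dvd_mul_right _ _) (d₁.mul_right _)) (h₁.mul_right _)
  have eb : (b : ℤ) ∣ a * x ^ 2 + b * y ^ 2 - c * z ^ 2 := by
    refine hab'.symm.dvd_of_dvd_mul_left ?_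
    have : (a : ℤ) * (a * x ^ 2 + b * y ^ 2 - c * z ^ 2)
        = b * (a * y ^ 2) + (a * x - r₂ * z) * (a * x + r₂ * z) + (r₂ ^ 2 - a * c) * z ^ 2 := by
      ring
    rw [this]
    exact dvd_add (dvd_add (dvd_mul_right _ _) (d₂.mul_right _)) (h₂.mul_right _)
  have ec : (c : ℤ) ∣ a * x ^ 2 + b * y ^ 2 - c * z ^ 2 := by
    refine hac'.symm.dvd_of_dvd_mul_left ?_
    have : (a : ℤ) * (a * x ^ 2 + b * y ^ 2 - c * z ^ 2)
        = c * (-(a * z ^ 2)) + (a * x - r₃ * y) * (a * x + r₃ * y)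
          + (r₃ ^ 2 - -(a * b)) * y ^ 2 := by
      ring
    rw [this]
    exact dvd_add (dvd_add (dvd_mul_right _ _) (d₃.mul_right _)) (h₃.mul_right _)
  obtain ⟨k, hk⟩ := (hac'.mul_left hbc').mul_dvd (hab'.mul_dvd ea eb) ec
  have habc : (0 : ℤ) < a * b * c := by positivity
  have hlo : -(a * b * c : ℤ) < a * b * c * k := by rw [← hk]; nlinarith [sq_nonneg x, sq_nonneg y]
  have hhi : (a * b * c : ℤ) * k < a * b * c * 2 := by rw [← hk]; nlinarith [sq_nonneg z]
  have hk1 : k < 2 := lt_of_mul_lt_mul_left hhi habc.le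
  have hk0 : -1 < k := by
    refine lt_of_mul_lt_mul_left (a := (a * b * c : ℤ)) ?_ habc.le
    linarith
  obtain rfl | rfl : k = 0 ∨ k = 1 := by omega
  · exact ⟨x, y, z, hne, by linarith⟩
  · refine ⟨x * z + b * y, y * z - a * x, z ^ 2 + a * b, ?_, ?_⟩
    · rintro ⟨-, -, h⟩
      have : (0 : ℤ) < a * b := by positivity
      nlinarith [sq_nonneg z]
    · have : (a * x ^ 2 + b * y ^ 2 : ℤ) = c * z ^ 2 + a * b * c := by linarith
      linear_combination ((z : ℤ) ^ 2 + a * b) * this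

/-- The Hilbert symbol `(a, b)` at an odd prime `p`, for nonzero integers `a` and `b`. -/
def oddHilbertSym (p : ℕ) (a b : ℤ) : ℤ :=
  J((-1) ^ (padicValInt p a * padicValInt p b) *
    (b / p ^ padicValInt p b) ^ padicValInt p a * (a / p ^ padicValInt p a) ^ padicValInt p b | p)

theorem Int.exists_eq_prime_pow_mul {p : ℕ} (hp : p.Prime) {a : ℤ} (ha : a ≠ 0) :
    ∃ (m : ℕ) (u : ℤ), a = p ^ m * u ∧ ¬ (p : ℤ) ∣ u := by
  have hf : FiniteMultiplicity (p : ℤ) a :=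
    Int.finiteMultiplicity_iff.mpr ⟨by simpa using hp.ne_one, ha⟩
  obtain ⟨u, hu, hu'⟩ := hf.exists_eq_pow_mul_and_not_dvd
  exact ⟨_, u, hu, hu'⟩

theorem padicValInt_prime_pow_mul {p : ℕ} (hp : p.Prime) (m : ℕ) {u : ℤ} (hu : ¬ (p : ℤ) ∣ u) :
    padicValInt p (p ^ m * u) = m := by
  have := Fact.mk hp
  have hp0 : (p : ℤ) ≠ 0 := by exact_mod_cast hp.ne_zero
  have hu0 : u ≠ 0 := by rintro rfl; simp at hu
  rw [padicValInt.mul (pow_ne_zero _ hp0) hu0, padicValInt.eq_zero_of_not_dvd hu, add_zero,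
    padicValInt, Int.natAbs_pow, Int.natAbs_natCast, padicValNat.prime_pow]

theorem jacobiSym_sq_eq_one_of_not_dvd {p : ℕ} (hp : p.Prime) {u : ℤ} (hu : ¬ (p : ℤ) ∣ u) :
    J(u | p) ^ 2 = 1 := by
  refine jacobiSym.sq_one ?_
  rw [← Int.isCoprime_iff_gcd_eq_one]
  exact ((Nat.prime_iff_prime_int.mp hp).coprime_iff_not_dvd.mpr hu).symm

theorem oddHilbertSym_eq {p : ℕ} (hp : p.Prime) {m n : ℕ} {u v : ℤ} (hu : ¬ (p : ℤ) ∣ u)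
    (hv : ¬ (p : ℤ) ∣ v) :
    oddHilbertSym p (p ^ m * u) (p ^ n * v) =
      J(-1 | p) ^ (m * n) * J(v | p) ^ m * J(u | p) ^ n := by
  have hp0 : (p : ℤ) ≠ 0 := by exact_mod_cast hp.ne_zero
  rw [oddHilbertSym, padicValInt_prime_pow_mul hp m hu, padicValInt_prime_pow_mul hp n hv,
    Int.mul_ediv_cancel_left _ (pow_ne_zero _ hp0), Int.mul_ediv_cancel_left _ (pow_ne_zero _ hp0),
    jacobiSym.mul_left, jacobiSym.mul_left, jacobiSym.pow_left, jacobiSym.pow_left,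
    jacobiSym.pow_left]

theorem oddHilbertSym_comm (p : ℕ) (a b : ℤ) : oddHilbertSym p a b = oddHilbertSym p b a := by
  unfold oddHilbertSym
  congr 1
  rw [mul_comm (padicValInt p a)]
  ring

theorem oddHilbertSym_mul_left {p : ℕ} (hp : p.Prime) {a b c : ℤ} (ha : a ≠ 0) (hb : b ≠ 0)
    (hc : c ≠ 0) :
    oddHilbertSym p (a * b) c = oddHilbertSym p a c * oddHilbertSym p b c := by
  obtain ⟨i, u, rfl, hu⟩ := Int.exists_eq_prime_pow_mul hp ha
  obtain ⟨j, v, rfl, hv⟩ := Int.exists_eq_prime_pow_mul hp hb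
  obtain ⟨k, w, rfl, hw⟩ := Int.exists_eq_prime_pow_mul hp hc
  have huv : ¬ (p : ℤ) ∣ u * v := (Nat.prime_iff_prime_int.mp hp).not_dvd_mul hu hv
  rw [show (p : ℤ) ^ i * u * (p ^ j * v) = p ^ (i + j) * (u * v) by ring,
    oddHilbertSym_eq hp huv hw, oddHilbertSym_eq hp hu hw, oddHilbertSym_eq hp hv hw,
    jacobiSym.mul_left]
  ring

theorem oddHilbertSym_mul_right {p : ℕ} (hp : p.Prime) {a b c : ℤ} (ha : a ≠ 0) (hb : b ≠ 0)
    (hc : c ≠ 0) :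
    oddHilbertSym p a (b * c) = oddHilbertSym p a b * oddHilbertSym p a c := by
  rw [oddHilbertSym_comm, oddHilbertSym_mul_left hp hb hc ha, oddHilbertSym_comm p b,
    oddHilbertSym_comm p c]

theorem oddHilbertSym_sq {p : ℕ} (hp : p.Prime) {a b : ℤ} (ha : a ≠ 0) (hb : b ≠ 0) :
    oddHilbertSym p a b ^ 2 = 1 := by
  obtain ⟨i, u, rfl, hu⟩ := Int.exists_eq_prime_pow_mul hp ha
  obtain ⟨j, v, rfl, hv⟩ := Int.exists_eq_prime_pow_mul hp hb
  have h1 : ¬ (p : ℤ) ∣ -1 := by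
    rw [Int.dvd_neg, Int.natCast_dvd]
    simpa using hp.ne_one
  rw [oddHilbertSym_eq hp hu hv, mul_pow, mul_pow, pow_right_comm, pow_right_comm _ i,
    pow_right_comm _ j, jacobiSym_sq_eq_one_of_not_dvd hp hu, jacobiSym_sq_eq_one_of_not_dvd hp hv,
    jacobiSym_sq_eq_one_of_not_dvd hp h1]
  simp

theorem oddHilbertSym_of_not_dvd_left {p : ℕ} (hp : p.Prime) {a v : ℤ} (n : ℕ)
    (ha : ¬ (p : ℤ) ∣ a) (hv : ¬ (p : ℤ) ∣ v) :
    oddHilbertSym p a (p ^ n * v) = J(a | p) ^ n := by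
  simpa using oddHilbertSym_eq hp (m := 0) ha hv

theorem oddHilbertSym_of_not_dvd {p : ℕ} (hp : p.Prime) {a b : ℤ} (ha : ¬ (p : ℤ) ∣ a)
    (hb : ¬ (p : ℤ) ∣ b) : oddHilbertSym p a b = 1 := by
  simpa using oddHilbertSym_of_not_dvd_left hp 0 ha hb

theorem oddHilbertSym_sq_mul_left {p : ℕ} (hp : p.Prime) {k a b : ℤ} (hk : k ≠ 0) (ha : a ≠ 0)
    (hb : b ≠ 0) : oddHilbertSym p (k ^ 2 * a) b = oddHilbertSym p a b := by
  rw [oddHilbertSym_mul_left hp (pow_ne_zero 2 hk) ha hb, sq, oddHilbertSym_mul_left hp hk hk hb,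
    ← sq, oddHilbertSym_sq hp hk hb, one_mul]

theorem exists_prime_dvd_sq_sub {p : ℕ} (hp : p.Prime) {n : ℤ} (h : J(n | p) = 1) :
    ∃ r : ℤ, (p : ℤ) ∣ r ^ 2 - n := by
  have := Fact.mk hp
  obtain ⟨r, hr⟩ := ZMod.isSquare_of_jacobiSym_eq_one h
  refine ⟨r.val, ?_⟩
  rw [← ZMod.intCast_zmod_eq_zero_iff_dvd]
  push_cast
  rw [hr, ZMod.natCast_zmod_val]
  ring

theorem exists_legendre_solution_int {a b : ℤ} {g : ℕ} (ha : Squarefree a.natAbs)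
    (hb : Squarefree b.natAbs) (hg : Squarefree g) (hab : a.natAbs.Coprime b.natAbs)
    (hag : a.natAbs.Coprime g) (hbg : b.natAbs.Coprime g) (hpos : 0 < a ∨ 0 < b)
    (h₁ : ∃ r : ℤ, (a.natAbs : ℤ) ∣ r ^ 2 - g * b) (h₂ : ∃ r : ℤ, (b.natAbs : ℤ) ∣ r ^ 2 - g * a)
    (h₃ : ∃ r : ℤ, (g : ℤ) ∣ r ^ 2 - -(a * b)) :
    ∃ x y z : ℤ, ¬ (x = 0 ∧ y = 0 ∧ z = 0) ∧ a * x ^ 2 + b * y ^ 2 = g * z ^ 2 := by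
  wlog ha0 : 0 < a generalizing a b
  · obtain ⟨x, y, z, h0, h⟩ := this hb ha hab.symm hbg hag hpos.symm h₂ h₁
      (by simpa only [mul_comm] using h₃) (hpos.resolve_left ha0)
    exact ⟨y, x, z, by tauto, by linarith⟩
  lift a to ℕ using ha0.le
  obtain ⟨r₁, h₁⟩ := h₁
  obtain ⟨r₂, h₂⟩ := h₂
  obtain ⟨r₃, h₃⟩ := h₃
  rw [Int.natAbs_natCast] at ha hab hag h₁
  obtain ⟨n, rfl | rfl⟩ := b.eq_nat_or_neg
  · rw [Int.natAbs_natCast] at hb hab hbg h₂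
    refine exists_legendre_solution ha hb hg hab hag hbg (r₁ := r₁) (r₂ := r₂) (r₃ := r₃) ?_ ?_ h₃
    · rwa [mul_comm]
    · rwa [mul_comm]
  · rw [Int.natAbs_neg, Int.natAbs_natCast] at hb hab hbg h₂
    obtain ⟨x, y, z, h0, h⟩ := exists_legendre_solution hg hb ha hbg.symm hag.symm hab.symm
      (r₁ := r₃) (r₂ := r₂) (r₃ := r₁) (by convert h₃ using 2; ring) h₂
      (by convert h₁ using 2; ring)
    exact ⟨z, y, x, by tauto, by linear_combination -h⟩

theorem Int.Squarefree.not_dvd_right {p : ℕ} (hp : p.Prime) {a b : ℤ} (h : Squarefree (a * b))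
    (ha : (p : ℤ) ∣ a) : ¬ (p : ℤ) ∣ b := fun hb =>
  (Nat.prime_iff_prime_int.mp hp).not_isUnit (h p (mul_dvd_mul ha hb))

theorem exists_solution_of_oddHilbertSym_of_squarefree {a b : ℤ} (ha : Squarefree a)
    (hb : Squarefree b) (hpos : 0 < a ∨ 0 < b)
    (h : ∀ p : ℕ, p.Prime → p ≠ 2 → oddHilbertSym p a b = 1) :
    ∃ x y z : ℤ, ¬ (x = 0 ∧ y = 0 ∧ z = 0) ∧ a * x ^ 2 + b * y ^ 2 = z ^ 2 := by
  have hg0 : 0 < Int.gcd a b := Int.gcd_pos_of_ne_zero_left _ ha.ne_zero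
  obtain ⟨a', b', hab, ea, eb⟩ := Int.exists_gcd_one hg0
  generalize Int.gcd a b = g at *
  subst ea eb
  have hg0' : (0 : ℤ) < g := by exact_mod_cast hg0
  have sa : Squarefree a'.natAbs :=
    Int.squarefree_natAbs.mpr (ha.squarefree_of_dvd (dvd_mul_right _ _))
  have sb : Squarefree b'.natAbs :=
    Int.squarefree_natAbs.mpr (hb.squarefree_of_dvd (dvd_mul_right _ _))
  have sg : Squarefree g := by
    have := Int.squarefree_natAbs.mpr (ha.squarefree_of_dvd (dvd_mul_left _ _))
    rwa [Int.natAbs_natCast] at this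
  have cab : a'.natAbs.Coprime b'.natAbs := hab
  have cag : a'.natAbs.Coprime g := by
    have := Int.squarefree_natAbs.mpr ha
    rw [Int.natAbs_mul, Int.natAbs_natCast] at this
    exact Nat.coprime_of_squarefree_mul this
  have cbg : b'.natAbs.Coprime g := by
    have := Int.squarefree_natAbs.mpr hb
    rw [Int.natAbs_mul, Int.natAbs_natCast] at this
    exact Nat.coprime_of_squarefree_mul this
  have key : ∀ {c d : ℤ}, Squarefree (c * g) → c.natAbs.Coprime d.natAbs →
      (∀ p : ℕ, p.Prime → p ≠ 2 → oddHilbertSym p (c * g) (d * g) = 1) →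
      ∀ p : ℕ, p.Prime → p ≠ 2 → p ∣ c.natAbs → ∃ r : ℤ, (p : ℤ) ∣ r ^ 2 - g * d := by
    intro c d hc hcd h p hp hp2 hpc
    have hpd : ¬ (p : ℤ) ∣ d := by
      intro hd
      exact hp.not_dvd_one (hcd ▸ Nat.dvd_gcd hpc (Int.natCast_dvd.mp hd))
    rw [← Int.natCast_dvd] at hpc
    have hpg : ¬ (p : ℤ) ∣ g := Int.Squarefree.not_dvd_right hp hc hpc
    have hdg : ¬ (p : ℤ) ∣ d * g := (Nat.prime_iff_prime_int.mp hp).not_dvd_mul hpd hpg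
    obtain ⟨k, rfl⟩ := hpc
    have hk : ¬ (p : ℤ) ∣ k * g :=
      Int.Squarefree.not_dvd_right hp (by rwa [mul_assoc] at hc) dvd_rfl
    have := h p hp hp2
    rw [oddHilbertSym_comm, mul_assoc, ← pow_one (p : ℤ),
      oddHilbertSym_of_not_dvd_left hp 1 hdg hk, pow_one, mul_comm] at this
    exact exists_prime_dvd_sq_sub hp this
  have h₃ : ∀ p : ℕ, p.Prime → p ≠ 2 → p ∣ g → ∃ r : ℤ, (p : ℤ) ∣ r ^ 2 - -(a' * b') := by
    intro p hp hp2 hpg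
    obtain ⟨k, rfl⟩ := hpg
    have e : ∀ c : ℤ, c * ((p * k : ℕ) : ℤ) = p ^ 1 * (k * c) := by intro c; push_cast; ring
    have hka : ¬ (p : ℤ) ∣ k * a' :=
      Int.Squarefree.not_dvd_right hp (by rwa [e, pow_one] at ha) dvd_rfl
    have hkb : ¬ (p : ℤ) ∣ k * b' :=
      Int.Squarefree.not_dvd_right hp (by rwa [e, pow_one] at hb) dvd_rfl
    have hk : ¬ (p : ℤ) ∣ k := fun h => hka (h.mul_right _)
    have := h p hp hp2
    rw [e, e, oddHilbertSym_eq hp hka hkb] at this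
    apply exists_prime_dvd_sq_sub hp
    rw [← neg_one_mul, jacobiSym.mul_left, jacobiSym.mul_left]
    rw [jacobiSym.mul_left, jacobiSym.mul_left] at this
    linear_combination this - J(-1 | p) * J(a' | p) * J(b' | p) *
      jacobiSym_sq_eq_one_of_not_dvd hp hk
  obtain ⟨x, y, z, h0, hz⟩ := exists_legendre_solution_int sa sb sg cab cag cbg
    (hpos.imp (fun h => pos_of_mul_pos_left h hg0'.le) fun h => pos_of_mul_pos_left h hg0'.le)
    (exists_sq_modEq_of_squarefree _ _ sa (key ha cab h))
    (exists_sq_modEq_of_squarefree _ _ sb (key hb cab.symm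
      fun p hp hp2 => by rw [oddHilbertSym_comm]; exact h p hp hp2))
    (exists_sq_modEq_of_squarefree _ _ sg h₃)
  refine ⟨x, y, g * z, ?_, by linear_combination (g : ℤ) * hz⟩
  rintro ⟨hx, hy, hgz⟩
  exact h0 ⟨hx, hy, (mul_eq_zero.mp hgz).resolve_left hg0'.ne'⟩

theorem Int.exists_sq_mul_squarefree {a : ℤ} (ha : a ≠ 0) :
    ∃ k r : ℤ, k ≠ 0 ∧ Squarefree r ∧ a = k ^ 2 * r := by
  obtain ⟨r, k, h, hr⟩ := Nat.sq_mul_squarefree a.natAbs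
  have hk : (k : ℤ) ≠ 0 := by
    rintro hk
    rw [Nat.cast_eq_zero.mp hk, zero_pow two_ne_zero, zero_mul] at h
    exact ha (Int.natAbs_eq_zero.mp h.symm)
  have hr' : Squarefree (r : ℤ) := by rwa [← Int.squarefree_natAbs, Int.natAbs_natCast]
  rcases Int.natAbs_eq a with e | e <;> rw [← h] at e
  · exact ⟨k, r, hk, hr', by simpa using e⟩
  · exact ⟨k, -r, hk, by rwa [← Int.squarefree_natAbs, Int.natAbs_neg, Int.natAbs_natCast],
      by simpa using e⟩

/-- The Hasse principle for `a x² + b y² = z²`, with the condition at `2` omitted. -/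
theorem exists_solution_of_oddHilbertSym {a b : ℤ} (ha : a ≠ 0) (hb : b ≠ 0)
    (hpos : 0 < a ∨ 0 < b) (h : ∀ p : ℕ, p.Prime → p ≠ 2 → oddHilbertSym p a b = 1) :
    ∃ x y z : ℤ, ¬ (x = 0 ∧ y = 0 ∧ z = 0) ∧ a * x ^ 2 + b * y ^ 2 = z ^ 2 := by
  obtain ⟨k, r, hk, hr, rfl⟩ := Int.exists_sq_mul_squarefree ha
  obtain ⟨l, s, hl, hs, rfl⟩ := Int.exists_sq_mul_squarefree hb
  have hk2 : 0 < k ^ 2 := by positivity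
  have hl2 : 0 < l ^ 2 := by positivity
  obtain ⟨x, y, z, h0, hz⟩ := exists_solution_of_oddHilbertSym_of_squarefree hr hs
    (hpos.imp (fun h => pos_of_mul_pos_right h hk2.le) fun h => pos_of_mul_pos_right h hl2.le)
    fun p hp hp2 => by
      rw [← h p hp hp2, oddHilbertSym_sq_mul_left hp hk hr.ne_zero hb, oddHilbertSym_comm p r,
        oddHilbertSym_comm p r, oddHilbertSym_sq_mul_left hp hl hs.ne_zero hr.ne_zero]
  refine ⟨l * x, k * y, k * l * z, ?_, by linear_combination (k * l) ^ 2 * hz⟩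
  simpa [hk, hl] using h0

theorem jacobiSym_eq_of_mod_four_eq_one {d : ℤ} (hd : d % 4 = 1) {q : ℕ} (hq : Odd q) :
    J(d | q) = J(q | d.natAbs) := by
  obtain ⟨n, rfl | rfl⟩ := d.eq_nat_or_neg
  · rw [Int.natAbs_natCast]
    exact jacobiSym.quadratic_reciprocity_one_mod_four (by omega) hq
  · rw [Int.natAbs_neg, Int.natAbs_natCast, jacobiSym.neg _ hq]
    rcases Nat.odd_mod_four_iff.mp (Nat.odd_iff.mp hq) with h | h
    · rw [ZMod.χ₄_nat_one_mod_four h, one_mul]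
      exact jacobiSym.quadratic_reciprocity_one_mod_four' (by rw [Nat.odd_iff]; omega) h
    · rw [ZMod.χ₄_nat_three_mod_four h,
        jacobiSym.quadratic_reciprocity_three_mod_four (by omega) h]
      simp

theorem jacobiSym_eq_of_mod_four_eq_three {a : ℤ} (ha : a % 4 = 3) {q : ℕ} (hq : Odd q) :
    J(a | q) = ZMod.χ₄ q * J(q | a.natAbs) := by
  rw [← Int.natAbs_neg, ← jacobiSym_eq_of_mod_four_eq_one (by omega) hq, ← jacobiSym.neg _ hq,
    neg_neg]

theorem Int.exists_modEq_modEq {m n : ℤ} (h : IsCoprime m n) (r s : ℤ) :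
    ∃ x : ℤ, x ≡ r [ZMOD m] ∧ x ≡ s [ZMOD n] := by
  obtain ⟨u, v, huv⟩ := h
  refine ⟨r * (v * n) + s * (u * m), ?_, ?_⟩
  · refine (Int.modEq_iff_dvd.mpr ⟨(r - s) * u, ?_⟩)
    linear_combination -r * huv
  · refine (Int.modEq_iff_dvd.mpr ⟨(s - r) * v, ?_⟩)
    linear_combination -s * huv

theorem jacobiSym_congr {m n : ℕ} {x y : ℤ} (h : x ≡ y [ZMOD n]) (hm : m ∣ n) :
    J(x | m) = J(y | m) :=
  jacobiSym.mod_left' (h.of_dvd (Int.natCast_dvd_natCast.mpr hm))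

theorem exists_jacobiSym_eq_neg_one {p : ℕ} (hp : p.Prime) (hp2 : p ≠ 2) :
    ∃ x : ℤ, J(x | p) = -1 := by
  have := Fact.mk hp
  obtain ⟨x, hx⟩ := FiniteField.exists_nonsquare (F := ZMod p) (by rwa [ZMod.ringChar_zmod_n])
  refine ⟨x.val, ZMod.nonsquare_iff_jacobiSym_eq_neg_one.mpr ?_⟩
  simpa using hx

theorem exists_jacobiSym_eq_of_squarefree {m : ℕ} (hm : Squarefree m) (hodd : ¬ 2 ∣ m) {η : ℕ → ℤ}
    (hη : ∀ p : ℕ, p.Prime → η p = 1 ∨ η p = -1) :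
    ∃ x : ℤ, ∀ p : ℕ, p.Prime → p ∣ m → J(x | p) = η p := by
  induction m using induction_on_primes with
  | zero => exact absurd hm not_squarefree_zero
  | one => exact ⟨0, fun p hp h => absurd h hp.not_dvd_one⟩
  | prime_mul p k hp ih =>
    have hcop : Nat.Coprime p k := Nat.coprime_of_squarefree_mul hm
    obtain ⟨r, hr⟩ := ih (hm.squarefree_of_dvd (dvd_mul_left _ _))
      fun h => hodd (h.mul_left p)
    have hp2 : p ≠ 2 := fun h => hodd (h ▸ dvd_mul_right _ _)
    obtain ⟨s, hs⟩ : ∃ s : ℤ, J(s | p) = η p := by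
      rcases hη p hp with h | h
      · exact ⟨1, by rw [h, jacobiSym.one_left]⟩
      · rw [h]
        exact exists_jacobiSym_eq_neg_one hp hp2
    obtain ⟨x, hx₁, hx₂⟩ := Int.exists_modEq_modEq (Nat.isCoprime_iff_coprime.mpr hcop) s r
    refine ⟨x, fun q hq hqm => ?_⟩
    rcases (hq.dvd_mul).mp hqm with h | h
    · obtain rfl := (Nat.prime_dvd_prime_iff_eq hq hp).mp h
      rw [← hs, jacobiSym_congr hx₁ dvd_rfl]
    · rw [← hr q hq h, jacobiSym_congr hx₂ h]

theorem Int.gcd_eq_one_of_jacobiSym_ne_zero {x : ℤ} {m : ℕ}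
    (h : ∀ p : ℕ, p.Prime → p ∣ m → J(x | p) ≠ 0) : x.gcd m = 1 := by
  by_contra hne
  obtain ⟨p, hp, hpd⟩ := Nat.exists_prime_and_dvd hne
  have hpm : p ∣ m := hpd.trans (by simpa using Int.gcd_dvd_natAbs_right x m)
  refine h p hp hpm (jacobiSym.eq_zero_iff.mpr ⟨hp.ne_zero, fun h1 => ?_⟩)
  have : p ∣ Int.gcd x p :=
    Int.dvd_gcd ((Int.natCast_dvd_natCast.mpr hpd).trans (Int.gcd_dvd_left _ _)) dvd_rfl
  rw [h1] at this
  exact hp.not_dvd_one this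

theorem Int.eq_sq_of_mul_sq_eq_sq {n y z : ℤ} (hy : y ≠ 0) (h : n * y ^ 2 = z ^ 2) :
    ∃ k : ℤ, n = k ^ 2 := by
  obtain ⟨k, rfl⟩ : y ∣ z := (Int.pow_dvd_pow_iff two_ne_zero).mp ⟨n, by rw [← h, mul_comm]⟩
  refine ⟨k, mul_right_cancel₀ (pow_ne_zero 2 hy) ?_⟩
  rw [h]; ring

/-- Existence of a prime with prescribed Legendre symbols at the primes dividing `a`, prescribed
residue modulo `d`, and with `a` and `d` as quadratic residues. -/
theorem exists_prime_jacobiSym_eq {a d f₀ : ℤ} (ha : a % 4 = 3) (hsq : Squarefree a)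
    (hd : d % 4 = 1) (hcop : a.natAbs.Coprime d.natAbs) {η : ℕ → ℤ}
    (hη : ∀ p : ℕ, p.Prime → η p = 1 ∨ η p = -1) (hf₀ : J(f₀ | d.natAbs) = 1) (N : ℕ) :
    ∃ q : ℕ, N < q ∧ q.Prime ∧ J(a | q) = 1 ∧ J(d | q) = 1 ∧ (q : ℤ) ≡ f₀ [ZMOD d.natAbs] ∧
      ∀ p : ℕ, p.Prime → p ∣ a.natAbs → J(q | p) = η p := by
  obtain ⟨xa, hxa⟩ := exists_jacobiSym_eq_of_squarefree (Int.squarefree_natAbs.mpr hsq)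
    (by omega) hη
  have hxa1 : xa.gcd a.natAbs = 1 := by
    refine Int.gcd_eq_one_of_jacobiSym_ne_zero fun p hp hpa => ?_
    rw [hxa p hp hpa]
    rcases hη p hp with h | h <;> simp [h]
  have hf1 : f₀.gcd d.natAbs = 1 := by
    by_contra h
    have : J(f₀ | d.natAbs) = 0 := jacobiSym.eq_zero_iff.mpr ⟨by omega, h⟩
    omega
  obtain ⟨c, hχ, hc4, hc⟩ : ∃ c : ℤ, ZMod.χ₄ c = J(xa | a.natAbs) ∧ IsCoprime c 4 ∧ c % 2 = 1 := by
    rcases jacobiSym.eq_one_or_neg_one hxa1 with h | h <;> rw [h]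
    · exact ⟨1, rfl, by norm_num, by norm_num⟩
    · exact ⟨3, rfl, by norm_num, by norm_num⟩
  have cop4 : IsCoprime (a.natAbs * d.natAbs : ℤ) 4 := by
    have h1 : Odd (a.natAbs * d.natAbs) := by
      rw [Nat.odd_mul, Nat.odd_iff, Nat.odd_iff]; omega
    have := Nat.isCoprime_iff_coprime.mpr (Nat.Coprime.pow_right 2 (Nat.coprime_two_right.mpr h1))
    exact_mod_cast this
  obtain ⟨y, hya, hyd⟩ := Int.exists_modEq_modEq (Nat.isCoprime_iff_coprime.mpr hcop) xa f₀
  obtain ⟨x, hxy, hxc⟩ := Int.exists_modEq_modEq cop4 y c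
  have cong : ∀ {u v : ℤ} {m : ℤ}, u ≡ v [ZMOD m] → IsCoprime v m → IsCoprime u m := by
    intro u v m h hv
    obtain ⟨k, hk⟩ := h.dvd
    have : u = v + m * (-k) := by linear_combination -hk
    rw [this]
    exact (IsCoprime.add_mul_left_left_iff).mpr hv
  have copx : IsCoprime x ((a.natAbs * d.natAbs * 4 : ℕ) : ℤ) := by
    rw [Nat.cast_mul, Nat.cast_mul, Nat.cast_ofNat]
    refine IsCoprime.mul_right (IsCoprime.mul_right ?_ ?_) (cong hxc hc4)
    · exact cong ((hxy.of_dvd (dvd_mul_right _ _)).trans hya)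
        (Int.isCoprime_iff_gcd_eq_one.mpr hxa1)
    · exact cong ((hxy.of_dvd (dvd_mul_left _ _)).trans hyd) (Int.isCoprime_iff_gcd_eq_one.mpr hf1)
  obtain ⟨q, hNq, hq, hqx⟩ := Nat.forall_exists_prime_gt_and_zmodEq N
    (by simp; omega) copx
  rw [Nat.cast_mul, Nat.cast_mul, Nat.cast_ofNat] at hqx
  have hqa : (q : ℤ) ≡ xa [ZMOD a.natAbs] :=
    ((hqx.of_dvd ⟨d.natAbs * 4, by ring⟩).trans (hxy.of_dvd (dvd_mul_right _ _))).trans hya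
  have hqd : (q : ℤ) ≡ f₀ [ZMOD d.natAbs] :=
    ((hqx.of_dvd ⟨a.natAbs * 4, by ring⟩).trans (hxy.of_dvd (dvd_mul_left _ _))).trans hyd
  have hqc : (q : ℤ) ≡ c [ZMOD 4] := (hqx.of_dvd (dvd_mul_left _ _)).trans hxc
  have hodd : Odd q := by
    rw [Nat.odd_iff]
    have : (q : ℤ) % 4 = c % 4 := hqc
    omega
  refine ⟨q, hNq, hq, ?_, ?_, hqd, fun p hp hpa => ?_⟩
  · have h4 : ((q : ℕ) : ZMod 4) = ((c : ℤ) : ZMod 4) := by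
      have := (ZMod.intCast_eq_intCast_iff (q : ℤ) c 4).mpr hqc
      simpa using this
    rw [jacobiSym_eq_of_mod_four_eq_three ha hodd, h4, hχ, jacobiSym_congr hqa dvd_rfl, ← sq]
    exact jacobiSym.sq_one hxa1
  · rw [jacobiSym_eq_of_mod_four_eq_one hd hodd, jacobiSym_congr hqd dvd_rfl, hf₀]
  · rw [jacobiSym_congr hqa hpa, hxa p hp hpa]

/-- A number which is divisible exactly once by the odd primes in `R` and by no other odd primes,
and whose Jacobi symbol modulo `d` is trivial if all primes in `R` are inert in `ℚ(√d)`. -/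
theorem jacobiSym_two_pow_card_mul_prod {d : ℤ} (hd : d % 8 = 5) {R : Finset ℕ}
    (hR : ∀ p ∈ R, p.Prime ∧ p ≠ 2 ∧ J(d | p) = -1) :
    J(2 ^ R.card * ∏ p ∈ R, (p : ℤ) | d.natAbs) = 1 := by
  induction R using Finset.induction_on with
  | empty => simp
  | insert p R hp ih =>
    have h2 : J(2 | d.natAbs) = -1 := by
      rw [jacobiSym.at_two (by rw [Nat.odd_iff]; omega), ZMod.χ₈_nat_eq_if_mod_eight]
      rw [if_neg (by omega), if_neg (by omega)]
    have hpd : J(p | d.natAbs) = -1 := by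
      obtain ⟨hp1, hp2, hp3⟩ := hR p (Finset.mem_insert_self _ _)
      rw [← jacobiSym_eq_of_mod_four_eq_one (by omega) (hp1.odd_of_ne_two hp2), hp3]
    rw [Finset.card_insert_of_notMem hp, Finset.prod_insert hp, pow_succ,
      show (2 : ℤ) ^ R.card * 2 * (p * ∏ p ∈ R, (p : ℤ))
        = 2 * p * (2 ^ R.card * ∏ p ∈ R, (p : ℤ)) by ring, jacobiSym.mul_left, jacobiSym.mul_left,
      h2, hpd, ih fun q hq => hR q (Finset.mem_insert_of_mem hq)]
    norm_num

theorem not_dvd_two_pow_mul_prod {p n : ℕ} (hp : p.Prime) (hp2 : p ≠ 2) {R : Finset ℕ}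
    (hR : ∀ q ∈ R, q.Prime) (hpR : p ∉ R) : ¬ (p : ℤ) ∣ 2 ^ n * ∏ q ∈ R, (q : ℤ) := by
  have hp' := Nat.prime_iff_prime_int.mp hp
  refine hp'.not_dvd_mul (fun h => hp2 ?_) fun h => ?_
  · have := hp'.dvd_of_dvd_pow h
    exact (Nat.prime_dvd_prime_iff_eq hp Nat.prime_two).mp (by exact_mod_cast this)
  · obtain ⟨q, hq, hpq⟩ := hp'.exists_mem_finset_dvd h
    obtain rfl := (Nat.prime_dvd_prime_iff_eq hp (hR q hq)).mp (Int.natCast_dvd_natCast.mp hpq)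
    exact hpR hq

/-- `f` is a common slot: `(a, f) = (d, f) = (a, b)` at all odd primes. -/
theorem exists_common_slot {a b d : ℤ} (ha : a % 4 = 3) (hsq : Squarefree a) (hb : b ≠ 0)
    (hd : d % 8 = 5) (h : ∀ p : ℕ, p.Prime → p ≠ 2 → (p : ℤ) ∣ a * b → J(d | p) = -1) :
    ∃ f : ℤ, 0 < f ∧ (¬ ∃ k, f = k ^ 2) ∧ ∀ p : ℕ, p.Prime → p ≠ 2 →
      oddHilbertSym p f a = oddHilbertSym p a b ∧ oddHilbertSym p f d = oddHilbertSym p a b := by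
  have ha0 : a ≠ 0 := hsq.ne_zero
  have hd0 : d ≠ 0 := by omega
  have hab0 : a * b ≠ 0 := mul_ne_zero ha0 hb
  have inert : ∀ p : ℕ, p.Prime → p ≠ 2 → (p : ℤ) ∣ a * b → ¬ (p : ℤ) ∣ d := by
    intro p hp hp2 hpab hpd
    have h0 : J(d | p) = 0 := by
      refine jacobiSym.eq_zero_iff.mpr ⟨hp.ne_zero, fun h1 => hp.not_dvd_one ?_⟩
      rw [← h1]
      exact Int.dvd_gcd hpd dvd_rfl
    have := h p hp hp2 hpab
    omega
  let R : Finset ℕ := (a * b).natAbs.primeFactors.filter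
    fun p => p ≠ 2 ∧ oddHilbertSym p a b = -1
  have hR : ∀ p ∈ R, p.Prime ∧ p ≠ 2 ∧ (p : ℤ) ∣ a * b ∧ oddHilbertSym p a b = -1 := by
    intro p hp
    simp only [R, Finset.mem_filter, Nat.mem_primeFactors] at hp
    exact ⟨hp.1.1, hp.2.1, Int.natCast_dvd.mpr hp.1.2.1, hp.2.2⟩
  have hRp : ∀ p ∈ R, p.Prime := fun p hp => (hR p hp).1
  have hnR : ∀ p : ℕ, p.Prime → p ≠ 2 → p ∉ R → oddHilbertSym p a b = 1 := by
    intro p hp hp2 hpR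
    by_cases hpab : (p : ℤ) ∣ a * b
    · refine (sq_eq_one_iff.mp (oddHilbertSym_sq hp ha0 hb)).resolve_right
        fun h1 => hpR ?_
      simp only [R, Finset.mem_filter, Nat.mem_primeFactors]
      exact ⟨⟨hp, Int.natCast_dvd.mp hpab, Int.natAbs_ne_zero.mpr hab0⟩, hp2, h1⟩
    · exact oddHilbertSym_of_not_dvd hp (fun h => hpab (h.mul_right _))
        fun h => hpab (h.mul_left _)
  set f₀ : ℤ := 2 ^ R.card * ∏ p ∈ R, (p : ℤ) with hf₀
  have hf₀pos : 0 < f₀ :=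
    mul_pos (by positivity) (Finset.prod_pos fun p hp => by exact_mod_cast (hRp p hp).pos)
  have hJ : J(f₀ | d.natAbs) = 1 := jacobiSym_two_pow_card_mul_prod hd
    fun p hp => ⟨(hR p hp).1, (hR p hp).2.1, h p (hR p hp).1 (hR p hp).2.1 (hR p hp).2.2.1⟩
  have hf₀R : ∀ p ∈ R, ∃ u : ℤ, f₀ = p ^ 1 * u ∧ ¬ (p : ℤ) ∣ u := by
    intro p hp
    refine ⟨2 ^ R.card * ∏ q ∈ R.erase p, (q : ℤ), ?_, not_dvd_two_pow_mul_prod (hRp p hp)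
      (hR p hp).2.1 (fun q hq => hRp q (Finset.mem_of_mem_erase hq)) (Finset.notMem_erase _ _)⟩
    rw [hf₀, ← Finset.mul_prod_erase R _ hp]
    ring
  have hf₀n : ∀ p : ℕ, p.Prime → p ≠ 2 → p ∉ R → ¬ (p : ℤ) ∣ f₀ := fun p hp hp2 hpR =>
    not_dvd_two_pow_mul_prod hp hp2 hRp hpR
  have hcop : a.natAbs.Coprime d.natAbs := by
    refine Nat.Coprime.symm (Nat.coprime_of_dvd fun p hp hpd hpa => ?_)
    refine inert p hp ?_ ((Int.natCast_dvd.mpr hpa).mul_right b) (Int.natCast_dvd.mpr hpd)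
    rintro rfl
    omega
  obtain ⟨q, hNq, hq, hqa, hqd, hqf, hqη⟩ := exists_prime_jacobiSym_eq
    (η := fun p => oddHilbertSym p f₀ a * oddHilbertSym p a b) ha hsq (by omega) hcop
    (fun p hp => sq_eq_one_iff.mp (by
      rw [mul_pow, oddHilbertSym_sq hp hf₀pos.ne' ha0, oddHilbertSym_sq hp ha0 hb, one_mul])) hJ
    (2 * f₀.natAbs * (a * b).natAbs * d.natAbs)
  have hbig : ∀ n : ℕ, n ≠ 0 → n ∣ 2 * f₀.natAbs * (a * b).natAbs * d.natAbs → ¬ q ∣ n := by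
    intro n hn hnd hqn
    refine absurd (Nat.le_of_dvd ?_ (hqn.trans hnd)) hNq.not_ge
    have := Int.natAbs_ne_zero.mpr hf₀pos.ne'
    have := Int.natAbs_ne_zero.mpr hab0
    have := Int.natAbs_ne_zero.mpr hd0
    positivity
  have hq2 : q ≠ 2 := by
    rintro rfl
    exact hbig 2 two_ne_zero ⟨f₀.natAbs * (a * b).natAbs * d.natAbs, by ring⟩ dvd_rfl
  have hqf₀ : ¬ (q : ℤ) ∣ f₀ := fun hdvd =>
    hbig _ (Int.natAbs_ne_zero.mpr hf₀pos.ne') ⟨2 * (a * b).natAbs * d.natAbs, by ring⟩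
      (Int.natCast_dvd.mp hdvd)
  have hqab : ¬ (q : ℤ) ∣ a * b := fun hdvd =>
    hbig _ (Int.natAbs_ne_zero.mpr hab0) ⟨2 * f₀.natAbs * d.natAbs, by ring⟩
      (Int.natCast_dvd.mp hdvd)
  have hqd' : ¬ (q : ℤ) ∣ d := fun hdvd =>
    hbig _ (Int.natAbs_ne_zero.mpr hd0) (dvd_mul_left _ _) (Int.natCast_dvd.mp hdvd)
  have hq0 : (q : ℤ) ≠ 0 := by exact_mod_cast hq.ne_zero
  have hf0 : (q : ℤ) * f₀ ≠ 0 := mul_ne_zero hq0 hf₀pos.ne'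
  refine ⟨q * f₀, mul_pos (by exact_mod_cast hq.pos) hf₀pos, ?_, fun p hp hp2 => ?_⟩
  · rintro ⟨k, hk⟩
    obtain ⟨l, rfl⟩ := (Nat.prime_iff_prime_int.mp hq).dvd_of_dvd_pow (Dvd.intro _ hk)
    refine hqf₀ ⟨l ^ 2, mul_left_cancel₀ hq0 ?_⟩
    rw [hk]; ring
  by_cases hpq : p = q
  · subst hpq
    have ha' : ¬ (p : ℤ) ∣ a := fun h => hqab (h.mul_right _)
    have hb' : ¬ (p : ℤ) ∣ b := fun h => hqab (h.mul_left _)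
    rw [oddHilbertSym_comm p _ a, oddHilbertSym_comm p _ d, oddHilbertSym_of_not_dvd hp ha' hb',
      ← pow_one (p : ℤ), oddHilbertSym_of_not_dvd_left hp 1 ha' hqf₀,
      oddHilbertSym_of_not_dvd_left hp 1 hqd' hqf₀, hqa, hqd]
    simp
  have hp' := Nat.prime_iff_prime_int.mp hp
  have hpq' : ¬ (p : ℤ) ∣ q := fun hdvd =>
    hpq ((Nat.prime_dvd_prime_iff_eq hp hq).mp (Int.natCast_dvd_natCast.mp hdvd))
  by_cases hpab : (p : ℤ) ∣ a * b
  · have hpd := inert p hp hp2 hpab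
    constructor
    · by_cases hpa : (p : ℤ) ∣ a
      · obtain ⟨u, hu⟩ := hpa
        have hpu : ¬ (p : ℤ) ∣ u := Int.Squarefree.not_dvd_right hp (by rwa [← hu]) dvd_rfl
        have hqp : oddHilbertSym p q a = oddHilbertSym p f₀ a * oddHilbertSym p a b := by
          rw [← hqη p hp (Int.natCast_dvd.mp ⟨u, hu⟩)]
          conv_lhs => rw [hu, ← pow_one (p : ℤ)]
          rw [oddHilbertSym_of_not_dvd_left hp 1 hpq' hpu, pow_one]
        rw [oddHilbertSym_mul_left hp hq0 hf₀pos.ne' ha0, hqp]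
        linear_combination oddHilbertSym p a b * oddHilbertSym_sq hp hf₀pos.ne' ha0
      · by_cases hpR : p ∈ R
        · obtain ⟨u, hu, hpu⟩ := hf₀R p hpR
          obtain ⟨n, v, hv, hpv⟩ := Int.exists_eq_prime_pow_mul hp hb
          rw [(hR p hpR).2.2.2, hu, oddHilbertSym_comm, mul_left_comm,
            oddHilbertSym_of_not_dvd_left hp 1 hpa (hp'.not_dvd_mul hpq' hpu), pow_one]
          have h1 := (hR p hpR).2.2.2
          rw [hv, oddHilbertSym_of_not_dvd_left hp n hpa hpv] at h1
          refine (sq_eq_one_iff.mp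
            (jacobiSym_sq_eq_one_of_not_dvd hp hpa)).resolve_left fun h2 => ?_
          rw [h2, one_pow] at h1
          omega
        · rw [hnR p hp hp2 hpR]
          exact oddHilbertSym_of_not_dvd hp (hp'.not_dvd_mul hpq' (hf₀n p hp hp2 hpR)) hpa
    · by_cases hpR : p ∈ R
      · obtain ⟨u, hu, hpu⟩ := hf₀R p hpR
        rw [(hR p hpR).2.2.2, hu, oddHilbertSym_comm, mul_left_comm,
          oddHilbertSym_of_not_dvd_left hp 1 hpd (hp'.not_dvd_mul hpq' hpu), pow_one,
          h p hp hp2 hpab]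
      · rw [hnR p hp hp2 hpR]
        exact oddHilbertSym_of_not_dvd hp (hp'.not_dvd_mul hpq' (hf₀n p hp hp2 hpR)) hpd
  · have hpR : p ∉ R := fun h => hpab (hR p h).2.2.1
    have hpf : ¬ (p : ℤ) ∣ q * f₀ := hp'.not_dvd_mul hpq' (hf₀n p hp hp2 hpR)
    rw [hnR p hp hp2 hpR]
    refine ⟨oddHilbertSym_of_not_dvd hp hpf fun h => hpab (h.mul_right _), ?_⟩
    by_cases hpd : (p : ℤ) ∣ d
    · obtain ⟨n, u, hu, hpu⟩ := Int.exists_eq_prime_pow_mul hp hd0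
      rw [hu, oddHilbertSym_of_not_dvd_left hp n hpf hpu, jacobiSym.mul_left,
        jacobiSym_congr hqf (Int.natCast_dvd.mp hpd), ← sq,
        jacobiSym_sq_eq_one_of_not_dvd hp (hf₀n p hp hp2 hpR), one_pow]
    · exact oddHilbertSym_of_not_dvd hp hpf hpd

/-- `d` is a value of the form `a y₁² + b y₂² - a b y₃²` over `ℚ`. -/
def IsRepresented (a b d : ℚ) : Prop :=
  ∃ y₁ y₂ y₃ : ℚ, a * y₁ ^ 2 + b * y₂ ^ 2 - a * b * y₃ ^ 2 = d

theorem isRepresented_of_jacobiSym {a b d : ℤ} (ha : a % 4 = 3) (hsq : Squarefree a)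
    (hb : b ≠ 0) (hpos : 0 < a ∨ 0 < b) (hd : d % 8 = 5)
    (h : ∀ p : ℕ, p.Prime → p ≠ 2 → (p : ℤ) ∣ a * b → J(d | p) = -1) :
    IsRepresented a b d := by
  obtain ⟨f, hf, hfsq, hfs⟩ := exists_common_slot ha hsq hb hd h
  have ha0 : a ≠ 0 := hsq.ne_zero
  have hd0 : d ≠ 0 := by omega
  obtain ⟨x, y, z, h0, h₁⟩ := exists_solution_of_oddHilbertSym (a := b * f) (b := a)
    (mul_ne_zero hb hf.ne') ha0 (hpos.symm.imp_left fun h => mul_pos h hf) fun p hp hp2 => by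
      rw [oddHilbertSym_mul_left hp hb hf.ne' ha0, (hfs p hp hp2).1, oddHilbertSym_comm p b, ← sq,
        oddHilbertSym_sq hp ha0 hb]
  obtain ⟨X, Y, Z, h0', h₂⟩ := exists_solution_of_oddHilbertSym (a := f) (b := a * d)
    hf.ne' (mul_ne_zero ha0 hd0) (.inl hf) fun p hp hp2 => by
      rw [oddHilbertSym_mul_right hp hf.ne' ha0 hd0, (hfs p hp hp2).1, (hfs p hp hp2).2, ← sq,
        oddHilbertSym_sq hp ha0 hb]
  have hx : x ≠ 0 := by
    rintro rfl
    have hy : y ≠ 0 := by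
      rintro rfl
      exact h0 ⟨rfl, rfl, by simpa using h₁.symm⟩
    obtain ⟨k, rfl⟩ := Int.eq_sq_of_mul_sq_eq_sq (n := a) (z := z) hy (by linear_combination h₁)
    rcases Int.even_or_odd' k with ⟨j, rfl | rfl⟩ <;> ring_nf at ha <;> omega
  have hY : Y ≠ 0 := by
    rintro rfl
    have hX : X ≠ 0 := by
      rintro rfl
      exact h0' ⟨rfl, rfl, by simpa using h₂.symm⟩
    exact hfsq (Int.eq_sq_of_mul_sq_eq_sq (n := f) (z := Z) hX (by linear_combination h₂))
  have h₁' : (b : ℚ) * f * x ^ 2 + a * y ^ 2 = z ^ 2 := by exact_mod_cast h₁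
  have h₂' : (f : ℚ) * X ^ 2 + a * d * Y ^ 2 = Z ^ 2 := by exact_mod_cast h₂
  have ha' : (a : ℚ) ≠ 0 := by exact_mod_cast ha0
  have hb' : (b : ℚ) ≠ 0 := by exact_mod_cast hb
  have hx' : (x : ℚ) ≠ 0 := by exact_mod_cast hx
  have hY' : (Y : ℚ) ≠ 0 := by exact_mod_cast hY
  refine ⟨Z / (a * Y), y * X / (b * x * Y), z * X / (a * b * x * Y), ?_⟩
  field_simp
  linear_combination (-(b : ℚ) * x ^ 2) * h₂' + X ^ 2 * h₁'

theorem IsRepresented.swap {a b d : ℚ} (h : IsRepresented a b d) : IsRepresented b a d := by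
  obtain ⟨y₁, y₂, y₃, rfl⟩ := h
  exact ⟨y₂, y₁, y₃, by ring⟩

theorem IsRepresented.of_neg_mul {a b d : ℚ} (h : IsRepresented a (-(a * b)) d) :
    IsRepresented a b d := by
  obtain ⟨y₁, y₂, y₃, rfl⟩ := h
  exact ⟨y₁, a * y₃, y₂, by ring⟩

theorem IsRepresented.of_add {a b d : ℚ} (h : IsRepresented (a + b) (-(a * b)) d) :
    IsRepresented a b d := by
  obtain ⟨y₁, y₂, y₃, rfl⟩ := h
  exact ⟨y₁ + b * y₃, y₁ - a * y₃, y₂, by ring⟩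

theorem IsRepresented.of_mul_sq {a b d u v : ℚ} (h : IsRepresented (u ^ 2 * a) (v ^ 2 * b) d) :
    IsRepresented a b d := by
  obtain ⟨y₁, y₂, y₃, rfl⟩ := h
  exact ⟨u * y₁, v * y₂, u * v * y₃, by ring⟩

theorem Int.not_four_dvd_of_squarefree {a : ℤ} (h : Squarefree a) : a % 4 ≠ 0 := by
  intro h4
  have := h 2 (by omega)
  rw [Int.isUnit_iff] at this
  omega

theorem Rat.exists_sq_mul_eq_squarefree {a : ℚ} (ha : 0 < a) :
    ∃ (u : ℚ) (r : ℤ), Squarefree r ∧ 0 < r ∧ a = u ^ 2 * r := by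
  have hn : 0 < a.num := Rat.num_pos.mpr ha
  have hd : (0 : ℤ) < a.den := by exact_mod_cast a.den_pos
  obtain ⟨k, r, hk, hr, h⟩ := Int.exists_sq_mul_squarefree (mul_pos hn hd).ne'
  refine ⟨k / a.den, r, hr, ?_, ?_⟩
  · have := mul_pos hn hd
    rw [h] at this
    exact pos_of_mul_pos_right this (sq_nonneg k)
  · have h' : (a.num : ℚ) * a.den = k ^ 2 * r := by exact_mod_cast h
    have : (a.den : ℚ) ≠ 0 := by positivity
    rw [div_pow, div_mul_eq_mul_div, ← h']
    conv_lhs => rw [← Rat.num_div_den a]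
    field_simp

/-- Reduction to the case where the first coefficient is `3` modulo `4`. -/
theorem exists_mod_four_eq_three_of_squarefree {a b : ℤ} (ha : Squarefree a) (hb : Squarefree b)
    (hapos : 0 < a) (hbpos : 0 < b) :
    ∃ a' b' : ℤ, a' % 4 = 3 ∧ b' ≠ 0 ∧ (0 < a' ∨ 0 < b') ∧
      ∀ d : ℚ, IsRepresented a' b' d → IsRepresented a b d := by
  have ha4 := Int.not_four_dvd_of_squarefree ha
  have hb4 := Int.not_four_dvd_of_squarefree hb
  by_cases ha3 : a % 4 = 3
  · exact ⟨a, b, ha3, hbpos.ne', .inl hapos, fun _ h => h⟩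
  by_cases hb3 : b % 4 = 3
  · exact ⟨b, a, hb3, hapos.ne', .inl hbpos, fun _ h => h.swap⟩
  by_cases h11 : a % 4 = 1 ∧ b % 4 = 1
  · refine ⟨-(a * b), a, ?_, hapos.ne', .inr hapos, fun d h => ?_⟩
    · have : a * b % 4 = 1 := by simp [Int.mul_emod, h11]
      omega
    · exact IsRepresented.of_neg_mul (by push_cast at h; exact h.swap)
  by_cases h22 : a % 4 = 2 ∧ b % 4 = 2
  · obtain ⟨m, rfl⟩ : ∃ m, a = 2 * m := ⟨a / 2, by omega⟩
    obtain ⟨n, rfl⟩ : ∃ n, b = 2 * n := ⟨b / 2, by omega⟩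
    have key : ∀ d : ℚ, IsRepresented (2 * m : ℤ) (-(m * n) : ℤ) d →
        IsRepresented (2 * m : ℤ) (2 * n : ℤ) d := by
      refine fun d h => .of_neg_mul (.of_mul_sq (u := 1) (v := 1 / 2) ?_)
      convert h using 1 <;> push_cast <;> ring
    have hmn : (m * n) % 4 = 1 ∨ (m * n) % 4 = 3 := by
      have hm : m % 4 = 1 ∨ m % 4 = 3 := by omega
      have hn : n % 4 = 1 ∨ n % 4 = 3 := by omega
      rcases hm with hm | hm <;> rcases hn with hn | hn <;> simp [Int.mul_emod, hm, hn]
    have hmnpos : 0 < m * n := mul_pos (by omega) (by omega)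
    rcases hmn with hmn | hmn
    · exact ⟨-(m * n), 2 * m, by omega, by omega, .inr hapos, fun d h => key d h.swap⟩
    · refine ⟨2 * m + -(m * n), -(2 * m * -(m * n)), by omega, ?_, .inr ?_, fun d h =>
        key d (.of_add (by push_cast at h ⊢; exact h))⟩
      · simp [hapos.ne', hmnpos.ne']
      · rw [mul_neg, neg_neg]; exact mul_pos hapos hmnpos
  refine ⟨a + b, -(a * b), by omega, by simp [hapos.ne', hbpos.ne'], .inl (by omega),
    fun d h => .of_add (by push_cast at h; exact h)⟩

/-- Reduction to integral coefficients, the first of them squarefree and `3` modulo `4`. -/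
theorem exists_squarefree_mod_four_eq_three {a b : ℚ} (ha : 0 < a) (hb : 0 < b) :
    ∃ a' b' : ℤ, a' % 4 = 3 ∧ Squarefree a' ∧ b' ≠ 0 ∧ (0 < a' ∨ 0 < b') ∧
      ∀ d : ℚ, IsRepresented a' b' d → IsRepresented a b d := by
  obtain ⟨u, r, hr, hrpos, rfl⟩ := Rat.exists_sq_mul_eq_squarefree ha
  obtain ⟨v, s, hs, hspos, rfl⟩ := Rat.exists_sq_mul_eq_squarefree hb
  have hu : u ≠ 0 := by rintro rfl; simp at ha
  have hv : v ≠ 0 := by rintro rfl; simp at hb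
  obtain ⟨a', b', h3, hb', hpos, h⟩ := exists_mod_four_eq_three_of_squarefree hr hs hrpos hspos
  obtain ⟨k, l, hk, hl, rfl⟩ := Int.exists_sq_mul_squarefree (a := a') (by omega)
  refine ⟨l, b', ?_, hl, hb', hpos.imp_left fun h => pos_of_mul_pos_right h (sq_nonneg k),
    fun d hd => .of_mul_sq (u := u⁻¹) (v := v⁻¹) ?_⟩
  · rcases Int.even_or_odd' k with ⟨j, rfl | rfl⟩
    · rw [show (2 * j) ^ 2 * l = 4 * (j ^ 2 * l) by ring] at h3
      omega
    · rw [show (2 * j + 1) ^ 2 * l = 4 * ((j ^ 2 + j) * l) + l by ring] at h3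
      omega
  · rw [← mul_assoc, ← mul_assoc, ← mul_pow, ← mul_pow, inv_mul_cancel₀ hu, inv_mul_cancel₀ hv,
      one_pow, one_mul, one_mul]
    refine h d (.of_mul_sq (u := (k : ℚ)⁻¹) (v := 1) ?_)
    have hk' : (k : ℚ) ≠ 0 := by exact_mod_cast hk
    convert hd using 1 <;> push_cast <;> field_simp

section FiniteField

variable {F : Type*} [Field F] [Fintype F] [DecidableEq F]

theorem card_filter_add_inv_eq (hF : ringChar F ≠ 2) (s : F) :
    ((Finset.univ.filter fun z : Fˣ => (z : F) + (z : F)⁻¹ = s).card : ℤ) =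
      quadraticChar F (s ^ 2 - 4) + 1 := by
  have h2 : (2 : F) ≠ 0 := Ring.two_ne_zero hF
  rw [← quadraticChar_card_sqrts hF]
  congr 1
  refine Finset.card_bij (fun z _ => (z : F) - (z : F)⁻¹) ?_ ?_ ?_
  · intro z hz
    simp only [Finset.mem_filter, Finset.mem_univ, true_and] at hz
    simp only [Set.mem_toFinset, Set.mem_ofPred_eq, ← hz]
    have := z.ne_zero
    field_simp
    ring
  · intro z hz w hw h
    simp only [Finset.mem_filter, Finset.mem_univ, true_and] at hz hw
    apply Units.ext
    apply mul_left_cancel₀ h2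
    linear_combination hz - hw + h
  · intro x hx
    simp only [Set.mem_toFinset, Set.mem_ofPred_eq] at hx
    have e : (s + x) / 2 * ((s - x) / 2) = 1 := by
      field_simp
      linear_combination -hx
    refine ⟨⟨(s + x) / 2, (s - x) / 2, e, by rw [mul_comm, e]⟩, ?_, ?_⟩
    · simp only [Finset.mem_filter, Finset.mem_univ, true_and, ← eq_inv_of_mul_eq_one_right e]
      field_simp
      ring
    · simp only [← eq_inv_of_mul_eq_one_right e]
      field_simp
      ring

theorem sum_quadraticChar_sq_sub_four_mul (hF : ringChar F ≠ 2) (h : F → F) :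
    ∑ s, ((quadraticChar F (s ^ 2 - 4) : F) + 1) * h s = ∑ z : Fˣ, h (z + (z : F)⁻¹) := by
  rw [← Finset.sum_fiberwise Finset.univ fun z : Fˣ => (z : F) + (z : F)⁻¹]
  refine Finset.sum_congr rfl fun s _ => ?_
  rw [Finset.sum_congr rfl (g := fun _ => h s)
    (fun z hz => by rw [(Finset.mem_filter.mp hz).2]), Finset.sum_const, nsmul_eq_mul]
  congr 1
  exact_mod_cast congrArg (Int.cast : ℤ → F) (card_filter_add_inv_eq hF s).symm

theorem sum_units_inv_pow (i : ℕ) : ∑ z : Fˣ, (z : F)⁻¹ ^ i = ∑ z : Fˣ, (z : F) ^ i := by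
  rw [← Equiv.sum_comp (Equiv.inv Fˣ)]
  simp

end FiniteField

section ZMod

variable {p : ℕ} [Fact p.Prime]

theorem ZMod.two_ne_zero_of_lt (hp : 2 < p) : (2 : ZMod p) ≠ 0 := by
  intro h
  have := (ZMod.natCast_eq_zero_iff 2 p).mp (by exact_mod_cast h)
  exact absurd (Nat.le_of_dvd two_pos this) (by omega)

theorem ZMod.sum_units_pow (hp : 7 ≤ p) :
    (∑ _z : (ZMod p)ˣ, (1 : ZMod p) = -1) ∧ (∑ z : (ZMod p)ˣ, (z : ZMod p) ^ 2 = 0) ∧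
      ∑ z : (ZMod p)ˣ, (z : ZMod p) ^ 4 = 0 := by
  have h := FiniteField.sum_pow_units (ZMod p)
  simp only [ZMod.card] at h
  refine ⟨by simpa using h 0, ?_, ?_⟩
  · rw [h, if_neg (Nat.not_dvd_of_pos_of_lt (by omega) (by omega))]
  · rw [h, if_neg (Nat.not_dvd_of_pos_of_lt (by omega) (by omega))]

theorem ZMod.sum_quadraticChar_sq_sub_four (hp : 7 ≤ p) :
    (∑ s : ZMod p, (quadraticChar (ZMod p) (s ^ 2 - 4) : ZMod p) = -1) ∧
    (∑ s : ZMod p, (quadraticChar (ZMod p) (s ^ 2 - 4) : ZMod p) * s ^ 2 = -2) ∧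
    ∑ s : ZMod p, (quadraticChar (ZMod p) (s ^ 2 - 4) : ZMod p) * s ^ 4 = -6 := by
  have hF : ringChar (ZMod p) ≠ 2 := by rw [ZMod.ringChar_zmod_n]; omega
  obtain ⟨h0, h2, h4⟩ := ZMod.sum_units_pow hp
  have key := sum_quadraticChar_sq_sub_four_mul hF
  have hs : ∀ i < p - 1, ∑ s : ZMod p, s ^ i = 0 := fun i hi =>
    FiniteField.sum_pow_lt_card_sub_one (ZMod p) i (by rwa [ZMod.card])
  refine ⟨?_, ?_, ?_⟩
  · have := key fun _ => 1
    simp only [mul_one, Finset.sum_add_distrib] at this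
    rw [h0] at this
    have h := hs 0 (by omega)
    simp only [pow_zero] at h
    rwa [h, add_zero] at this
  · have := key fun s => s ^ 2
    simp only [add_mul, one_mul, Finset.sum_add_distrib] at this
    rw [hs 2 (by omega), add_zero] at this
    rw [this, Finset.sum_congr rfl (g := fun z : (ZMod p)ˣ =>
      (z : ZMod p) ^ 2 + 2 * 1 + (z : ZMod p)⁻¹ ^ 2) fun z _ => by
        have := z.ne_zero
        field_simp
        ring, Finset.sum_add_distrib, Finset.sum_add_distrib, sum_units_inv_pow, ← Finset.mul_sum,
      h0, h2]
    ring
  · have := key fun s => s ^ 4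
    simp only [add_mul, one_mul, Finset.sum_add_distrib] at this
    rw [hs 4 (by omega), add_zero] at this
    rw [this, Finset.sum_congr rfl (g := fun z : (ZMod p)ˣ =>
      (z : ZMod p) ^ 4 + 4 * (z : ZMod p) ^ 2 + 6 * 1 + 4 * (z : ZMod p)⁻¹ ^ 2 +
        (z : ZMod p)⁻¹ ^ 4) fun z _ => by
        have := z.ne_zero
        field_simp
        ring, Finset.sum_add_distrib, Finset.sum_add_distrib, Finset.sum_add_distrib,
      Finset.sum_add_distrib, sum_units_inv_pow, ← Finset.mul_sum, ← Finset.mul_sum,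
      ← Finset.mul_sum, sum_units_inv_pow, h0, h2, h4]
    ring

/-- Power sums over the `s` for which `s² - 4` is a nonresidue. -/
theorem ZMod.sum_filter_quadraticChar_sq_sub_four (hp : 7 ≤ p) {U : Finset (ZMod p)}
    (hU : U = Finset.univ.filter fun s => quadraticChar (ZMod p) (s ^ 2 - 4) = -1) :
    2 * (U.card : ZMod p) = -1 ∧ ∑ s ∈ U, s = 0 ∧ ∑ s ∈ U, s ^ 2 = -3 ∧ ∑ s ∈ U, s ^ 3 = 0 ∧
      ∑ s ∈ U, s ^ 4 = -13 := by
  have h2 : (2 : ZMod p) ≠ 0 := ZMod.two_ne_zero_of_lt (by omega)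
  obtain ⟨e0, e2, e4⟩ := ZMod.sum_quadraticChar_sq_sub_four hp
  have hs : ∀ i < p - 1, ∑ s : ZMod p, s ^ i = 0 := fun i hi =>
    FiniteField.sum_pow_lt_card_sub_one (ZMod p) i (by rwa [ZMod.card])
  have key : ∀ h : ZMod p → ZMod p, 2 * ∑ s ∈ U, h s = ∑ s, h s - h 2 - h (-2) -
      ∑ s, (quadraticChar (ZMod p) (s ^ 2 - 4) : ZMod p) * h s := by
    intro h
    have h22 : (2 : ZMod p) ≠ -2 := by
      intro h
      apply mul_ne_zero h2 h2
      linear_combination h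
    have h' : h 2 + h (-2) = ∑ s, if s ∈ ({2, -2} : Finset (ZMod p)) then h s else 0 := by
      rw [Finset.sum_ite_mem, Finset.univ_inter, Finset.sum_pair h22]
    rw [sub_sub _ (h 2), h', hU, Finset.sum_filter, Finset.mul_sum, ← Finset.sum_sub_distrib,
      ← Finset.sum_sub_distrib]
    refine Finset.sum_congr rfl fun s _ => ?_
    by_cases hs2 : s ^ 2 - 4 = 0
    · have : s = 2 ∨ s = -2 := by
        have : (s - 2) * (s + 2) = 0 := by linear_combination hs2
        exact (mul_eq_zero.mp this).imp sub_eq_zero.mp eq_neg_of_add_eq_zero_left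
      simp [hs2, this]
    · have : ¬ (s = 2 ∨ s = -2) := by
        rintro (rfl | rfl) <;> exact hs2 (by ring)
      rcases quadraticChar_dichotomy hs2 with h1 | h1 <;> simp [h1, this]
      ring
  have odd : ∀ i, Odd i → ∑ s ∈ U, s ^ i = 0 := by
    intro i hi
    have : ∑ s ∈ U, s ^ i = ∑ s ∈ U, -s ^ i := by
      refine Finset.sum_nbij' (fun s => -s) (fun s => -s) ?_ ?_ ?_ ?_ ?_ <;>
        simp [hU, hi.neg_pow]
    rw [Finset.sum_neg_distrib] at this
    apply mul_left_cancel₀ h2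
    linear_combination this
  refine ⟨?_, by simpa using odd 1 odd_one, ?_, odd 3 (by decide), ?_⟩
  · have := key fun _ => 1
    have h := hs 0 (by omega)
    simp only [pow_zero] at h
    simp only [mul_one, e0, h] at this
    rw [Finset.sum_const, nsmul_one] at this
    rw [this]; ring
  · have := key (· ^ 2)
    simp only [e2, hs 2 (by omega)] at this
    apply mul_left_cancel₀ h2
    rw [this]; ring
  · have := key (· ^ 4)
    simp only [e4, hs 4 (by omega)] at this
    apply mul_left_cancel₀ h2
    rw [this]; ring

/-- For `p ≥ 13`, every residue is the sum of two residues `s` with `s² - 4` a nonresidue. -/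
theorem ZMod.exists_quadraticChar_eq_neg_one (hp : 13 ≤ p) (c : ZMod p) :
    ∃ s : ZMod p, quadraticChar (ZMod p) (s ^ 2 - 4) = -1 ∧
      quadraticChar (ZMod p) ((c - s) ^ 2 - 4) = -1 := by
  by_contra! hno
  have h2 : (2 : ZMod p) ≠ 0 := ZMod.two_ne_zero_of_lt (by omega)
  set U : Finset (ZMod p) := Finset.univ.filter fun s =>
    quadraticChar (ZMod p) (s ^ 2 - 4) = -1 with hU
  obtain ⟨m0, m1, m2, m3, m4⟩ := ZMod.sum_filter_quadraticChar_sq_sub_four (by omega) hU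
  have hinj : Function.Injective fun s : ZMod p => c - s := fun x y h => sub_right_injective h
  set V : Finset (ZMod p) := U.image fun s => c - s with hV
  have hdisj : Disjoint U V := by
    rw [Finset.disjoint_left]
    intro s hs hs'
    obtain ⟨r, hr, rfl⟩ := Finset.mem_image.mp hs'
    exact hno r (Finset.mem_filter.mp hr).2 (Finset.mem_filter.mp hs).2
  have hcard : (U ∪ V).card = 2 * U.card := by
    rw [Finset.card_union_of_disjoint hdisj, hV, Finset.card_image_of_injective _ hinj, two_mul]
  have hle : 2 * U.card ≤ p := by
    rw [← hcard]
    exact (Finset.card_le_univ _).trans_eq (ZMod.card p)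
  have hUcard : 2 * U.card + 1 = p := by
    have h : p ∣ 2 * U.card + 1 := by
      rw [← ZMod.natCast_eq_zero_iff]
      push_cast
      rw [m0]; ring
    obtain ⟨k, hk⟩ := h
    obtain rfl : k = 1 := by
      have h1 : k ≠ 0 := by rintro rfl; omega
      have h2 : k < 2 := by
        by_contra! h2
        have := Nat.mul_le_mul_left p h2
        omega
      omega
    omega
  obtain ⟨e, he⟩ : ∃ e, (U ∪ V)ᶜ = {e} := by
    rw [← Finset.card_eq_one, Finset.card_compl, hcard, ZMod.card]
    omega
  have hsymm : ∀ s, s ∈ U ∪ V → c - s ∈ U ∪ V := by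
    intro s hs
    rcases Finset.mem_union.mp hs with hs | hs
    · exact Finset.mem_union_right _ (Finset.mem_image_of_mem _ hs)
    · obtain ⟨r, hr, rfl⟩ := Finset.mem_image.mp hs
      exact Finset.mem_union_left _ (by simpa using hr)
  have hce : c - e = e := by
    rw [← Finset.mem_singleton, ← he, Finset.mem_compl]
    intro h
    have h' : e ∈ (U ∪ V)ᶜ := by simp [he]
    exact Finset.mem_compl.mp h' (by simpa using hsymm _ h)
  have key : ∀ k, Even k → k ≠ 0 → k < p - 1 → ∑ s ∈ U, (2 * s - c) ^ k = 0 := by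
    intro k hk hk0 hkp
    have hall : ∑ s : ZMod p, (2 * s - c) ^ k = 0 := by
      have hbij : Function.Bijective fun s : ZMod p => 2 * s - c :=
        Finite.injective_iff_bijective.mp fun x y h => mul_left_cancel₀ h2 (sub_left_injective h)
      rw [hbij.sum_comp fun s => s ^ k]
      exact FiniteField.sum_pow_lt_card_sub_one (ZMod p) k (by rwa [ZMod.card])
    have hsumV : ∑ s ∈ V, (2 * s - c) ^ k = ∑ s ∈ U, (2 * s - c) ^ k := by
      rw [hV, Finset.sum_image hinj.injOn]
      refine Finset.sum_congr rfl fun s _ => ?_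
      rw [← hk.neg_pow]
      ring
    rw [← Finset.sum_add_sum_compl (U ∪ V), he, Finset.sum_singleton, Finset.sum_union hdisj,
      hsumV, show 2 * e - c = 0 by linear_combination -hce, zero_pow hk0, add_zero] at hall
    apply mul_left_cancel₀ h2
    linear_combination hall
  have k2 := key 2 (by decide) (by decide) (by omega)
  have k4 := key 4 (by decide) (by decide) (by omega)
  have e2 : ∑ s ∈ U, (2 * s - c) ^ 2 =
      4 * ∑ s ∈ U, s ^ 2 - 4 * c * ∑ s ∈ U, s + c ^ 2 * (U.card : ZMod p) := by
    rw [Finset.mul_sum, Finset.mul_sum, ← nsmul_one, ← Finset.sum_const, Finset.mul_sum,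
      ← Finset.sum_sub_distrib, ← Finset.sum_add_distrib]
    exact Finset.sum_congr rfl fun s _ => by ring
  have e4 : ∑ s ∈ U, (2 * s - c) ^ 4 =
      16 * ∑ s ∈ U, s ^ 4 - 32 * c * ∑ s ∈ U, s ^ 3 + 24 * c ^ 2 * ∑ s ∈ U, s ^ 2 -
        8 * c ^ 3 * ∑ s ∈ U, s + c ^ 4 * (U.card : ZMod p) := by
    rw [Finset.mul_sum, Finset.mul_sum, Finset.mul_sum, Finset.mul_sum, ← nsmul_one,
      ← Finset.sum_const, Finset.mul_sum, ← Finset.sum_sub_distrib, ← Finset.sum_add_distrib,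
      ← Finset.sum_sub_distrib, ← Finset.sum_add_distrib]
    exact Finset.sum_congr rfl fun s _ => by ring
  rw [e2, m1, m2] at k2
  rw [e4, m1, m2, m3, m4] at k4
  have hc2 : c ^ 2 = -24 := by linear_combination -2 * k2 + c ^ 2 * m0
  have h0 : ((2464 : ℕ) : ZMod p) = 0 := by
    push_cast
    linear_combination 2 * k4 - c ^ 4 * m0 + (144 + c ^ 2 - 24) * hc2
  rw [ZMod.natCast_eq_zero_iff, show 2464 = 2 ^ 5 * 7 * 11 by norm_num] at h0
  have hp' : p.Prime := Fact.out
  rcases (hp'.dvd_mul).mp h0 with h0 | h0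
  · rcases (hp'.dvd_mul).mp h0 with h0 | h0
    · have := Nat.le_of_dvd two_pos (hp'.dvd_of_dvd_pow h0)
      omega
    · have := Nat.le_of_dvd (by omega) h0
      omega
  · have := Nat.le_of_dvd (by omega) h0
    omega

end ZMod

theorem exists_jacobiSym_sq_sub_four_eq_neg_one {p : ℕ} (hp : p.Prime) (hp2 : p ≠ 2) {m : ℤ}
    (hm : p ≤ 11 → (p : ℤ) ∣ m) :
    ∃ s : ℤ, J(s ^ 2 - 4 | p) = -1 ∧ J((m - s) ^ 2 - 4 | p) = -1 := by
  have := Fact.mk hp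
  by_cases h11 : p ≤ 11
  · have hdvd := hm h11
    have key : ∀ s : ℤ, J((m - s) ^ 2 - 4 | p) = J(s ^ 2 - 4 | p) := by
      intro s
      refine jacobiSym.mod_left' (Int.modEq_iff_dvd.mpr ?_)
      rw [show s ^ 2 - 4 - ((m - s) ^ 2 - 4) = m * (2 * s - m) by ring]
      exact hdvd.mul_right _
    suffices h : ∃ s : ℤ, J(s ^ 2 - 4 | p) = -1 by
      obtain ⟨s, hs⟩ := h
      exact ⟨s, hs, (key s).trans hs⟩
    have hp4 : p = 3 ∨ p = 5 ∨ p = 7 ∨ p = 11 := by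
      interval_cases p <;> first | omega | (exfalso; revert hp; norm_num)
    rcases hp4 with rfl | rfl | rfl | rfl
    · exact ⟨0, by norm_num⟩
    · exact ⟨1, by norm_num⟩
    · exact ⟨0, by norm_num⟩
    · exact ⟨0, by norm_num⟩
  · have h13 : 13 ≤ p := by
      by_contra! h
      obtain rfl : p = 12 := by omega
      exact absurd hp (by norm_num)
    obtain ⟨s, h1, h2⟩ := ZMod.exists_quadraticChar_eq_neg_one h13 (m : ZMod p)
    refine ⟨s.val, ?_, ?_⟩
    · rw [← jacobiSym.legendreSym.to_jacobiSym, legendreSym]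
      simpa using h1
    · rw [← jacobiSym.legendreSym.to_jacobiSym, legendreSym]
      simpa using h2

theorem exists_modEq_of_finset_primes (P : Finset ℕ) (hP : ∀ p ∈ P, p.Prime) (r : ℕ → ℤ) :
    ∃ s : ℤ, ∀ p ∈ P, s ≡ r p [ZMOD p] := by
  induction P using Finset.induction_on with
  | empty => exact ⟨0, by simp⟩
  | insert q P hq ih =>
    obtain ⟨s, hs⟩ := ih fun p hp => hP p (Finset.mem_insert_of_mem hp)
    have hcop : IsCoprime (q : ℤ) (∏ p ∈ P, (p : ℤ)) := by
      refine IsCoprime.prod_right fun p hp => Nat.isCoprime_iff_coprime.mpr ?_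
      refine (Nat.coprime_primes (hP q (Finset.mem_insert_self _ _))
        (hP p (Finset.mem_insert_of_mem hp))).mpr ?_
      rintro rfl
      exact hq hp
    obtain ⟨x, hx, hx'⟩ := Int.exists_modEq_modEq hcop (r q) s
    refine ⟨x, fun p hp => ?_⟩
    rcases Finset.mem_insert.mp hp with rfl | hp
    · exact hx
    · exact (hx'.of_dvd (Finset.dvd_prod_of_mem _ hp)).trans (hs p hp)

theorem Int.sq_emod_eight_of_odd {x : ℤ} (h : x % 2 = 1) : x ^ 2 % 8 = 1 := by
  have h1 : x % 8 = 1 ∨ x % 8 = 3 ∨ x % 8 = 5 ∨ x % 8 = 7 := by omega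
  rcases h1 with h1 | h1 | h1 | h1 <;> simp [sq, Int.mul_emod, h1]

theorem Int.sq_sub_four_emod_eight_of_odd {s : ℤ} (h : s % 2 = 1) : (s ^ 2 - 4) % 8 = 5 := by
  have := Int.sq_emod_eight_of_odd h
  omega

/-- An integer divisible by `2 · 3 · 5 · 7 · 11` is a sum of two traces of norm one elements of the
quaternion algebra `(a, b)`. -/
theorem exists_isRepresented_sq_sub_four {a b : ℚ} (ha : 0 < a) (hb : 0 < b) {m : ℤ}
    (hm : (2310 : ℤ) ∣ m) :
    ∃ s : ℤ, IsRepresented a b ((s : ℚ) ^ 2 - 4) ∧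
      IsRepresented a b (((m - s : ℤ) : ℚ) ^ 2 - 4) := by
  obtain ⟨a', b', h3, hsq, hb', hpos, h⟩ := exists_squarefree_mod_four_eq_three ha hb
  have key : ∀ p : ℕ, ∃ s : ℤ, p.Prime → p ≠ 2 →
      J(s ^ 2 - 4 | p) = -1 ∧ J((m - s) ^ 2 - 4 | p) = -1 := by
    intro p
    by_cases hp : p.Prime ∧ p ≠ 2
    · have hpm : p ≤ 11 → (p : ℤ) ∣ m := by
        intro h11
        refine dvd_trans ?_ hm
        obtain ⟨hp, hp2⟩ := hp
        interval_cases p <;> first | decide | (exfalso; revert hp; norm_num)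
      obtain ⟨s, hs⟩ := exists_jacobiSym_sq_sub_four_eq_neg_one hp.1 hp.2 hpm
      exact ⟨s, fun _ _ => hs⟩
    · exact ⟨0, fun h1 h2 => absurd ⟨h1, h2⟩ hp⟩
  choose r hr using key
  obtain ⟨s, hs⟩ := exists_modEq_of_finset_primes (insert 2 (a' * b').natAbs.primeFactors)
    (fun p hp => by
      rcases Finset.mem_insert.mp hp with rfl | hp
      · exact Nat.prime_two
      · exact Nat.prime_of_mem_primeFactors hp) fun p => if p = 2 then 1 else r p
  have hs2 : s % 2 = 1 := by
    simpa [Int.ModEq] using hs 2 (Finset.mem_insert_self _ _)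
  have hab0 : (a' * b').natAbs ≠ 0 := Int.natAbs_ne_zero.mpr (mul_ne_zero hsq.ne_zero hb')
  have hsr : ∀ p : ℕ, p.Prime → p ≠ 2 → (p : ℤ) ∣ a' * b' → s ≡ r p [ZMOD p] := by
    intro p hp hp2 hdvd
    simpa [hp2] using hs p (Finset.mem_insert_of_mem
      (Nat.mem_primeFactors.mpr ⟨hp, Int.natCast_dvd.mp hdvd, hab0⟩))
  refine ⟨s, ?_, ?_⟩
  · have := h _ (isRepresented_of_jacobiSym (d := s ^ 2 - 4) h3 hsq hb' hpos
      (Int.sq_sub_four_emod_eight_of_odd hs2) fun p hp hp2 hdvd => by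
        rw [← (hr p hp hp2).1]
        exact jacobiSym_congr (((hsr p hp hp2 hdvd).pow 2).sub_right 4) dvd_rfl)
    exact_mod_cast this
  · have := h _ (isRepresented_of_jacobiSym (d := (m - s) ^ 2 - 4) h3 hsq hb' hpos
      (Int.sq_sub_four_emod_eight_of_odd (by omega)) fun p hp hp2 hdvd => by
        rw [← (hr p hp hp2).2]
        exact jacobiSym_congr ((((hsr p hp hp2 hdvd).sub_left m).pow 2).sub_right 4) dvd_rfl)
    exact_mod_cast this

theorem Rat.exists_add_four_squares_eq_zero {a : ℚ} (ha : a ≤ 0) :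
    ∃ x y z w : ℚ, a + x ^ 2 + y ^ 2 + z ^ 2 + w ^ 2 = 0 := by
  obtain ⟨x, y, z, w, h⟩ := Nat.sum_four_squares (a.num.natAbs * a.den)
  have hn : (a.num.natAbs : ℤ) = -a.num := by
    have := Rat.num_nonpos.mpr ha
    omega
  have hd : (a.den : ℚ) ≠ 0 := by exact_mod_cast a.den_nz
  have h' : (x : ℚ) ^ 2 + y ^ 2 + z ^ 2 + w ^ 2 = -a.num * a.den := by
    have : ((x : ℤ) ^ 2 + y ^ 2 + z ^ 2 + w ^ 2) = -a.num * a.den := by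
      rw [← hn]
      exact_mod_cast h
    exact_mod_cast this
  refine ⟨x / a.den, y / a.den, z / a.den, w / a.den, ?_⟩
  have hmul := Rat.mul_den_eq_num a
  field_simp
  linear_combination h' + a.den * hmul

theorem exists_solution_of_int (m : ℤ) (a b : ℚ) :
    ∃ a₁ a₂ a₃ a₄ b₁ b₂ b₃ b₄ x₁ x₂ x₃ x₄ y₁ y₂ y₃ y₄ n : ℚ,
        (a + a₁ ^ 2 + a₂ ^ 2 + a₃ ^ 2 + a₄ ^ 2) *
          (b + b₁ ^ 2 + b₂ ^ 2 + b₃ ^ 2 + b₄ ^ 2) *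
          ((x₁ ^ 2 - a * x₂ ^ 2 - b * x₃ ^ 2 + a * b * x₄ ^ 2 - 1) ^ 2 +
            (y₁ ^ 2 - a * y₂ ^ 2 - b * y₃ ^ 2 + a * b * y₄ ^ 2 - 1) ^ 2 +
            (∏ j ∈ Finset.range 2310, (n - (j : ℚ))) ^ 2 +
            (2 * x₁ + 2 * y₁ + n - m) ^ 2) = 0 := by
  rcases le_or_gt a 0 with ha | ha
  · obtain ⟨x, y, z, w, h⟩ := Rat.exists_add_four_squares_eq_zero ha
    exact ⟨x, y, z, w, 0, 0, 0, 0, 0, 0, 0, 0, 0, 0, 0, 0, 0, by rw [h, zero_mul, zero_mul]⟩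
  rcases le_or_gt b 0 with hb | hb
  · obtain ⟨x, y, z, w, h⟩ := Rat.exists_add_four_squares_eq_zero hb
    exact ⟨0, 0, 0, 0, x, y, z, w, 0, 0, 0, 0, 0, 0, 0, 0, 0, by rw [h, mul_zero, zero_mul]⟩
  obtain ⟨s, ⟨x₂, x₃, x₄, hx⟩, ⟨y₂, y₃, y₄, hy⟩⟩ :=
    exists_isRepresented_sq_sub_four ha hb (Int.dvd_self_sub_emod (x := m) (m := 2310))
  refine ⟨0, 0, 0, 0, 0, 0, 0, 0, s / 2, x₂ / 2, x₃ / 2, x₄ / 2, (m - m % 2310 - s : ℤ) / 2,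
    y₂ / 2, y₃ / 2, y₄ / 2, (m % 2310 : ℤ), ?_⟩
  have hprod : ∏ j ∈ Finset.range 2310, (((m % 2310 : ℤ) : ℚ) - (j : ℚ)) = 0 := by
    refine Finset.prod_eq_zero (i := (m % 2310).toNat) ?_ ?_
    · rw [Finset.mem_range]
      omega
    · rw [sub_eq_zero]
      have : ((m % 2310).toNat : ℤ) = m % 2310 := Int.toNat_of_nonneg (by omega)
      exact_mod_cast this.symm
  rw [hprod]
  have e1 : ((s : ℚ) / 2) ^ 2 - a * (x₂ / 2) ^ 2 - b * (x₃ / 2) ^ 2 + a * b * (x₄ / 2) ^ 2 - 1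
      = 0 := by linear_combination -hx / 4
  have e2 : (((m - m % 2310 - s : ℤ) : ℚ) / 2) ^ 2 - a * (y₂ / 2) ^ 2 - b * (y₃ / 2) ^ 2 +
      a * b * (y₄ / 2) ^ 2 - 1 = 0 := by linear_combination -hy / 4
  rw [e1, e2]
  push_cast
  ring

/-- `q` has no `p` in its denominator. -/
def Rat.IsIntegralAt (p : ℕ) (q : ℚ) : Prop :=
  ∃ n d : ℤ, ¬ (p : ℤ) ∣ d ∧ q * d = n

theorem Rat.IsIntegralAt.add {p : ℕ} (hp : p.Prime) {q r : ℚ} (hq : q.IsIntegralAt p)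
    (hr : r.IsIntegralAt p) : (q + r).IsIntegralAt p := by
  obtain ⟨n, d, hd, h⟩ := hq
  obtain ⟨n', d', hd', h'⟩ := hr
  refine ⟨n * d' + n' * d, d * d', (Nat.prime_iff_prime_int.mp hp).not_dvd_mul hd hd', ?_⟩
  push_cast
  linear_combination (d' : ℚ) * h + d * h'

theorem Rat.isIntegralAt_natCast {p : ℕ} (hp : p.Prime) (n : ℕ) : (n : ℚ).IsIntegralAt p :=
  ⟨n, 1, (Nat.prime_iff_prime_int.mp hp).not_dvd_one, by simp⟩

theorem Rat.exists_eq_intCast_of_isIntegralAt {q : ℚ}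
    (h : ∀ p : ℕ, p.Prime → q.IsIntegralAt p) : ∃ m : ℤ, q = m := by
  suffices hd : q.den = 1 from ⟨q.num, ((Rat.den_eq_one_iff q).mp hd).symm⟩
  by_contra hne
  obtain ⟨p, hp, hpd⟩ := Nat.exists_prime_and_dvd hne
  obtain ⟨n, d, hd, hq⟩ := h p hp
  have e : q.num * d = n * q.den := by
    have h1 := Rat.mul_den_eq_num q
    have : (q.num : ℚ) * d = n * q.den := by linear_combination q.den * hq - d * h1
    exact_mod_cast this
  have hdvd : (p : ℤ) ∣ q.num := by
    refine ((Nat.prime_iff_prime_int.mp hp).dvd_or_dvd ?_).resolve_right hd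
    rw [e]
    exact (Int.natCast_dvd_natCast.mpr hpd).mul_left n
  refine hp.not_dvd_one ?_
  rw [← q.reduced]
  exact Nat.dvd_gcd (Int.natCast_dvd.mp hdvd) hpd

theorem Rat.exists_common_den (x y z w : ℚ) : ∃ X Y Z W D : ℤ, D ≠ 0 ∧
    x * D = X ∧ y * D = Y ∧ z * D = Z ∧ w * D = W := by
  refine ⟨x.num * (y.den * z.den * w.den), y.num * (x.den * z.den * w.den),
    z.num * (x.den * y.den * w.den), w.num * (x.den * y.den * z.den),
    x.den * y.den * z.den * w.den, by simp, ?_⟩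
  have hx := Rat.mul_den_eq_num x
  have hy := Rat.mul_den_eq_num y
  have hz := Rat.mul_den_eq_num z
  have hw := Rat.mul_den_eq_num w
  push_cast
  simp only [← hx, ← hy, ← hz, ← hw]
  refine ⟨?_, ?_, ?_, ?_⟩ <;> ring

/-- Descent: if a norm form takes the value `D²` with `c` dividing `D` only when `p` divides all
coordinates, then twice the first coordinate of a norm one element is integral at `p`. -/
theorem Rat.isIntegralAt_two_mul_of_descent {p : ℕ} (hp : p.Prime) {a b c : ℤ}
    (hc : ∀ d : ℤ, d ≠ 0 → ¬ c ∣ d → ∃ e f : ℤ, ¬ (p : ℤ) ∣ e ∧ 2 * e = f * d) (hpc : (p : ℤ) ∣ c)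
    (hdesc : ∀ x y z w d : ℤ, x ^ 2 - a * y ^ 2 - b * z ^ 2 + a * b * w ^ 2 = d ^ 2 → c ∣ d →
      (p : ℤ) ∣ x ∧ (p : ℤ) ∣ y ∧ (p : ℤ) ∣ z ∧ (p : ℤ) ∣ w)
    {x y z w : ℚ} (h : x ^ 2 - a * y ^ 2 - b * z ^ 2 + a * b * w ^ 2 = 1) :
    (2 * x).IsIntegralAt p := by
  have key : ∀ n : ℕ, ∀ X Y Z W D : ℤ, D.natAbs = n → D ≠ 0 →
      x * D = X → y * D = Y → z * D = Z → w * D = W → (2 * x).IsIntegralAt p := by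
    intro n
    induction n using Nat.strong_induction_on with
    | _ n ih =>
      intro X Y Z W D hDn hD hX hY hZ hW
      have hD' : (D : ℚ) ≠ 0 := by exact_mod_cast hD
      by_cases hcD : c ∣ D
      · have e : X ^ 2 - a * Y ^ 2 - b * Z ^ 2 + a * b * W ^ 2 = D ^ 2 := by
          have : (X : ℚ) ^ 2 - a * Y ^ 2 - b * Z ^ 2 + a * b * W ^ 2 = D ^ 2 := by
            rw [← hX, ← hY, ← hZ, ← hW]
            linear_combination D ^ 2 * h
          exact_mod_cast this
        obtain ⟨⟨X, rfl⟩, ⟨Y, rfl⟩, ⟨Z, rfl⟩, ⟨W, rfl⟩⟩ := hdesc _ _ _ _ _ e hcD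
        obtain ⟨E, rfl⟩ := hpc.trans hcD
        have hp0 : (p : ℚ) ≠ 0 := by exact_mod_cast hp.ne_zero
        have hE : E ≠ 0 := by rintro rfl; simp at hD
        have div : ∀ {q : ℚ} {Q : ℤ}, q * (p * E : ℤ) = (p * Q : ℤ) → q * E = Q := by
          intro q Q hq
          push_cast at hq
          apply mul_left_cancel₀ hp0
          linear_combination hq
        refine ih E.natAbs ?_ X Y Z W E rfl hE (div hX) (div hY) (div hZ) (div hW)
        rw [← hDn, Int.natAbs_mul, Int.natAbs_natCast]
        have := Int.natAbs_ne_zero.mpr hE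
        have := hp.two_le
        nlinarith [Nat.pos_of_ne_zero (Int.natAbs_ne_zero.mpr hE)]
      · obtain ⟨e, f, hpe, hef⟩ := hc D hD hcD
        have hef' : 2 * (e : ℚ) = f * D := by exact_mod_cast hef
        refine ⟨f * X, e, hpe, ?_⟩
        push_cast
        rw [← hX]
        linear_combination x * hef'
  obtain ⟨X, Y, Z, W, D, hD, hX, hY, hZ, hW⟩ := Rat.exists_common_den x y z w
  exact key _ X Y Z W D rfl hD hX hY hZ hW

theorem Int.sq_sub_five_mul_sq_emod_four (x y : ℤ) : (x ^ 2 - 5 * y ^ 2) % 4 ≠ 2 := by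
  have hx : x % 4 = 0 ∨ x % 4 = 1 ∨ x % 4 = 2 ∨ x % 4 = 3 := by omega
  have hy : y % 4 = 0 ∨ y % 4 = 1 ∨ y % 4 = 2 ∨ y % 4 = 3 := by omega
  rcases hx with hx | hx | hx | hx <;> rcases hy with hy | hy | hy | hy <;>
    simp [sq, Int.sub_emod, Int.mul_emod, hx, hy]

theorem Int.even_or_emod_eight_of_sq_sub_five_mul_sq {x y : ℤ} (h : (x ^ 2 - 5 * y ^ 2) % 2 = 0) :
    (2 ∣ x ∧ 2 ∣ y) ∨ (x ^ 2 - 5 * y ^ 2) % 8 = 4 := by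
  have sq_even : ∀ z : ℤ, z % 2 = 0 → z ^ 2 % 2 = 0 := fun z hz => by
    simp [sq, Int.mul_emod, hz]
  rcases Int.emod_two_eq_zero_or_one x with hx | hx <;>
    rcases Int.emod_two_eq_zero_or_one y with hy | hy
  · exact .inl ⟨Int.dvd_of_emod_eq_zero hx, Int.dvd_of_emod_eq_zero hy⟩
  · have := sq_even x hx
    have := Int.sq_emod_eight_of_odd hy
    omega
  · have := sq_even y hy
    have := Int.sq_emod_eight_of_odd hx
    omega
  · have := Int.sq_emod_eight_of_odd hx
    have := Int.sq_emod_eight_of_odd hy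
    omega

theorem Int.two_dvd_of_four_dvd {x y z w d : ℤ}
    (h : x ^ 2 - 5 * y ^ 2 - 2 * z ^ 2 + 5 * 2 * w ^ 2 = d ^ 2) (hd : 4 ∣ d) :
    2 ∣ x ∧ 2 ∣ y ∧ 2 ∣ z ∧ 2 ∣ w := by
  obtain ⟨k, rfl⟩ := hd
  have h4 := Int.sq_sub_five_mul_sq_emod_four z w
  have hxy : 2 ∣ x ∧ 2 ∣ y := by
    refine (Int.even_or_emod_eight_of_sq_sub_five_mul_sq
      (by rw [mul_pow] at h; omega)).resolve_right fun h8 => ?_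
    rw [mul_pow] at h
    omega
  obtain ⟨⟨x, rfl⟩, ⟨y, rfl⟩⟩ := hxy
  have h4' := Int.sq_sub_five_mul_sq_emod_four x y
  simp only [mul_pow] at h
  refine ⟨dvd_mul_right _ _, dvd_mul_right _ _, (Int.even_or_emod_eight_of_sq_sub_five_mul_sq
    (by omega)).resolve_right fun h8 => ?_⟩
  omega

theorem Int.dvd_of_dvd_sq_sub_mul_sq {p : ℕ} (hp : p.Prime) {a : ℤ} (ha : J(a | p) = -1) {x y : ℤ}
    (h : (p : ℤ) ∣ x ^ 2 - a * y ^ 2) : (p : ℤ) ∣ x ∧ (p : ℤ) ∣ y := by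
  have hp' := Nat.prime_iff_prime_int.mp hp
  have hy : (p : ℤ) ∣ y := by
    by_contra hy
    have h1 : J(x ^ 2 | p) = J(a * y ^ 2 | p) :=
      (jacobiSym.mod_left' (Int.modEq_iff_dvd.mpr h)).symm
    rw [jacobiSym.mul_left, jacobiSym.pow_left, jacobiSym.pow_left,
      jacobiSym_sq_eq_one_of_not_dvd hp hy, ha] at h1
    nlinarith [sq_nonneg J(x | p)]
  refine ⟨hp'.dvd_of_dvd_pow (n := 2) ?_, hy⟩
  have := dvd_add h ((dvd_pow hy two_ne_zero).mul_left a)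
  rwa [sub_add_cancel] at this

theorem Int.prime_dvd_of_norm_eq_sq {p : ℕ} (hp : p.Prime) {a : ℤ} (ha : J(a | p) = -1)
    {x y z w d : ℤ} (h : x ^ 2 - a * y ^ 2 - p * z ^ 2 + a * p * w ^ 2 = d ^ 2)
    (hd : (p : ℤ) ∣ d) :
    (p : ℤ) ∣ x ∧ (p : ℤ) ∣ y ∧ (p : ℤ) ∣ z ∧ (p : ℤ) ∣ w := by
  have hp0 : (p : ℤ) ≠ 0 := by exact_mod_cast hp.ne_zero
  obtain ⟨d, rfl⟩ := hd
  obtain ⟨⟨x, rfl⟩, ⟨y, rfl⟩⟩ := Int.dvd_of_dvd_sq_sub_mul_sq hp ha (x := x) (y := y)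
    ⟨p * d ^ 2 + z ^ 2 - a * w ^ 2, by linear_combination h⟩
  refine ⟨dvd_mul_right _ _, dvd_mul_right _ _, Int.dvd_of_dvd_sq_sub_mul_sq hp ha
    ⟨x ^ 2 - a * y ^ 2 - d ^ 2, mul_left_cancel₀ hp0 ?_⟩⟩
  linear_combination -h

/-- For each prime `p` there is a quaternion algebra over `ℚ` in which the traces of norm one
elements are integral at `p`. -/
theorem exists_pos_isIntegralAt {p : ℕ} (hp : p.Prime) : ∃ a b : ℤ, 0 < a ∧ 0 < b ∧
    ∀ x y z w : ℚ, x ^ 2 - a * y ^ 2 - b * z ^ 2 + a * b * w ^ 2 = 1 →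
      (2 * x).IsIntegralAt p := by
  by_cases hp2 : p = 2
  · subst hp2
    refine ⟨5, 2, by norm_num, by norm_num, fun x y z w h =>
      Rat.isIntegralAt_two_mul_of_descent hp (c := 4) ?_ (by norm_num)
        (fun x y z w d h hd => Int.two_dvd_of_four_dvd h hd) h⟩
    intro d hd h4
    rcases Int.even_or_odd' d with ⟨k, rfl | rfl⟩
    · exact ⟨k, 1, by omega, by ring⟩
    · exact ⟨2 * k + 1, 2, by omega, by ring⟩
  · obtain ⟨r, hr⟩ := exists_jacobiSym_eq_neg_one hp hp2
    have hpos : (0 : ℤ) < p := by exact_mod_cast hp.pos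
    have hJ : J(r % p | p) = -1 := by rwa [← jacobiSym.mod_left]
    refine ⟨r % p, p, (Int.emod_nonneg r hpos.ne').lt_of_ne ?_, hpos, fun x y z w h =>
      Rat.isIntegralAt_two_mul_of_descent hp (c := p) ?_ dvd_rfl
        (fun x y z w d h hd => Int.prime_dvd_of_norm_eq_sq hp hJ h hd) h⟩
    · intro h0
      rw [← h0, jacobiSym.zero_left hp.one_lt] at hJ
      norm_num at hJ
    · exact fun d _ hpd => ⟨d, 2, hpd, rfl⟩

theorem eq_zero_of_sum_four_sq_eq_zero {x y z w : ℚ} (h : x ^ 2 + y ^ 2 + z ^ 2 + w ^ 2 = 0) :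
    x = 0 ∧ y = 0 ∧ z = 0 ∧ w = 0 := by
  refine ⟨?_, ?_, ?_, ?_⟩ <;> apply pow_eq_zero_iff two_ne_zero |>.mp <;>
    linarith [sq_nonneg x, sq_nonneg y, sq_nonneg z, sq_nonneg w]

theorem exists_int_of_exists_solution {t : ℚ} (h : ∀ a b : ℚ,
      ∃ a₁ a₂ a₃ a₄ b₁ b₂ b₃ b₄ x₁ x₂ x₃ x₄ y₁ y₂ y₃ y₄ n : ℚ,
        (a + a₁ ^ 2 + a₂ ^ 2 + a₃ ^ 2 + a₄ ^ 2) *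
          (b + b₁ ^ 2 + b₂ ^ 2 + b₃ ^ 2 + b₄ ^ 2) *
          ((x₁ ^ 2 - a * x₂ ^ 2 - b * x₃ ^ 2 + a * b * x₄ ^ 2 - 1) ^ 2 +
            (y₁ ^ 2 - a * y₂ ^ 2 - b * y₃ ^ 2 + a * b * y₄ ^ 2 - 1) ^ 2 +
            (∏ j ∈ Finset.range 2310, (n - (j : ℚ))) ^ 2 +
            (2 * x₁ + 2 * y₁ + n - t) ^ 2) = 0) : ∃ m : ℤ, t = m := by
  refine Rat.exists_eq_intCast_of_isIntegralAt fun p hp => ?_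
  obtain ⟨a, b, ha, hb, hab⟩ := exists_pos_isIntegralAt hp
  have ha' : (0 : ℚ) < a := by exact_mod_cast ha
  have hb' : (0 : ℚ) < b := by exact_mod_cast hb
  obtain ⟨a₁, a₂, a₃, a₄, b₁, b₂, b₃, b₄, x₁, x₂, x₃, x₄, y₁, y₂, y₃, y₄, n, h⟩ := h a b
  have h0 := (mul_eq_zero.mp h).resolve_left
    (mul_ne_zero (ne_of_gt (by positivity)) (ne_of_gt (by positivity)))
  obtain ⟨h1, h2, h3, h4⟩ := eq_zero_of_sum_four_sq_eq_zero h0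
  obtain ⟨j, -, hj⟩ := Finset.prod_eq_zero_iff.mp h3
  rw [← sub_eq_zero.mp h4, sub_eq_zero.mp hj]
  exact ((hab _ _ _ _ (sub_eq_zero.mp h1)).add hp (hab _ _ _ _ (sub_eq_zero.mp h2))).add hp
    (Rat.isIntegralAt_natCast hp j)

/-- (Poonen) A rational number `t` is an integer iff for all `a, b ∈ ℚ` there exist
`a₁, …, a₄, b₁, …, b₄, x₁, …, x₄, y₁, …, y₄, n ∈ ℚ` satisfying Poonen's equation.
In particular, `ℤ` is definable over `ℚ` by a `∀∃`-formula with two universal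
quantifiers. -/
theorem poonen_two_universal_quantifiers (t : ℚ) :
    (∃ m : ℤ, t = (m : ℚ)) ↔
      ∀ a b : ℚ, ∃ a₁ a₂ a₃ a₄ b₁ b₂ b₃ b₄ x₁ x₂ x₃ x₄ y₁ y₂ y₃ y₄ n : ℚ,
        (a + a₁ ^ 2 + a₂ ^ 2 + a₃ ^ 2 + a₄ ^ 2) *
          (b + b₁ ^ 2 + b₂ ^ 2 + b₃ ^ 2 + b₄ ^ 2) *
          ((x₁ ^ 2 - a * x₂ ^ 2 - b * x₃ ^ 2 + a * b * x₄ ^ 2 - 1) ^ 2 +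
            (y₁ ^ 2 - a * y₂ ^ 2 - b * y₃ ^ 2 + a * b * y₄ ^ 2 - 1) ^ 2 +
            (∏ j ∈ Finset.range 2310, (n - (j : ℚ))) ^ 2 +
            (2 * x₁ + 2 * y₁ + n - t) ^ 2) = 0 := by
  refine ⟨?_, exists_int_of_exists_solution⟩
  rintro ⟨m, rfl⟩ a b
  exact exists_solution_of_int m a b
end
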